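/- (Two-sided global C² estimate.) For every K > 0 there exist constants ε > 0 and C₃₆ > 0, depending only on n, Ω, Ω̃, h, h̃, θ, θ̃ and K, with the following property. Let f ∈ 𝒜 with ‖f‖_{C²(Ω̄ × closure(Ω̃))} ≤ K satisfy condition (OSC), sup |D_x f| ≤ ε and sup |D_{xp} f| ≤ ε. Then every smooth uniformly convex solution u of the second boundary value problem with data (f, c) satisfies (1/C₃₆)·Iₙ ≤ D²u(x) ≤ C₃₆·Iₙ for all x ∈ Ω̄, in the sense of symmetric matrices. -/

import Mathlib

open Set MeasureTheory Matrix
open scoped Topology RealInnerProductSpace NNReal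

noncomputable section

abbrev Euc (n : ℕ) := EuclideanSpace ℝ (Fin n)

variable {n : ℕ}

/-- Hessian matrix of `u` at `x`. -/
def Hess (u : Euc n → ℝ) (x : Euc n) : Matrix (Fin n) (Fin n) ℝ :=
  fun i j => iteratedFDeriv ℝ 2 u x ![EuclideanSpace.single i 1, EuclideanSpace.single j 1]

/-- `A ≤ B` in the sense of symmetric matrices. -/
def MatLE (A B : Matrix (Fin n) (Fin n) ℝ) : Prop := (B - A).PosSemidef

/-- The Minkowski mean-curvature operator `div (∇u / √(1 - |∇u|²))`. -/
def MinkDiv (u : Euc n → ℝ) (x : Euc n) : ℝ :=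
  ∑ i, fderiv ℝ (fun y => (Real.sqrt (1 - ‖gradient u y‖ ^ 2))⁻¹ * gradient u y i) x
    (EuclideanSpace.single i 1)

/-- The Euclidean mean-curvature operator `div (∇u / √(1 + |∇u|²))`. -/
def EucDiv (u : Euc n → ℝ) (x : Euc n) : ℝ :=
  ∑ i, fderiv ℝ (fun y => (Real.sqrt (1 + ‖gradient u y‖ ^ 2))⁻¹ * gradient u y i) x
    (EuclideanSpace.single i 1)

/-- `S(p) = (1/v)(Iₙ + p pᵀ / v²)`, `v = √(1-|p|²)`. -/
def Smat (p : Euc n) : Matrix (Fin n) (Fin n) ℝ :=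
  (Real.sqrt (1 - ‖p‖ ^ 2))⁻¹ •
    ((1 : Matrix (Fin n) (Fin n) ℝ) +
      (1 - ‖p‖ ^ 2)⁻¹ • Matrix.vecMulVec (fun i => p i) (fun j => p j))

/-- `B(p) = Iₙ + p pᵀ / (v (1 + v))`, `v = √(1-|p|²)`. -/
def Bmat (p : Euc n) : Matrix (Fin n) (Fin n) ℝ :=
  (1 : Matrix (Fin n) (Fin n) ℝ) +
    (Real.sqrt (1 - ‖p‖ ^ 2) * (1 + Real.sqrt (1 - ‖p‖ ^ 2)))⁻¹ •
      Matrix.vecMulVec (fun i => p i) (fun j => p j)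

/-- `A(x) = (1/v)·B(∇u)·D²u·B(∇u)`: its eigenvalues are the principal curvatures. -/
def Amat (u : Euc n → ℝ) (x : Euc n) : Matrix (Fin n) (Fin n) ℝ :=
  (Real.sqrt (1 - ‖gradient u x‖ ^ 2))⁻¹ •
    (Bmat (gradient u x) * Hess u x * Bmat (gradient u x))

/-- supremum of the quadratic form of `A` over the unit sphere (the operator
norm / largest eigenvalue for a positive semidefinite symmetric `A`). -/
def quadSup (A : Matrix (Fin n) (Fin n) ℝ) : ℝ :=
  ⨆ ξ : Metric.sphere (0 : Euc n) 1,
    (fun i => (ξ : Euc n) i) ⬝ᵥ A.mulVec (fun i => (ξ : Euc n) i)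

/-- The domains `Ω = {h̃ > 0}`, `Ω̃ = {h > 0}` are bounded uniformly convex domains
with smooth boundary, described by the defining functions `h̃` and `h`. -/
def DomainSetup (Ω Ωt : Set (Euc n)) (ht h : Euc n → ℝ) (θt θ : ℝ) : Prop :=
  IsOpen Ω ∧ IsOpen Ωt ∧ Bornology.IsBounded Ω ∧ Bornology.IsBounded Ωt ∧
  Ω.Nonempty ∧ Ωt.Nonempty ∧
  ContDiff ℝ (⊤ : ℕ∞) ht ∧ ContDiff ℝ (⊤ : ℕ∞) h ∧
  Ω = {x | 0 < ht x} ∧ Ωt = {y | 0 < h y} ∧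
  (∀ x ∈ frontier Ω, ‖gradient ht x‖ = 1) ∧
  (∀ y ∈ frontier Ωt, ‖gradient h y‖ = 1) ∧
  0 < θt ∧ 0 < θ ∧
  (∀ x : Euc n, MatLE (Hess ht x) ((-θt) • (1 : Matrix (Fin n) (Fin n) ℝ))) ∧
  (∀ y : Euc n, MatLE (Hess h y) ((-θ) • (1 : Matrix (Fin n) (Fin n) ℝ)))

/-- `f ∈ 𝒜`: `f` is `C²` on `Ω̄ × closure Ω̃` and concave in `x`. -/
def InA (Ω Ωt : Set (Euc n)) (f : Euc n × Euc n → ℝ) : Prop :=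
  ContDiffOn ℝ 2 f (closure Ω ×ˢ closure Ωt) ∧
  ∀ p ∈ closure Ωt, ConcaveOn ℝ (closure Ω) (fun x => f (x, p))

/-- Condition (OSC): `osc f ≤ (n/2)(|Ω̃|/|Ω|)^{1/n}`. -/
def OSCcond (Ω Ωt : Set (Euc n)) (f : Euc n × Euc n → ℝ) : Prop :=
  ∀ x ∈ closure Ω, ∀ y ∈ closure Ω, ∀ p ∈ closure Ωt, ∀ q ∈ closure Ωt,
    |f (x, p) - f (y, q)| ≤
      ((n : ℝ) / 2) * ((volume Ωt).toReal / (volume Ω).toReal) ^ ((1 : ℝ) / n)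

/-- `‖f‖_{C²(Ω̄ × closure Ω̃)} ≤ K`. -/
def C2Bound (Ω Ωt : Set (Euc n)) (f : Euc n × Euc n → ℝ) (K : ℝ) : Prop :=
  ContDiffOn ℝ 2 f (closure Ω ×ˢ closure Ωt) ∧
  ∀ z ∈ closure Ω ×ˢ closure Ωt,
    |f z| ≤ K ∧ ‖fderiv ℝ f z‖ ≤ K ∧ ‖iteratedFDeriv ℝ 2 f z‖ ≤ K

/-- `sup |D_x f| ≤ ε` on `Ω̄ × closure Ω̃`. -/
def DxBound (Ω Ωt : Set (Euc n)) (f : Euc n × Euc n → ℝ) (ε : ℝ) : Prop :=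
  ∀ x ∈ closure Ω, ∀ p ∈ closure Ωt, ‖fderiv ℝ (fun x' => f (x', p)) x‖ ≤ ε

/-- `sup |D_{xp} f| ≤ ε` on `Ω̄ × closure Ω̃`. -/
def DxpBound (Ω Ωt : Set (Euc n)) (f : Euc n × Euc n → ℝ) (ε : ℝ) : Prop :=
  ∀ x ∈ closure Ω, ∀ p ∈ closure Ωt,
    ‖fderiv ℝ (fun p' => fderiv ℝ (fun x' => f (x', p')) x) p‖ ≤ ε

/-- A strictly convex solution of the second boundary value problem. -/
def IsStrictSol (Ω Ωt : Set (Euc n)) (f : Euc n × Euc n → ℝ) (c : ℝ) (u : Euc n → ℝ) : Prop :=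
  ContDiffOn ℝ 2 u (closure Ω) ∧
  (∀ x ∈ closure Ω, (Hess u x).PosDef) ∧
  (∀ x ∈ closure Ω, ‖gradient u x‖ < 1) ∧
  (∀ x ∈ Ω, MinkDiv u x = f (x, gradient u x) + c) ∧
  gradient u '' Ω = Ωt

/-- A smooth uniformly convex solution of the second boundary value problem. -/
def IsSmoothSol (Ω Ωt : Set (Euc n)) (f : Euc n × Euc n → ℝ) (c : ℝ) (u : Euc n → ℝ) : Prop :=
  ContDiffOn ℝ (⊤ : ℕ∞) u (closure Ω) ∧
  (∃ δ : ℝ, 0 < δ ∧ ∀ x ∈ closure Ω, MatLE (δ • (1 : Matrix (Fin n) (Fin n) ℝ)) (Hess u x)) ∧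
  (∀ x ∈ closure Ω, ‖gradient u x‖ < 1) ∧
  (∀ x ∈ Ω, MinkDiv u x = f (x, gradient u x) + c) ∧
  gradient u '' Ω = Ωt

/-- A uniformly convex `C^{2}` solution of the second boundary value problem. -/
def IsUCSol (Ω Ωt : Set (Euc n)) (f : Euc n × Euc n → ℝ) (c : ℝ) (u : Euc n → ℝ) : Prop :=
  ContDiffOn ℝ 2 u (closure Ω) ∧
  (∃ δ : ℝ, 0 < δ ∧ ∀ x ∈ closure Ω, MatLE (δ • (1 : Matrix (Fin n) (Fin n) ℝ)) (Hess u x)) ∧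
  (∀ x ∈ closure Ω, ‖gradient u x‖ < 1) ∧
  (∀ x ∈ Ω, MinkDiv u x = f (x, gradient u x) + c) ∧
  gradient u '' Ω = Ωt

/-- A uniformly convex `C^{4,α}` solution of the second boundary value problem
for the Minkowski mean-curvature operator. -/
def IsC4Sol (Ω Ωt : Set (Euc n)) (f : Euc n × Euc n → ℝ) (c : ℝ) (u : Euc n → ℝ)
    (α : ℝ) : Prop :=
  ContDiffOn ℝ 4 u (closure Ω) ∧
  (∃ C : ℝ≥0, HolderOnWith C (Real.toNNReal α) (fun x => iteratedFDeriv ℝ 4 u x) (closure Ω)) ∧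
  (∃ δ : ℝ, 0 < δ ∧ ∀ x ∈ closure Ω, MatLE (δ • (1 : Matrix (Fin n) (Fin n) ℝ)) (Hess u x)) ∧
  (∀ x ∈ closure Ω, ‖gradient u x‖ < 1) ∧
  (∀ x ∈ Ω, MinkDiv u x = f (x, gradient u x) + c) ∧
  gradient u '' Ω = Ωt

/-- A uniformly convex `C^{4,α}` solution of the second boundary value problem
for the Euclidean mean-curvature operator. -/
def IsC4SolE (Ω Ωt : Set (Euc n)) (f : Euc n × Euc n → ℝ) (c : ℝ) (u : Euc n → ℝ)
    (α : ℝ) : Prop :=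
  ContDiffOn ℝ 4 u (closure Ω) ∧
  (∃ C : ℝ≥0, HolderOnWith C (Real.toNNReal α) (fun x => iteratedFDeriv ℝ 4 u x) (closure Ω)) ∧
  (∃ δ : ℝ, 0 < δ ∧ ∀ x ∈ closure Ω, MatLE (δ • (1 : Matrix (Fin n) (Fin n) ℝ)) (Hess u x)) ∧
  (∀ x ∈ Ω, EucDiv u x = f (x, gradient u x) + c) ∧
  gradient u '' Ω = Ωt

/-- `ũ` is the Legendre transform of `u`. -/
def IsLegendre (Ω Ωt : Set (Euc n)) (u ut : Euc n → ℝ) : Prop :=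
  ContDiffOn ℝ (⊤ : ℕ∞) ut (closure Ωt) ∧
  (∀ x ∈ closure Ω, ut (gradient u x) = ⟪x, gradient u x⟫ - u x) ∧
  (∀ x ∈ closure Ω, gradient ut (gradient u x) = x) ∧
  (∀ x ∈ closure Ω, Hess ut (gradient u x) = (Hess u x)⁻¹)

section Jets

variable {F G H : Type*} [NormedAddCommGroup F] [NormedSpace ℝ F]
  [NormedAddCommGroup G] [NormedSpace ℝ G] [NormedAddCommGroup H] [NormedSpace ℝ H]

/-- The curve `φ` has value `a`, first derivative `b` and second derivative `c` at `0`. -/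
def Jet2 (φ : ℝ → F) (a b c : F) : Prop :=
  φ 0 = a ∧ ∃ φ' : ℝ → F, (∀ᶠ t in 𝓝 0, HasDerivAt φ (φ' t) t) ∧ φ' 0 = b ∧ HasDerivAt φ' c 0

lemma Jet2.const (a : F) : Jet2 (fun _ => a) a 0 0 :=
  ⟨rfl, fun _ => 0, Filter.Eventually.of_forall fun t => hasDerivAt_const t a, rfl,
    hasDerivAt_const _ _⟩

lemma Jet2.line (x v : F) : Jet2 (fun t : ℝ => x + t • v) x v 0 := by
  refine ⟨by simp, fun _ => v, Filter.Eventually.of_forall fun t => ?_, rfl, hasDerivAt_const _ _⟩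
  simpa using ((hasDerivAt_id t).smul_const v).const_add x

lemma Jet2.clm {φ : ℝ → F} {a b c : F} (hφ : Jet2 φ a b c) (L : F →L[ℝ] G) :
    Jet2 (fun t => L (φ t)) (L a) (L b) (L c) := by
  obtain ⟨h0, φ', h1, h2, h3⟩ := hφ
  refine ⟨by simp only [h0], fun t => L (φ' t), ?_, by simp only [h2], ?_⟩
  · filter_upwards [h1] with t ht using L.hasFDerivAt.comp_hasDerivAt t ht
  · exact L.hasFDerivAt.comp_hasDerivAt 0 h3

lemma Jet2.prodMk {φ : ℝ → F} {ψ : ℝ → G} {a b c : F} {a' b' c' : G} (hφ : Jet2 φ a b c)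
    (hψ : Jet2 ψ a' b' c') : Jet2 (fun t => (φ t, ψ t)) (a, a') (b, b') (c, c') := by
  obtain ⟨h0, φ', h1, h2, h3⟩ := hφ
  obtain ⟨k0, ψ', k1, k2, k3⟩ := hψ
  refine ⟨by simp only [h0, k0], fun t => (φ' t, ψ' t), ?_, by simp only [h2, k2], h3.prodMk k3⟩
  filter_upwards [h1, k1] with t ht kt using ht.prodMk kt

lemma Jet2.add {φ ψ : ℝ → F} {a b c a' b' c' : F} (hφ : Jet2 φ a b c)
    (hψ : Jet2 ψ a' b' c') : Jet2 (fun t => φ t + ψ t) (a + a') (b + b') (c + c') := by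
  simpa using (hφ.prodMk hψ).clm (ContinuousLinearMap.fst ℝ F F + ContinuousLinearMap.snd ℝ F F)

lemma Jet2.sub {φ ψ : ℝ → F} {a b c a' b' c' : F} (hφ : Jet2 φ a b c)
    (hψ : Jet2 ψ a' b' c') : Jet2 (fun t => φ t - ψ t) (a - a') (b - b') (c - c') := by
  simpa using (hφ.prodMk hψ).clm (ContinuousLinearMap.fst ℝ F F - ContinuousLinearMap.snd ℝ F F)

lemma Jet2.const_smul {φ : ℝ → F} {a b c : F} (hφ : Jet2 φ a b c) (r : ℝ) :
    Jet2 (fun t => r • φ t) (r • a) (r • b) (r • c) := by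
  simpa using hφ.clm (r • ContinuousLinearMap.id ℝ F)

lemma Jet2.bilin {φ : ℝ → F} {ψ : ℝ → G} {a b c : F} {a' b' c' : G} (hφ : Jet2 φ a b c)
    (hψ : Jet2 ψ a' b' c') (B : F →L[ℝ] G →L[ℝ] H) :
    Jet2 (fun t => B (φ t) (ψ t)) (B a a') (B b a' + B a b')
      (B c a' + (2 : ℝ) • B b b' + B a c') := by
  obtain ⟨h0, φ', h1, h2, h3⟩ := hφ
  obtain ⟨k0, ψ', k1, k2, k3⟩ := hψ
  have key : ∀ (φ : ℝ → F) (ψ : ℝ → G) (x : F) (y : G) (t : ℝ), HasDerivAt φ x t →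
      HasDerivAt ψ y t → HasDerivAt (fun t => B (φ t) (ψ t)) (B x (ψ t) + B (φ t) y) t := by
    intro φ ψ x y t h k
    exact (B.hasFDerivAt.comp_hasDerivAt t h).clm_apply k
  refine ⟨by simp only [h0, k0], fun t => B (φ' t) (ψ t) + B (φ t) (ψ' t), ?_, by
    simp only [h2, k2, h0, k0], ?_⟩
  · filter_upwards [h1, k1] with t ht kt using key _ _ _ _ _ ht kt
  · have h4 := (key _ _ _ _ 0 h3 k1.self_of_nhds).add (key _ _ _ _ 0 h1.self_of_nhds k3)
    rw [h0, k0, h2, k2] at h4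
    refine h4.congr_deriv ?_
    rw [two_smul]
    abel

lemma Jet2.mul {φ ψ : ℝ → ℝ} {a b c a' b' c' : ℝ} (hφ : Jet2 φ a b c)
    (hψ : Jet2 ψ a' b' c') :
    Jet2 (fun t => φ t * ψ t) (a * a') (b * a' + a * b') (c * a' + 2 * (b * b') + a * c') := by
  simpa using hφ.bilin hψ (ContinuousLinearMap.mul ℝ ℝ)

lemma Jet2.apply {φ : ℝ → F →L[ℝ] G} {ψ : ℝ → F} {a b c : F →L[ℝ] G} {a' b' c' : F}
    (hφ : Jet2 φ a b c) (hψ : Jet2 ψ a' b' c') :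
    Jet2 (fun t => φ t (ψ t)) (a a') (b a' + a b') (c a' + (2 : ℝ) • b b' + a c') :=
  hφ.bilin hψ (ContinuousLinearMap.id ℝ (F →L[ℝ] G))

lemma Jet2.inner {X : Type*} [NormedAddCommGroup X] [InnerProductSpace ℝ X] {φ ψ : ℝ → X}
    {a b c a' b' c' : X} (hφ : Jet2 φ a b c) (hψ : Jet2 ψ a' b' c') :
    Jet2 (fun t => ⟪φ t, ψ t⟫) ⟪a, a'⟫ (⟪b, a'⟫ + ⟪a, b'⟫)
      (⟪c, a'⟫ + 2 * ⟪b, b'⟫ + ⟪a, c'⟫) := by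
  exact hφ.bilin hψ (innerSL ℝ)

lemma Jet2.sum {ι : Type*} (s : Finset ι) {φ : ι → ℝ → F} {a b c : ι → F}
    (hφ : ∀ i ∈ s, Jet2 (φ i) (a i) (b i) (c i)) :
    Jet2 (fun t => ∑ i ∈ s, φ i t) (∑ i ∈ s, a i) (∑ i ∈ s, b i) (∑ i ∈ s, c i) := by
  classical
  induction s using Finset.induction_on with
  | empty => simpa using Jet2.const (0 : F)
  | insert i s hi ih =>
    simp only [Finset.sum_insert hi]
    exact (hφ i (Finset.mem_insert_self i s)).add
      (ih fun j hj => hφ j (Finset.mem_insert_of_mem hj))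

lemma Jet2.comp {φ : ℝ → F} {a b c : F} (hφ : Jet2 φ a b c) {Ψ : F → G}
    (hΨ : ContDiffAt ℝ 2 Ψ a) :
    Jet2 (fun t => Ψ (φ t)) (Ψ a) (fderiv ℝ Ψ a b)
      (fderiv ℝ (fderiv ℝ Ψ) a b b + fderiv ℝ Ψ a c) := by
  obtain ⟨h0, φ', h1, h2, h3⟩ := hφ
  have hd : ∀ᶠ y in 𝓝 a, DifferentiableAt ℝ Ψ y := by
    filter_upwards [hΨ.eventually (by simp)] with y hy using hy.differentiableAt (by simp)
  have hc : Filter.Tendsto φ (𝓝 0) (𝓝 a) := by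
    rw [← h0]; exact h1.self_of_nhds.continuousAt
  have hdd : DifferentiableAt ℝ (fderiv ℝ Ψ) a :=
    (hΨ.fderiv_right (m := 1) (by norm_num)).differentiableAt (by simp)
  refine ⟨by simp only [h0], fun t => fderiv ℝ Ψ (φ t) (φ' t), ?_, by simp only [h0, h2], ?_⟩
  · filter_upwards [h1, hc.eventually hd] with t ht hdt
    exact hdt.hasFDerivAt.comp_hasDerivAt t ht
  · have h4 : HasDerivAt (fun t => fderiv ℝ Ψ (φ t)) (fderiv ℝ (fderiv ℝ Ψ) a b) 0 := by
      have h5 := h1.self_of_nhds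
      rw [h2] at h5
      rw [← h0] at hdd ⊢
      exact hdd.hasFDerivAt.comp_hasDerivAt 0 h5
    have h6 := h4.clm_apply h3
    rwa [h0, h2] at h6

lemma Jet2.unique {φ ψ : ℝ → F} {a b c a' b' c' : F} (hφ : Jet2 φ a b c) (hψ : Jet2 ψ a' b' c')
    (h : φ =ᶠ[𝓝 0] ψ) : b = b' ∧ c = c' := by
  obtain ⟨h0, φ', h1, h2, h3⟩ := hφ
  obtain ⟨k0, ψ', k1, k2, k3⟩ := hψ
  have e : φ' =ᶠ[𝓝 0] ψ' := by
    filter_upwards [h1, k1, h.eventuallyEq_nhds] with t ht kt e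
    exact (ht.congr_of_eventuallyEq e.symm).unique kt
  exact ⟨by rw [← h2, ← k2, e.self_of_nhds],
    (h3.congr_of_eventuallyEq e.symm).unique k3⟩

lemma Jet2.of_isLocalMax {φ : ℝ → ℝ} {a b c : ℝ} (hφ : Jet2 φ a b c) (h : IsLocalMax φ 0) :
    b = 0 ∧ c ≤ 0 := by
  have hφ' := hφ
  obtain ⟨h0, φ', h1, h2, h3⟩ := hφ
  have hb : φ' 0 = 0 := h.hasDerivAt_eq_zero h1.self_of_nhds
  refine ⟨by rw [← h2, hb], ?_⟩
  by_contra! hc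
  have e : deriv φ =ᶠ[𝓝 0] φ' := by
    filter_upwards [h1] with t ht using ht.deriv
  have hmin : IsLocalMin φ 0 := by
    apply isLocalMin_of_deriv_deriv_pos
    · rw [(h3.congr_of_eventuallyEq e).deriv]; exact hc
    · rw [e.self_of_nhds, hb]
    · exact h1.self_of_nhds.continuousAt
  have e2 : φ =ᶠ[𝓝 0] fun _ => φ 0 := by
    filter_upwards [h, hmin] with t ht ht' using le_antisymm ht ht'
  exact hc.ne' (hφ'.unique (Jet2.const _) e2).2

/-- The second-order jet of a `C²` map along a line. -/
lemma jet2_along_line {Ψ : F → G} {x : F} (hΨ : ContDiffAt ℝ 2 Ψ x) (v : F) :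
    Jet2 (fun t : ℝ => Ψ (x + t • v)) (Ψ x) (fderiv ℝ Ψ x v)
      (fderiv ℝ (fderiv ℝ Ψ) x v v) := by
  simpa using (Jet2.line x v).comp hΨ

end Jets

lemma tendsto_line {F : Type*} [NormedAddCommGroup F] [NormedSpace ℝ F] (x v : F) :
    Filter.Tendsto (fun t : ℝ => x + t • v) (𝓝 0) (𝓝 x) := by
  have : Continuous fun t : ℝ => x + t • v := by fun_prop
  simpa using this.tendsto 0

/-- The contraction of a quadratic form `q` with the matrix `(1 - |p|²) I + p pᵀ`. -/
def contr (p : Euc n) (q : Euc n → ℝ) : ℝ :=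
  (1 - ‖p‖ ^ 2) * ∑ i, q (EuclideanSpace.single i 1) + q p

lemma contr_add (p : Euc n) (q q' : Euc n → ℝ) :
    contr p (fun v => q v + q' v) = contr p q + contr p q' := by
  simp only [contr, Finset.sum_add_distrib]; ring

lemma contr_sub (p : Euc n) (q q' : Euc n → ℝ) :
    contr p (fun v => q v - q' v) = contr p q - contr p q' := by
  simp only [contr, Finset.sum_sub_distrib]; ring

lemma contr_mul (p : Euc n) (r : ℝ) (q : Euc n → ℝ) :
    contr p (fun v => r * q v) = r * contr p q := by
  simp only [contr, ← Finset.mul_sum]; ring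

lemma contr_mono {p : Euc n} (hp : ‖p‖ ^ 2 ≤ 1) {q q' : Euc n → ℝ} (h : ∀ v, q v ≤ q' v) :
    contr p q ≤ contr p q' := by
  unfold contr
  have := Finset.sum_le_sum (s := Finset.univ)
    (fun i _ => h (EuclideanSpace.single i (1 : ℝ) : Euc n))
  have h2 := mul_le_mul_of_nonneg_left this (sub_nonneg.2 hp)
  linarith [h p]

/-- A field `G` with symmetric derivative on the open set `E` that solves
`(1 - |G|²) tr DG + ⟨DG G, G⟩ = g(x, G)`. -/
structure InteriorSol (E : Set (Euc n)) (G : Euc n → Euc n) (g : Euc n × Euc n → ℝ) : Prop where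
  isOpen : IsOpen E
  smooth : ∀ x ∈ E, ContDiffAt ℝ (⊤ : ℕ∞) G x
  symm : ∀ x ∈ E, ∀ v w, ⟪fderiv ℝ G x v, w⟫ = ⟪v, fderiv ℝ G x w⟫
  eqn : ∀ x ∈ E, contr (G x) (fun v => ⟪fderiv ℝ G x v, v⟫) = g (x, G x)
  rhs : ∀ x ∈ E, ContDiffAt ℝ 2 g (x, G x)

namespace InteriorSol

variable {E : Set (Euc n)} {G : Euc n → Euc n} {g : Euc n × Euc n → ℝ}

lemma smooth_fderiv (S : InteriorSol E G g) {x : Euc n} (hx : x ∈ E) :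
    ContDiffAt ℝ (⊤ : ℕ∞) (fderiv ℝ G) x :=
  (S.smooth x hx).fderiv_right (by simp)

lemma smooth_fderiv_fderiv (S : InteriorSol E G g) {x : Euc n} (hx : x ∈ E) :
    ContDiffAt ℝ (⊤ : ℕ∞) (fderiv ℝ (fderiv ℝ G)) x :=
  (S.smooth_fderiv hx).fderiv_right (by simp)

lemma two_le : (2 : WithTop ℕ∞) ≤ ((⊤ : ℕ∞) : WithTop ℕ∞) := by
  have h : ((2 : ℕ∞) : WithTop ℕ∞) ≤ ((⊤ : ℕ∞) : WithTop ℕ∞) := WithTop.coe_le_coe.2 le_top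
  exact h

lemma third_swap (S : InteriorSol E G g) {x : Euc n} (hx : x ∈ E) (v w : Euc n) :
    fderiv ℝ (fderiv ℝ G) x v w = fderiv ℝ (fderiv ℝ G) x w v :=
  (S.smooth x hx).isSymmSndFDerivAt (by simpa using two_le) v w

lemma fourth_swap (S : InteriorSol E G g) {x : Euc n} (hx : x ∈ E) (v w : Euc n) :
    fderiv ℝ (fderiv ℝ (fderiv ℝ G)) x v w = fderiv ℝ (fderiv ℝ (fderiv ℝ G)) x w v :=
  (S.smooth_fderiv hx).isSymmSndFDerivAt (by simpa using two_le) v w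

lemma fourth_swap' (S : InteriorSol E G g) {x : Euc n} (hx : x ∈ E) (v w z : Euc n) :
    fderiv ℝ (fderiv ℝ (fderiv ℝ G)) x v w z = fderiv ℝ (fderiv ℝ (fderiv ℝ G)) x v z w := by
  have hj := jet2_along_line ((S.smooth_fderiv_fderiv hx).of_le two_le) v
  have j1 := (hj.apply (Jet2.const w)).apply (Jet2.const z)
  have j2 := (hj.apply (Jet2.const z)).apply (Jet2.const w)
  have e : (fun t : ℝ => fderiv ℝ (fderiv ℝ G) (x + t • v) w z) =ᶠ[𝓝 0]
      fun t : ℝ => fderiv ℝ (fderiv ℝ G) (x + t • v) z w := by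
    filter_upwards [(tendsto_line x v).eventually (S.isOpen.mem_nhds hx)] with t ht using
      S.third_swap ht w z
  simpa using (j1.unique j2 e).1

lemma third_symm (S : InteriorSol E G g) {x : Euc n} (hx : x ∈ E) (v w z : Euc n) :
    ⟪fderiv ℝ (fderiv ℝ G) x v w, z⟫ = ⟪w, fderiv ℝ (fderiv ℝ G) x v z⟫ := by
  have hj := jet2_along_line ((S.smooth_fderiv hx).of_le two_le) v
  have j1 := (hj.apply (Jet2.const w)).inner (Jet2.const z)
  have j2 := (Jet2.const w).inner (hj.apply (Jet2.const z))
  have e : (fun t : ℝ => ⟪fderiv ℝ G (x + t • v) w, z⟫) =ᶠ[𝓝 0]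
      fun t : ℝ => ⟪w, fderiv ℝ G (x + t • v) z⟫ := by
    filter_upwards [(tendsto_line x v).eventually (S.isOpen.mem_nhds hx)] with t ht using S.symm _ ht w z
  simpa using (j1.unique j2 e).1

lemma fourth_symm (S : InteriorSol E G g) {x : Euc n} (hx : x ∈ E) (u v w z : Euc n) :
    ⟪fderiv ℝ (fderiv ℝ (fderiv ℝ G)) x u v w, z⟫
      = ⟪w, fderiv ℝ (fderiv ℝ (fderiv ℝ G)) x u v z⟫ := by
  have hj := jet2_along_line ((S.smooth_fderiv_fderiv hx).of_le two_le) u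
  have j1 := ((hj.apply (Jet2.const v)).apply (Jet2.const w)).inner (Jet2.const z)
  have j2 := (Jet2.const w).inner ((hj.apply (Jet2.const v)).apply (Jet2.const z))
  have e : (fun t : ℝ => ⟪fderiv ℝ (fderiv ℝ G) (x + t • u) v w, z⟫) =ᶠ[𝓝 0]
      fun t : ℝ => ⟪w, fderiv ℝ (fderiv ℝ G) (x + t • u) v z⟫ := by
    filter_upwards [(tendsto_line x u).eventually (S.isOpen.mem_nhds hx)] with t ht using
      S.third_symm ht v w z
  simpa using (j1.unique j2 e).1

lemma fourth_exchange (S : InteriorSol E G g) {x : Euc n} (hx : x ∈ E) (v ξ : Euc n) :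
    ⟪fderiv ℝ (fderiv ℝ (fderiv ℝ G)) x v v ξ, ξ⟫
      = ⟪fderiv ℝ (fderiv ℝ (fderiv ℝ G)) x ξ ξ v, v⟫ := by
  rw [S.fourth_swap' hx v v ξ, S.fourth_swap hx v ξ, S.fourth_symm hx, S.fourth_swap' hx ξ v ξ,
    real_inner_comm]

/-- The equation differentiated once and twice in the direction `ξ`. -/
lemma differentiated (S : InteriorSol E G g) {x : Euc n} (hx : x ∈ E) (ξ : Euc n) :
    (contr (G x) (fun v => ⟪fderiv ℝ (fderiv ℝ G) x ξ v, v⟫)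
      = fderiv ℝ g (x, G x) (ξ, fderiv ℝ G x ξ)
        + 2 * ⟪G x, fderiv ℝ G x ξ⟫ * ∑ i, ⟪fderiv ℝ G x (EuclideanSpace.single i 1),
            EuclideanSpace.single i 1⟫
        - 2 * ⟪fderiv ℝ G x (G x), fderiv ℝ G x ξ⟫) ∧
    (contr (G x) (fun v => ⟪fderiv ℝ (fderiv ℝ (fderiv ℝ G)) x ξ ξ v, v⟫)
      = fderiv ℝ (fderiv ℝ g) (x, G x) (ξ, fderiv ℝ G x ξ) (ξ, fderiv ℝ G x ξ)
        + fderiv ℝ g (x, G x) (0, fderiv ℝ (fderiv ℝ G) x ξ ξ)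
        + (2 * ⟪G x, fderiv ℝ (fderiv ℝ G) x ξ ξ⟫ + 2 * ‖fderiv ℝ G x ξ‖ ^ 2) *
          ∑ i, ⟪fderiv ℝ G x (EuclideanSpace.single i 1), EuclideanSpace.single i 1⟫
        - 2 * ⟪fderiv ℝ G x (G x), fderiv ℝ (fderiv ℝ G) x ξ ξ⟫
        + 4 * ⟪G x, fderiv ℝ G x ξ⟫ *
          ∑ i, ⟪fderiv ℝ (fderiv ℝ G) x ξ (EuclideanSpace.single i 1), EuclideanSpace.single i 1⟫
        - 4 * ⟪fderiv ℝ (fderiv ℝ G) x ξ (fderiv ℝ G x ξ), G x⟫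
        - 2 * ⟪fderiv ℝ G x (fderiv ℝ G x ξ), fderiv ℝ G x ξ⟫) := by
  have jP := jet2_along_line ((S.smooth x hx).of_le two_le) ξ
  have jU := jet2_along_line ((S.smooth_fderiv hx).of_le two_le) ξ
  have jtr := Jet2.sum Finset.univ fun (i : Fin n) _ =>
    (jU.apply (Jet2.const (EuclideanSpace.single i (1 : ℝ) : Euc n))).inner
      (Jet2.const (EuclideanSpace.single i (1 : ℝ) : Euc n))
  have jL := (((Jet2.const (1 : ℝ)).sub (jP.inner jP)).mul jtr).add ((jU.apply jP).inner jP)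
  have jR := ((Jet2.line x ξ).prodMk jP).comp (S.rhs x hx)
  obtain ⟨h1, h2⟩ := jL.unique jR (by
    filter_upwards [(tendsto_line x ξ).eventually (S.isOpen.mem_nhds hx)] with t ht
    rw [← S.eqn _ ht, contr, real_inner_self_eq_norm_sq])
  simp only [map_zero, add_zero, inner_zero_right, smul_zero, zero_sub,
    real_inner_self_eq_norm_sq, inner_add_left, inner_smul_left] at h1 h2
  have s1 : ∀ w, ⟪fderiv ℝ G x w, G x⟫ = ⟪fderiv ℝ G x (G x), w⟫ := fun w => by
    rw [S.symm x hx, real_inner_comm]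
  have s2 : ∀ w, ⟪w, G x⟫ = ⟪G x, w⟫ := fun w => real_inner_comm _ _
  have s3 : ⟪fderiv ℝ (fderiv ℝ G) x ξ (G x), fderiv ℝ G x ξ⟫
      = ⟪fderiv ℝ (fderiv ℝ G) x ξ (fderiv ℝ G x ξ), G x⟫ := by
    rw [S.third_symm hx, real_inner_comm]
  rw [s2 (fderiv ℝ G x ξ), s1 (fderiv ℝ G x ξ)] at h1
  rw [s2 (fderiv ℝ G x ξ), s1 (fderiv ℝ (fderiv ℝ G) x ξ ξ), s3,
    s2 (fderiv ℝ (fderiv ℝ G) x ξ ξ)] at h2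
  constructor
  · rw [← h1, contr]; ring
  · have : fderiv ℝ (fderiv ℝ g) (x, G x) (ξ, fderiv ℝ G x ξ) (ξ, fderiv ℝ G x ξ)
        + fderiv ℝ g (x, G x) (0, fderiv ℝ (fderiv ℝ G) x ξ ξ) = _ := h2.symm
    rw [this, contr]
    simp
    ring

end InteriorSol

namespace InteriorSol

variable {E : Set (Euc n)} {G : Euc n → Euc n} {g : Euc n × Euc n → ℝ}

/-- The maximum principle for the linearised operator, applied to a lower support function of
`s ⟨e, (DG)⁻¹ e⟩ + ⟨a, G⟩ + Q - B h(G)` at an interior maximum, where `e = DG(x) ξ₀`. -/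
lemma linearised_le_of_isLocalMax (S : InteriorSol E G g) {x : Euc n} (hx : x ∈ E)
    (hp : ‖G x‖ ^ 2 ≤ 1) {Q h : Euc n → ℝ}
    (hQ : ContDiffAt ℝ 2 Q x) (hh : ContDiffAt ℝ 2 h (G x)) (ξ₀ a b y : Euc n) (s r B : ℝ)
    (hb : ∀ w, ⟪b, w⟫ = - fderiv ℝ g (x, G x) (0, w)
      - 2 * ⟪G x, w⟫ * ∑ i, ⟪fderiv ℝ G x (EuclideanSpace.single i 1), EuclideanSpace.single i 1⟫
      + 2 * ⟪fderiv ℝ G x (G x), w⟫)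
    (hy : ∀ w, fderiv ℝ h (G x) w = ⟪y, w⟫)
    (hmax : IsLocalMax (fun z =>
      s * (2 * ⟪fderiv ℝ G x ξ₀, ξ₀ - r • fderiv ℝ (fderiv ℝ G) x (z - x) ξ₀⟫
        - ⟪fderiv ℝ G z (ξ₀ - r • fderiv ℝ (fderiv ℝ G) x (z - x) ξ₀),
            ξ₀ - r • fderiv ℝ (fderiv ℝ G) x (z - x) ξ₀⟫)
      + ⟪a, G z⟫ + Q z - B * h (G z)) x) :
    s * (4 * r * contr (G x) (fun v => ‖fderiv ℝ (fderiv ℝ G) x v ξ₀‖ ^ 2)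
        - 2 * r ^ 2 * contr (G x) (fun v => ⟪fderiv ℝ G x (fderiv ℝ (fderiv ℝ G) x v ξ₀),
            fderiv ℝ (fderiv ℝ G) x v ξ₀⟫)
        - (fderiv ℝ (fderiv ℝ g) (x, G x) (ξ₀, fderiv ℝ G x ξ₀) (ξ₀, fderiv ℝ G x ξ₀)
          + 2 * ‖fderiv ℝ G x ξ₀‖ ^ 2 *
            ∑ i, ⟪fderiv ℝ G x (EuclideanSpace.single i 1), EuclideanSpace.single i 1⟫
          + 4 * ⟪G x, fderiv ℝ G x ξ₀⟫ *
            ∑ i, ⟪fderiv ℝ (fderiv ℝ G) x ξ₀ (EuclideanSpace.single i 1),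
              EuclideanSpace.single i 1⟫
          - 4 * ⟪fderiv ℝ (fderiv ℝ G) x ξ₀ (fderiv ℝ G x ξ₀), G x⟫
          - 2 * ⟪fderiv ℝ G x (fderiv ℝ G x ξ₀), fderiv ℝ G x ξ₀⟫))
      + fderiv ℝ g (x, G x) (a, 0) + contr (G x) (fun v => fderiv ℝ (fderiv ℝ Q) x v v)
      + fderiv ℝ Q x b
      - B * (contr (G x) (fun v => fderiv ℝ (fderiv ℝ h) (G x) (fderiv ℝ G x v) (fderiv ℝ G x v))
        + fderiv ℝ g (x, G x) (y, 0)) ≤ 0 := by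
  have jets : ∀ v : Euc n,
      (s * (- ⟪fderiv ℝ (fderiv ℝ G) x v ξ₀, ξ₀⟫) + ⟪a, fderiv ℝ G x v⟫ + fderiv ℝ Q x v
        - B * fderiv ℝ h (G x) (fderiv ℝ G x v) = 0) ∧
      (s * (4 * r * ‖fderiv ℝ (fderiv ℝ G) x v ξ₀‖ ^ 2
          - 2 * r ^ 2 * ⟪fderiv ℝ G x (fderiv ℝ (fderiv ℝ G) x v ξ₀),
            fderiv ℝ (fderiv ℝ G) x v ξ₀⟫ - ⟪fderiv ℝ (fderiv ℝ (fderiv ℝ G)) x v v ξ₀, ξ₀⟫)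
        + ⟪a, fderiv ℝ (fderiv ℝ G) x v v⟫ + fderiv ℝ (fderiv ℝ Q) x v v
        - B * (fderiv ℝ (fderiv ℝ h) (G x) (fderiv ℝ G x v) (fderiv ℝ G x v)
          + fderiv ℝ h (G x) (fderiv ℝ (fderiv ℝ G) x v v)) ≤ 0) := by
    intro v
    have jP := jet2_along_line ((S.smooth x hx).of_le two_le) v
    have jU := jet2_along_line ((S.smooth_fderiv hx).of_le two_le) v
    have jξ : Jet2 (fun t : ℝ => ξ₀ - r • fderiv ℝ (fderiv ℝ G) x (x + t • v - x) ξ₀) ξ₀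
        (-(r • fderiv ℝ (fderiv ℝ G) x v ξ₀)) 0 := by
      convert Jet2.line ξ₀ (-(r • fderiv ℝ (fderiv ℝ G) x v ξ₀)) using 2 with t
      rw [add_sub_cancel_left, map_smul, _root_.smul_apply, smul_neg,
        sub_eq_add_neg, smul_comm]
    have jW := ((((((Jet2.const (2 : ℝ)).mul ((Jet2.const (fderiv ℝ G x ξ₀)).inner jξ)).sub
      ((jU.apply jξ).inner jξ)).const_smul s).add ((Jet2.const a).inner jP)).add
      (jet2_along_line hQ v)).sub ((jP.comp hh).const_smul B)
    have hm : IsLocalMax (fun t : ℝ => (fun z =>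
      s * (2 * ⟪fderiv ℝ G x ξ₀, ξ₀ - r • fderiv ℝ (fderiv ℝ G) x (z - x) ξ₀⟫
        - ⟪fderiv ℝ G z (ξ₀ - r • fderiv ℝ (fderiv ℝ G) x (z - x) ξ₀),
            ξ₀ - r • fderiv ℝ (fderiv ℝ G) x (z - x) ξ₀⟫)
      + ⟪a, G z⟫ + Q z - B * h (G z)) (x + t • v)) 0 := by
      have h1 := (tendsto_line x v).eventually hmax
      filter_upwards [h1] with t ht
      simpa using ht
    obtain ⟨e1, e2⟩ := jW.of_isLocalMax hm
    have s0 : ⟪fderiv ℝ G x (fderiv ℝ (fderiv ℝ G) x v ξ₀), ξ₀⟫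
        = ⟪fderiv ℝ G x ξ₀, fderiv ℝ (fderiv ℝ G) x v ξ₀⟫ := by
      rw [S.symm x hx, real_inner_comm]
    have s1 : ⟪fderiv ℝ (fderiv ℝ G) x v (fderiv ℝ (fderiv ℝ G) x v ξ₀), ξ₀⟫
        = ‖fderiv ℝ (fderiv ℝ G) x v ξ₀‖ ^ 2 := by
      rw [S.third_symm hx, real_inner_self_eq_norm_sq]
    simp only [map_zero, add_zero, inner_zero_right, zero_mul, mul_zero, s1,
      real_inner_self_eq_norm_sq, inner_add_left, real_inner_smul_left, inner_zero_left, zero_add,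
      map_neg, map_smul, inner_neg_left, inner_neg_right, real_inner_smul_right, smul_eq_mul, s0,
      smul_neg] at e1 e2
    constructor
    · rw [← e1]; ring
    · refine le_trans (le_of_eq ?_) e2; ring
  have hsum : contr (G x) (fun v =>
      s * (4 * r * ‖fderiv ℝ (fderiv ℝ G) x v ξ₀‖ ^ 2
          - 2 * r ^ 2 * ⟪fderiv ℝ G x (fderiv ℝ (fderiv ℝ G) x v ξ₀),
            fderiv ℝ (fderiv ℝ G) x v ξ₀⟫ - ⟪fderiv ℝ (fderiv ℝ (fderiv ℝ G)) x v v ξ₀, ξ₀⟫)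
        + ⟪a, fderiv ℝ (fderiv ℝ G) x v v⟫ + fderiv ℝ (fderiv ℝ Q) x v v
        - B * (fderiv ℝ (fderiv ℝ h) (G x) (fderiv ℝ G x v) (fderiv ℝ G x v)
          + fderiv ℝ h (G x) (fderiv ℝ (fderiv ℝ G) x v v))) ≤ 0 := by
    refine (contr_mono hp fun v => (jets v).2).trans (le_of_eq ?_)
    simp [contr]
  have t1 : ∀ z v : Euc n, ⟪z, fderiv ℝ (fderiv ℝ G) x v v⟫
      = ⟪fderiv ℝ (fderiv ℝ G) x z v, v⟫ := fun z v => by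
    rw [← S.third_symm hx, S.third_swap hx]
  simp only [hy, t1, S.fourth_exchange hx] at hsum
  rw [contr_sub, contr_add, contr_add, contr_mul, contr_mul, contr_sub, contr_sub, contr_mul,
    contr_mul, contr_add, (S.differentiated hx a).1, (S.differentiated hx y).1,
    (S.differentiated hx ξ₀).2] at hsum
  have hb0 := (jets b).1
  have q1 : ⟪fderiv ℝ (fderiv ℝ G) x b ξ₀, ξ₀⟫ = ⟪b, fderiv ℝ (fderiv ℝ G) x ξ₀ ξ₀⟫ := by
    rw [S.third_swap hx, S.third_symm hx]
  have q2 : ∀ z, ⟪z, fderiv ℝ G x b⟫ = ⟪b, fderiv ℝ G x z⟫ := fun z => by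
    rw [← S.symm x hx, real_inner_comm]
  have q3 : ∀ z, fderiv ℝ g (x, G x) (z, fderiv ℝ G x z)
      = fderiv ℝ g (x, G x) (z, 0) + fderiv ℝ g (x, G x) (0, fderiv ℝ G x z) := fun z => by
    rw [← map_add]; simp
  rw [hy, q1, q2, q2, hb, hb, hb] at hb0
  rw [q3, q3] at hsum
  refine le_trans (le_of_eq ?_) hsum
  linear_combination hb0

end InteriorSol

section PosSemidef

variable {A : Euc n →L[ℝ] Euc n}

/-- The trace of an endomorphism of Euclidean space. -/
def tr (A : Euc n →L[ℝ] Euc n) : ℝ :=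
  ∑ i, ⟪A (EuclideanSpace.single i 1), EuclideanSpace.single i 1⟫

lemma inner_sq_le_of_nonneg (hs : ∀ v w, ⟪A v, w⟫ = ⟪v, A w⟫) (h0 : ∀ v, 0 ≤ ⟪A v, v⟫)
    (v w : Euc n) : ⟪A v, w⟫ ^ 2 ≤ ⟪A v, v⟫ * ⟪A w, w⟫ := by
  have key : ∀ t : ℝ, 0 ≤ ⟪A w, w⟫ * (t * t) + (2 * ⟪A v, w⟫) * t + ⟪A v, v⟫ := fun t => by
    have := h0 (v + t • w)
    have e : ⟪A w, v⟫ = ⟪A v, w⟫ := by rw [hs, real_inner_comm]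
    simp only [map_add, map_smul, inner_add_left, inner_add_right, real_inner_smul_left,
      real_inner_smul_right, e] at this
    linarith
  have := discrim_le_zero key
  unfold discrim at this
  nlinarith

lemma sum_inner_single_sq (v : Euc n) : ∑ i, ⟪v, EuclideanSpace.single i (1 : ℝ)⟫ ^ 2 = ‖v‖ ^ 2 := by
  simp [EuclideanSpace.norm_sq_eq, EuclideanSpace.inner_single_right]

lemma inner_le_tr_mul (hs : ∀ v w, ⟪A v, w⟫ = ⟪v, A w⟫) (h0 : ∀ v, 0 ≤ ⟪A v, v⟫) (v : Euc n) :
    ⟪A v, v⟫ ≤ tr A * ‖v‖ ^ 2 := by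
  have h1 : ‖A v‖ ^ 2 ≤ ⟪A v, v⟫ * tr A := by
    rw [← sum_inner_single_sq, tr, Finset.mul_sum]
    exact Finset.sum_le_sum fun i _ => inner_sq_le_of_nonneg hs h0 _ _
  have h2 : ⟪A v, v⟫ ≤ ‖A v‖ * ‖v‖ := real_inner_le_norm _ _
  rcases (h0 v).eq_or_lt with h | h
  · rw [← h]
    exact mul_nonneg (Finset.sum_nonneg fun i _ => h0 _) (sq_nonneg _)
  · have h3 : ⟪A v, v⟫ ^ 2 ≤ ‖A v‖ ^ 2 * ‖v‖ ^ 2 := by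
      rw [← mul_pow]; exact pow_le_pow_left₀ h.le h2 2
    have h4 : ⟪A v, v⟫ * ⟪A v, v⟫ ≤ ⟪A v, v⟫ * (tr A * ‖v‖ ^ 2) := by
      nlinarith [sq_nonneg ‖v‖]
    exact le_of_mul_le_mul_left h4 h

lemma norm_sq_le_of_inner_le (hs : ∀ v w, ⟪A v, w⟫ = ⟪v, A w⟫) (h0 : ∀ v, 0 ≤ ⟪A v, v⟫) {C : ℝ}
    (hC : ∀ v, ⟪A v, v⟫ ≤ C * ‖v‖ ^ 2) (v : Euc n) : ‖A v‖ ^ 2 ≤ C * ⟪A v, v⟫ := by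
  have h1 := inner_sq_le_of_nonneg hs h0 v (A v)
  rw [real_inner_self_eq_norm_sq] at h1
  have h2 := mul_le_mul_of_nonneg_left (hC (A v)) (h0 v)
  rcases eq_or_ne (A v) 0 with h | h
  · simp [h]
  · have h3 : 0 < ‖A v‖ ^ 2 := by positivity
    nlinarith

lemma norm_apply_le_of_inner_le (hs : ∀ v w, ⟪A v, w⟫ = ⟪v, A w⟫) (h0 : ∀ v, 0 ≤ ⟪A v, v⟫) {C : ℝ}
    (hC0 : 0 ≤ C) (hC : ∀ v, ⟪A v, v⟫ ≤ C * ‖v‖ ^ 2) (v : Euc n) : ‖A v‖ ≤ C * ‖v‖ := by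
  have h1 := norm_sq_le_of_inner_le hs h0 hC v
  have h2 := mul_le_mul_of_nonneg_left (hC v) hC0
  exact le_of_sq_le_sq (by nlinarith) (by positivity)

lemma tr_sq_le (A : Euc n →L[ℝ] Euc n) :
    tr A ^ 2 ≤ n * ∑ i, ‖A (EuclideanSpace.single i 1)‖ ^ 2 := by
  have h1 := sq_sum_le_card_mul_sum_sq (s := (Finset.univ : Finset (Fin n)))
    (f := fun i => ⟪A (EuclideanSpace.single i 1), (EuclideanSpace.single i (1 : ℝ) : Euc n)⟫)
  simp only [Finset.card_univ, Fintype.card_fin] at h1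
  refine h1.trans (mul_le_mul_of_nonneg_left (Finset.sum_le_sum fun i _ => ?_) (Nat.cast_nonneg _))
  have := abs_real_inner_le_norm (A (EuclideanSpace.single i 1))
    (EuclideanSpace.single i (1 : ℝ) : Euc n)
  rw [PiLp.norm_single, norm_one, mul_one] at this
  exact sq_le_sq' (by linarith [neg_abs_le ⟪A (EuclideanSpace.single i 1), (EuclideanSpace.single i (1 : ℝ) : Euc n)⟫]) ((le_abs_self _).trans this)

lemma surjective_of_inner_pos (h0 : ∀ v, v ≠ 0 → 0 < ⟪A v, v⟫) : Function.Surjective A := by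
  have hi : Function.Injective (A : Euc n →ₗ[ℝ] Euc n) := by
    rw [injective_iff_map_eq_zero]
    intro v hv
    by_contra hne
    have := h0 v hne
    have e : A v = 0 := hv
    simp [e] at this
  exact LinearMap.injective_iff_surjective.1 hi

lemma two_mul_inner_sub_le (hs : ∀ v w, ⟪A v, w⟫ = ⟪v, A w⟫) (h0 : ∀ v, 0 ≤ ⟪A v, v⟫)
    (v w : Euc n) : 2 * ⟪A v, w⟫ - ⟪A w, w⟫ ≤ ⟪A v, v⟫ := by
  have := h0 (v - w)
  have e : ⟪A w, v⟫ = ⟪A v, w⟫ := by rw [hs, real_inner_comm]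
  simp only [map_sub, inner_sub_left, inner_sub_right, e] at this
  linarith

lemma contr_norm_sq_le {p : Euc n} (hp : ‖p‖ ^ 2 ≤ 1) :
    contr p (fun v => ‖v‖ ^ 2) ≤ n + 1 := by
  simp only [contr, PiLp.norm_single, norm_one, one_pow, Finset.sum_const,
    Finset.card_univ, Fintype.card_fin, nsmul_eq_mul, mul_one]
  nlinarith [sq_nonneg ‖p‖, (Nat.cast_nonneg n : (0 : ℝ) ≤ n)]

end PosSemidef

namespace InteriorSol

variable {E : Set (Euc n)} {G : Euc n → Euc n} {g : Euc n × Euc n → ℝ}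

/-- Bounds at a point on a solution and on the right-hand side. -/
structure PointBounds (G : Euc n → Euc n) (g : Euc n × Euc n → ℝ) (ρ κ C L ε : ℝ) (x : Euc n) :
    Prop where
  norm_sq_le : ‖G x‖ ^ 2 ≤ ρ
  nonneg : ∀ v, 0 ≤ ⟪fderiv ℝ G x v, v⟫
  tr_ge : κ ≤ tr (fderiv ℝ G x)
  tr_le : tr (fderiv ℝ G x) ≤ C
  rhs_fst : ∀ ξ, |fderiv ℝ g (x, G x) (ξ, 0)| ≤ ε * ‖ξ‖
  rhs_snd : ∀ w, |fderiv ℝ g (x, G x) (0, w)| ≤ L * ‖w‖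
  rhs_second : ∀ ξ w, fderiv ℝ (fderiv ℝ g) (x, G x) (ξ, w) (ξ, w)
    ≤ L * ‖w‖ ^ 2 + 2 * ε * ‖ξ‖ * ‖w‖

lemma four_mul_le {a t : ℝ} (ha : 0 < a) : 4 * t ≤ 2 * a * t ^ 2 + 2 / a := by
  have : 2 * a * t ^ 2 + 2 / a - 4 * t = 2 / a * (a * t - 1) ^ 2 := by field_simp; ring
  have h2 : 0 ≤ 2 / a * (a * t - 1) ^ 2 := by positivity
  linarith

set_option maxHeartbeats 1000000 in
/-- Interior maximum of `s ⟨e, (DG)⁻¹ e⟩ + ⟨a, G⟩ + Q - B h(G)` forces an upper bound on `B`. -/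
theorem barrier_le (S : InteriorSol E G g) {x : Euc n} (hx : x ∈ E) {ρ κ C L ε : ℝ}
    (P : PointBounds G g ρ κ C L ε x) (hρ : ρ < 1) (hκ : 0 < κ) (hn : 0 < n) (hL : 0 ≤ L)
    (hε : 0 ≤ ε)
    {Q h : Euc n → ℝ} (hQ : ContDiffAt ℝ 2 Q x) (hh : ContDiffAt ℝ 2 h (G x))
    {y : Euc n} (hy : ∀ w, fderiv ℝ h (G x) w = ⟪y, w⟫) {H θ q₁ q₂ : ℝ} (hH : ‖y‖ ≤ H)
    (hθ0 : 0 ≤ θ)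
    (hθ : ∀ w, fderiv ℝ (fderiv ℝ h) (G x) w w ≤ - θ * ‖w‖ ^ 2)
    (hq₁ : ∀ w, |fderiv ℝ Q x w| ≤ q₁ * ‖w‖) (hq10 : 0 ≤ q₁)
    (hq20 : 0 ≤ q₂)
    (hq₂ : ∀ w, - q₂ * ‖w‖ ^ 2 ≤ fderiv ℝ (fderiv ℝ Q) x w w)
    {s B : ℝ} (hs : 0 ≤ s) (hB : 0 ≤ B) (ξ₀ a : Euc n) (he : ‖fderiv ℝ G x ξ₀‖ ≤ 1)
    (hmax : ∀ᶠ z in 𝓝 x, (∀ v, v ≠ 0 → 0 < ⟪fderiv ℝ G z v, v⟫) ∧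
      ∀ ξ, fderiv ℝ G z ξ = fderiv ℝ G x ξ₀ →
        s * ⟪fderiv ℝ G z ξ, ξ⟫ + ⟪a, G z⟫ + Q z - B * h (G z)
          ≤ s * ⟪fderiv ℝ G x ξ₀, ξ₀⟫ + ⟪a, G x⟫ + Q x - B * h (G x)) :
    B * (θ * ((1 - ρ) * κ ^ 2 / n) - ε * H) ≤
      s * (L + 4 * C + 2 * n * C / (1 - ρ) + 2 * ε * ‖ξ₀‖) + ε * ‖a‖
        + (q₂ * (n + 1) + q₁ * (L + 4 * C)) := by
  set U := fderiv ℝ G x with hU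
  set T := fderiv ℝ (fderiv ℝ G) x with hT
  have hC : 0 < C := hκ.trans_le (P.tr_ge.trans P.tr_le)
  have hp1 : ‖G x‖ ^ 2 ≤ 1 := P.norm_sq_le.trans hρ.le
  have hpn : ‖G x‖ ≤ 1 := by nlinarith [norm_nonneg (G x)]
  have hUC : ∀ v, ⟪U v, v⟫ ≤ C * ‖v‖ ^ 2 := fun v =>
    (inner_le_tr_mul (S.symm x hx) P.nonneg v).trans
      (mul_le_mul_of_nonneg_right P.tr_le (sq_nonneg _))
  have hUn := norm_apply_le_of_inner_le (S.symm x hx) P.nonneg hC.le hUC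
  -- the drift vector
  set ℓ : Euc n →L[ℝ] ℝ := - (fderiv ℝ g (x, G x)).comp (ContinuousLinearMap.inr ℝ (Euc n) (Euc n))
    - (2 * tr U) • innerSL ℝ (G x) + (2 : ℝ) • innerSL ℝ (U (G x)) with hℓ
  obtain ⟨b, hb⟩ : ∃ b : Euc n, ∀ w, ⟪b, w⟫ = ℓ w :=
    ⟨(InnerProductSpace.toDual ℝ (Euc n)).symm ℓ, fun w => by simp⟩
  have hb' : ∀ w, ⟪b, w⟫ = - fderiv ℝ g (x, G x) (0, w) - 2 * ⟪G x, w⟫ * tr U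
      + 2 * ⟪U (G x), w⟫ := fun w => by
    rw [hb, hℓ]
    simp
    ring
  have hbn : ‖b‖ ≤ L + 4 * C := by
    have h1 : ‖b‖ ^ 2 ≤ (L + 4 * C) * ‖b‖ := by
      rw [← real_inner_self_eq_norm_sq, hb']
      have a1 := (abs_le.1 (P.rhs_snd b)).1
      have a2 := (abs_le.1 (abs_real_inner_le_norm (G x) b)).1
      have a3 := real_inner_le_norm (U (G x)) b
      have a4 : ‖U (G x)‖ * ‖b‖ ≤ C * ‖b‖ := by
        refine mul_le_mul_of_nonneg_right ((hUn _).trans ?_) (norm_nonneg _)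
        nlinarith
      have a5 : ‖G x‖ * ‖b‖ ≤ ‖b‖ := by nlinarith [norm_nonneg b]
      have a6 : -(2 * ⟪G x, b⟫ * tr U) ≤ 2 * C * ‖b‖ := by
        have t0 : 0 ≤ tr U := hκ.le.trans P.tr_ge
        have : -⟪G x, b⟫ * tr U ≤ ‖b‖ * C :=
          (mul_le_mul_of_nonneg_right (by linarith) t0).trans
            (mul_le_mul_of_nonneg_left P.tr_le (norm_nonneg _))
        linarith
      linarith
    rcases (norm_nonneg b).eq_or_lt with h | h
    · rw [← h]; positivity
    · nlinarith
  have hlm := S.linearised_le_of_isLocalMax hx hp1 hQ hh ξ₀ a b y s (1 / C) B hb' hy (by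
    filter_upwards [hmax, S.isOpen.mem_nhds hx] with z hz hzE
    obtain ⟨ξ, hξ⟩ := surjective_of_inner_pos hz.1 (U ξ₀)
    have h1 := hz.2 ξ hξ
    have h0 : ∀ v, 0 ≤ ⟪fderiv ℝ G z v, v⟫ := fun v => by
      rcases eq_or_ne v 0 with rfl | hv
      · simp
      · exact (hz.1 v hv).le
    have h2 := two_mul_inner_sub_le (S.symm z hzE) h0 ξ (ξ₀ - (1 / C) • T (z - x) ξ₀)
    rw [hξ] at h1 h2
    have h3 := mul_le_mul_of_nonneg_left h2 hs
    simp only [sub_self, map_zero, _root_.zero_apply, smul_zero, sub_zero]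
    linarith)
  rw [← hU, ← hT] at hlm
  -- the good term
  set Y := contr (G x) (fun v => ‖T v ξ₀‖ ^ 2) with hY
  have hZ : contr (G x) (fun v => ⟪U (T v ξ₀), T v ξ₀⟫) ≤ C * Y := by
    rw [hY, ← contr_mul]
    exact contr_mono hp1 fun v => hUC _
  have hYge : (1 - ρ) * ∑ i, ‖T (EuclideanSpace.single i 1) ξ₀‖ ^ 2 + ‖T (G x) ξ₀‖ ^ 2 ≤ Y := by
    rw [hY, contr]
    have : 0 ≤ ∑ i, ‖T (EuclideanSpace.single i 1) ξ₀‖ ^ 2 :=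
      Finset.sum_nonneg fun i _ => sq_nonneg _
    nlinarith [P.norm_sq_le]
  have hgood : 2 / C * Y ≤ 4 * (1 / C) * Y - 2 * (1 / C) ^ 2 *
      contr (G x) (fun v => ⟪U (T v ξ₀), T v ξ₀⟫) := by
    have h1 : 2 * (1 / C) ^ 2 * contr (G x) (fun v => ⟪U (T v ξ₀), T v ξ₀⟫)
        ≤ 2 * (1 / C) ^ 2 * (C * Y) := mul_le_mul_of_nonneg_left hZ (by positivity)
    have h2 : 2 * (1 / C) ^ 2 * (C * Y) = 2 / C * Y := by field_simp
    have h3 : 4 * (1 / C) * Y = 2 / C * Y + 2 / C * Y := by ring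
    linarith
  have hsum : |∑ i, ⟪T ξ₀ (EuclideanSpace.single i 1), EuclideanSpace.single i 1⟫|
      ≤ ∑ i, ‖T (EuclideanSpace.single i 1) ξ₀‖ := by
    refine (Finset.abs_sum_le_sum_abs _ _).trans (Finset.sum_le_sum fun i _ => ?_)
    rw [hT, S.third_swap hx]
    refine (abs_real_inner_le_norm _ _).trans ?_
    simp
  have hpe : |⟪G x, U ξ₀⟫| ≤ 1 := by
    refine (abs_real_inner_le_norm _ _).trans ?_
    nlinarith [norm_nonneg (G x), norm_nonneg (U ξ₀)]
  have hcross : 4 * ⟪G x, U ξ₀⟫ *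
      ∑ i, ⟪T ξ₀ (EuclideanSpace.single i 1), EuclideanSpace.single i 1⟫
      ≤ 2 / C * (1 - ρ) * ∑ i, ‖T (EuclideanSpace.single i 1) ξ₀‖ ^ 2 + 2 * n * C / (1 - ρ) := by
    have h1 : ⟪G x, U ξ₀⟫ * ∑ i, ⟪T ξ₀ (EuclideanSpace.single i 1), EuclideanSpace.single i 1⟫
        ≤ ∑ i, ‖T (EuclideanSpace.single i 1) ξ₀‖ := by
      refine (le_abs_self _).trans ?_
      rw [abs_mul]
      refine (mul_le_of_le_one_left (abs_nonneg _) hpe).trans hsum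
    have hpos : 0 < (1 / C) * (1 - ρ) := mul_pos (by positivity) (by linarith)
    have h2 : ∑ i, 4 * ‖T (EuclideanSpace.single i 1) ξ₀‖
        ≤ ∑ i, (2 * ((1 / C) * (1 - ρ)) * ‖T (EuclideanSpace.single i 1) ξ₀‖ ^ 2
          + 2 / ((1 / C) * (1 - ρ))) := Finset.sum_le_sum fun i _ => four_mul_le hpos
    rw [Finset.sum_add_distrib, ← Finset.mul_sum, ← Finset.mul_sum, Finset.sum_const,
      Finset.card_univ, Fintype.card_fin, nsmul_eq_mul] at h2
    have h3 : (n : ℝ) * (2 / ((1 / C) * (1 - ρ))) = 2 * n * C / (1 - ρ) := by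
      have : 1 - ρ ≠ 0 := by linarith
      field_simp
    have h4 : 2 * ((1 / C) * (1 - ρ)) = 2 / C * (1 - ρ) := by ring
    rw [h3, h4] at h2
    linarith
  have hcross' : - (4 * ⟪T ξ₀ (U ξ₀), G x⟫) ≤ 2 / C * ‖T (G x) ξ₀‖ ^ 2 + 2 * C := by
    rw [hT, S.third_symm hx, S.third_swap hx, ← hT]
    have h1 := (abs_le.1 (abs_real_inner_le_norm (U ξ₀) (T (G x) ξ₀))).1
    have h2 : ‖U ξ₀‖ * ‖T (G x) ξ₀‖ ≤ ‖T (G x) ξ₀‖ := mul_le_of_le_one_left (norm_nonneg _) he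
    have h3 := four_mul_le (a := 1 / C) (t := ‖T (G x) ξ₀‖) (by positivity)
    have h4 : 2 / (1 / C) = 2 * C := by field_simp
    have h5 : 2 * (1 / C) = 2 / C := by ring
    rw [h4, h5] at h3
    linarith
  have hUξ : ‖U ξ₀‖ ^ 2 ≤ 1 := by nlinarith [norm_nonneg (U ξ₀)]
  have hsec : fderiv ℝ (fderiv ℝ g) (x, G x) (ξ₀, U ξ₀) (ξ₀, U ξ₀) ≤ L + 2 * ε * ‖ξ₀‖ := by
    refine (P.rhs_second ξ₀ (U ξ₀)).trans ?_
    have h1 : L * ‖U ξ₀‖ ^ 2 ≤ L := mul_le_of_le_one_right hL hUξ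
    have h2 : 2 * ε * ‖ξ₀‖ * ‖U ξ₀‖ ≤ 2 * ε * ‖ξ₀‖ := mul_le_of_le_one_right (by positivity) he
    linarith
  have hnn := P.nonneg (U ξ₀)
  rw [← hU] at hnn
  have htr : 2 * ‖U ξ₀‖ ^ 2 * tr U ≤ 2 * C := by
    have t0 : 0 ≤ tr U := hκ.le.trans P.tr_ge
    have := mul_le_mul hUξ P.tr_le t0 (by norm_num)
    linarith
  have hYge' := mul_le_mul_of_nonneg_left hYge (show 0 ≤ 2 / C by positivity)
  have hsterm : - (L + 4 * C + 2 * n * C / (1 - ρ) + 2 * ε * ‖ξ₀‖) ≤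
      4 * (1 / C) * Y - 2 * (1 / C) ^ 2 * contr (G x) (fun v => ⟪U (T v ξ₀), T v ξ₀⟫)
        - (fderiv ℝ (fderiv ℝ g) (x, G x) (ξ₀, U ξ₀) (ξ₀, U ξ₀)
          + 2 * ‖U ξ₀‖ ^ 2 *
            ∑ i, ⟪U (EuclideanSpace.single i 1), EuclideanSpace.single i 1⟫
          + 4 * ⟪G x, U ξ₀⟫ *
            ∑ i, ⟪T ξ₀ (EuclideanSpace.single i 1), EuclideanSpace.single i 1⟫
          - 4 * ⟪T ξ₀ (U ξ₀), G x⟫ - 2 * ⟪U (U ξ₀), U ξ₀⟫) := by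
    have e : ∑ i, ⟪U (EuclideanSpace.single i 1), EuclideanSpace.single i 1⟫ = tr U := rfl
    rw [e]
    linarith
  have hsterm' := mul_le_mul_of_nonneg_left hsterm hs
  have hQ2 : - (q₂ * (n + 1)) ≤ contr (G x) (fun v => fderiv ℝ (fderiv ℝ Q) x v v) := by
    have h1 := contr_mono hp1 hq₂
    rw [contr_mul] at h1
    have := mul_le_mul_of_nonneg_left (contr_norm_sq_le hp1) hq20
    linarith
  have hQ1 : - (q₁ * (L + 4 * C)) ≤ fderiv ℝ Q x b := by
    have := (abs_le.1 (hq₁ b)).1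
    have := mul_le_mul_of_nonneg_left hbn hq10
    linarith
  have ha := (abs_le.1 (P.rhs_fst a)).1
  have hyy : fderiv ℝ g (x, G x) (y, 0) ≤ ε * H :=
    (abs_le.1 (P.rhs_fst y)).2.trans (mul_le_mul_of_nonneg_left hH hε)
  have hh2 : contr (G x) (fun v => fderiv ℝ (fderiv ℝ h) (G x) (U v) (U v))
      ≤ - (θ * ((1 - ρ) * κ ^ 2 / n)) := by
    have h1 := contr_mono hp1 (fun v => hθ (U v))
    rw [contr_mul (q := fun v => ‖U v‖ ^ 2)] at h1
    have h2 : (1 - ρ) * κ ^ 2 / n ≤ contr (G x) (fun v => ‖U v‖ ^ 2) := by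
      rw [contr]
      have hn' : (0 : ℝ) < n := by exact_mod_cast hn
      have h3 := tr_sq_le U
      have h4 : κ ^ 2 ≤ tr U ^ 2 := pow_le_pow_left₀ hκ.le P.tr_ge 2
      have h5 : κ ^ 2 / n ≤ ∑ i, ‖U (EuclideanSpace.single i 1)‖ ^ 2 := by
        rw [div_le_iff₀ hn']; linarith
      have h6 : (1 - ρ) * (κ ^ 2 / n) ≤ (1 - ‖G x‖ ^ 2) *
          ∑ i, ‖U (EuclideanSpace.single i 1)‖ ^ 2 :=
        mul_le_mul (by linarith [P.norm_sq_le]) h5 (by positivity) (by linarith)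
      rw [mul_div_assoc]
      linarith [sq_nonneg ‖U (G x)‖]
    have := mul_le_mul_of_nonneg_left h2 hθ0
    linarith
  have hBt := mul_le_mul_of_nonneg_left (add_le_add hh2 hyy) hB
  linarith

end InteriorSol

/-- A bounded domain `{k > 0}` with a uniformly concave smooth defining function `k`. -/
structure UCDomain (E : Set (Euc n)) (k : Euc n → ℝ) (θ : ℝ) : Prop where
  isOpen : IsOpen E
  isBounded : Bornology.IsBounded E
  nonempty : E.Nonempty
  smooth : ContDiff ℝ (⊤ : ℕ∞) k
  eq_pos : E = {x | 0 < k x}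
  norm_gradient : ∀ x ∈ frontier E, ‖gradient k x‖ = 1
  pos : 0 < θ
  second_le : ∀ x v, fderiv ℝ (fderiv ℝ k) x v v ≤ - θ * ‖v‖ ^ 2

lemma fderiv_eq_inner_gradient {k : Euc n → ℝ} (x v : Euc n) :
    fderiv ℝ k x v = ⟪gradient k x, v⟫ := by
  simp [gradient]

namespace UCDomain

variable {E : Set (Euc n)} {k : Euc n → ℝ} {θ : ℝ}

lemma contDiff_two (D : UCDomain E k θ) : ContDiff ℝ 2 k := D.smooth.of_le InteriorSol.two_le

lemma differentiable (D : UCDomain E k θ) : Differentiable ℝ k :=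
  D.contDiff_two.differentiable (by simp)

lemma le_quadratic (D : UCDomain E k θ) (x y : Euc n) :
    k y ≤ k x + ⟪gradient k x, y - x⟫ - θ / 2 * ‖y - x‖ ^ 2 := by
  set v := y - x with hv
  have hd' : Differentiable ℝ (fderiv ℝ k) :=
    (D.contDiff_two.fderiv_right (m := 1) (by norm_num)).differentiable (by simp)
  have hl : ∀ t : ℝ, HasDerivAt (fun t : ℝ => x + t • v) v t := fun t => by
    simpa using ((hasDerivAt_id t).smul_const v).const_add x
  have h1 : ∀ t : ℝ, HasDerivAt (fun t : ℝ => k (x + t • v) + θ / 2 * ‖v‖ ^ 2 * t ^ 2)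
      (fderiv ℝ k (x + t • v) v + θ * ‖v‖ ^ 2 * t) t := fun t => by
    have a1 : HasDerivAt (fun t : ℝ => k (x + t • v)) (fderiv ℝ k (x + t • v) v) t :=
      (D.differentiable (x + t • v)).hasFDerivAt.comp_hasDerivAt t (hl t)
    have a2 : HasDerivAt (fun t : ℝ => θ / 2 * ‖v‖ ^ 2 * t ^ 2) (θ * ‖v‖ ^ 2 * t) t := by
      refine ((hasDerivAt_pow 2 t).const_mul (θ / 2 * ‖v‖ ^ 2)).congr_deriv ?_
      norm_num
      ring
    exact a1.add a2
  have h2 : ∀ t : ℝ, HasDerivAt (fun t : ℝ => fderiv ℝ k (x + t • v) v + θ * ‖v‖ ^ 2 * t)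
      (fderiv ℝ (fderiv ℝ k) (x + t • v) v v + θ * ‖v‖ ^ 2) t := fun t => by
    have a1 : HasDerivAt (fun t : ℝ => fderiv ℝ k (x + t • v))
        (fderiv ℝ (fderiv ℝ k) (x + t • v) v) t :=
      (hd' (x + t • v)).hasFDerivAt.comp_hasDerivAt t (hl t)
    have a2 : HasDerivAt (fun t : ℝ => fderiv ℝ k (x + t • v) v)
        (fderiv ℝ (fderiv ℝ k) (x + t • v) v v) t :=
      (ContinuousLinearMap.apply ℝ ℝ v).hasFDerivAt.comp_hasDerivAt t a1
    have a3 : HasDerivAt (fun t : ℝ => θ * ‖v‖ ^ 2 * t) (θ * ‖v‖ ^ 2) t := by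
      simpa using (hasDerivAt_id t).const_mul (θ * ‖v‖ ^ 2)
    exact a2.add a3
  have h3 : Antitone (fun t : ℝ => fderiv ℝ k (x + t • v) v + θ * ‖v‖ ^ 2 * t) :=
    antitone_of_deriv_nonpos (fun t => (h2 t).differentiableAt) fun t => by
      rw [(h2 t).deriv]; linarith [D.second_le (x + t • v) v]
  obtain ⟨t, ht, he⟩ := exists_hasDerivAt_eq_slope _ _ (zero_lt_one' ℝ)
    (fun t _ => (h1 t).continuousAt.continuousWithinAt) (fun t _ => h1 t)
  have h4 := h3 ht.1.le
  simp only [zero_smul, add_zero, mul_zero, one_smul] at h4 he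
  have e1 : x + v = y := by rw [hv]; abel
  rw [he, e1] at h4
  norm_num at h4
  rw [fderiv_eq_inner_gradient] at h4
  linarith

lemma concaveOn (D : UCDomain E k θ) : ConcaveOn ℝ univ k := by
  refine ⟨convex_univ, fun x _ y _ a b ha hb hab => ?_⟩
  have hθ := D.pos
  set z := a • x + b • y with hz
  have h1 := D.le_quadratic z x
  have h2 := D.le_quadratic z y
  have h3 : a * ⟪gradient k z, x - z⟫ + b * ⟪gradient k z, y - z⟫ = 0 := by
    rw [← real_inner_smul_right, ← real_inner_smul_right, ← inner_add_right]
    have : a • (x - z) + b • (y - z) = 0 := by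
      have : a • (x - z) + b • (y - z) = z - (a + b) • z := by
        rw [hz]; simp only [smul_sub, add_smul]; abel
      rw [this, hab, one_smul, sub_self]
    rw [this, inner_zero_right]
  have h4 : k x ≤ k z + ⟪gradient k z, x - z⟫ := by nlinarith [sq_nonneg ‖x - z‖]
  have h5 : k y ≤ k z + ⟪gradient k z, y - z⟫ := by nlinarith [sq_nonneg ‖y - z‖]
  have h6 := mul_le_mul_of_nonneg_left h4 ha
  have h7 := mul_le_mul_of_nonneg_left h5 hb
  have h8 : k z = a * k z + b * k z := by rw [← add_mul, hab, one_mul]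
  simp only [smul_eq_mul]
  linarith

lemma closure_eq (D : UCDomain E k θ) : closure E = {x | 0 ≤ k x} := by
  apply Subset.antisymm
  · refine closure_minimal (fun x hx => ?_) (isClosed_le continuous_const D.smooth.continuous)
    rw [D.eq_pos] at hx
    exact (show 0 < k x from hx).le
  · intro x hx
    obtain ⟨y, hy⟩ := D.nonempty
    have hy' : 0 < k y := by rw [D.eq_pos] at hy; exact hy
    have htend : Filter.Tendsto (fun t : ℝ => (1 - t) • x + t • y) (𝓝[>] 0) (𝓝 x) := by
      have : Continuous fun t : ℝ => (1 - t) • x + t • y := by fun_prop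
      simpa using (this.tendsto 0).mono_left nhdsWithin_le_nhds
    refine mem_closure_of_tendsto htend ?_
    filter_upwards [Ioo_mem_nhdsGT (zero_lt_one' ℝ)] with t ht
    have := D.concaveOn.2 (mem_univ x) (mem_univ y) (by linarith [ht.2] : 0 ≤ 1 - t) ht.1.le
      (by ring)
    rw [D.eq_pos]
    simp only [smul_eq_mul] at this
    have h1 : 0 ≤ (1 - t) * k x := mul_nonneg (by linarith [ht.2]) hx
    have h2 : 0 < t * k y := mul_pos ht.1 hy'
    show 0 < k _
    linarith

lemma mem_frontier_iff (D : UCDomain E k θ) {x : Euc n} : x ∈ frontier E ↔ k x = 0 := by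
  have h1 : x ∈ closure E ↔ 0 ≤ k x := by rw [D.closure_eq]; rfl
  have h2 : x ∈ E ↔ 0 < k x := by
    have := D.eq_pos
    constructor
    · intro h; rw [this] at h; exact h
    · intro h; rw [this]; exact h
  rw [frontier, D.isOpen.interior_eq, mem_sdiff, h1, h2]
  constructor
  · rintro ⟨a, b⟩; linarith
  · intro h; rw [h]; simp

lemma mem_closure_iff (D : UCDomain E k θ) {x : Euc n} : x ∈ closure E ↔ 0 ≤ k x := by
  rw [D.closure_eq]; rfl

lemma mem_iff (D : UCDomain E k θ) {x : Euc n} : x ∈ E ↔ 0 < k x := by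
  have := D.eq_pos
  constructor
  · intro h; rw [this] at h; exact h
  · intro h; rw [this]; exact h

lemma mem_or_mem_frontier (D : UCDomain E k θ) {x : Euc n} (hx : x ∈ closure E) :
    x ∈ E ∨ x ∈ frontier E := by
  rw [D.mem_iff, D.mem_frontier_iff]
  rw [D.mem_closure_iff] at hx
  rcases hx.eq_or_lt with h | h
  · exact Or.inr h.symm
  · exact Or.inl h

lemma convex (D : UCDomain E k θ) : Convex ℝ E := by
  rw [D.eq_pos]
  simpa using D.concaveOn.convex_gt 0

lemma convex_closure (D : UCDomain E k θ) : Convex ℝ (closure E) := D.convex.closure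

lemma isCompact_closure (D : UCDomain E k θ) : IsCompact (closure E) :=
  D.isBounded.isCompact_closure

lemma inner_gradient_ge (D : UCDomain E k θ) {x y : Euc n} (hx : x ∈ frontier E)
    (hy : y ∈ closure E) : θ / 2 * ‖y - x‖ ^ 2 ≤ ⟪gradient k x, y - x⟫ := by
  have h := D.le_quadratic x y
  rw [D.mem_frontier_iff.1 hx] at h
  linarith [D.mem_closure_iff.1 hy]

lemma smooth_gradient (D : UCDomain E k θ) : ContDiff ℝ (⊤ : ℕ∞) (gradient k) := by
  have : ContDiff ℝ (⊤ : ℕ∞) (fderiv ℝ k) := D.smooth.fderiv_right (by simp)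
  exact (InnerProductSpace.toDual ℝ (Euc n)).symm.contDiff.comp this

lemma differentiable_gradient (D : UCDomain E k θ) : Differentiable ℝ (gradient k) :=
  D.smooth_gradient.differentiable (by simp)

lemma continuous_gradient (D : UCDomain E k θ) : Continuous (gradient k) :=
  D.smooth_gradient.continuous

/-- Uniform bounds for a defining function and its derivatives on the closed domain. -/
structure Bounds (E : Set (Euc n)) (k : Euc n → ℝ) (M : ℝ) : Prop where
  one_le : 1 ≤ M
  abs_le : ∀ x ∈ closure E, |k x| ≤ M
  norm_gradient_le : ∀ x ∈ closure E, ‖gradient k x‖ ≤ M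
  norm_fderiv_gradient_le : ∀ x ∈ closure E, ‖fderiv ℝ (gradient k) x‖ ≤ M
  norm_fderiv_fderiv_le : ∀ x ∈ closure E, ‖fderiv ℝ (fderiv ℝ k) x‖ ≤ M
  lipschitz : ∀ x ∈ closure E, ∀ y ∈ closure E, ‖gradient k y - gradient k x‖ ≤ M * ‖y - x‖
  taylor : ∀ x ∈ closure E, ∀ y ∈ closure E,
    ‖gradient k y - gradient k x - fderiv ℝ (gradient k) x (y - x)‖ ≤ M * ‖y - x‖ ^ 2
  ge_quadratic : ∀ x ∈ closure E, ∀ y ∈ closure E,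
    k x + ⟪gradient k x, y - x⟫ - M * ‖y - x‖ ^ 2 ≤ k y

lemma exists_bounds (D : UCDomain E k θ) : ∃ M, Bounds E k M := by
  have hc := D.isCompact_closure
  have hcv := D.convex_closure
  have c0 : Continuous k := D.smooth.continuous
  have c1 := D.continuous_gradient
  have s2 : ContDiff ℝ (⊤ : ℕ∞) (fderiv ℝ (gradient k)) := D.smooth_gradient.fderiv_right (by simp)
  have s3 : ContDiff ℝ (⊤ : ℕ∞) (fderiv ℝ (fderiv ℝ (gradient k))) := s2.fderiv_right (by simp)
  have s4 : ContDiff ℝ (⊤ : ℕ∞) (fderiv ℝ k) := D.smooth.fderiv_right (by simp)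
  have s5 : ContDiff ℝ (⊤ : ℕ∞) (fderiv ℝ (fderiv ℝ k)) := s4.fderiv_right (by simp)
  obtain ⟨m0, h0⟩ := hc.exists_bound_of_continuousOn c0.continuousOn
  obtain ⟨m1, h1⟩ := hc.exists_bound_of_continuousOn c1.continuousOn
  obtain ⟨m2, h2⟩ := hc.exists_bound_of_continuousOn s2.continuous.continuousOn
  obtain ⟨m3, h3⟩ := hc.exists_bound_of_continuousOn (f := fderiv ℝ (fderiv ℝ (gradient k)))
    s3.continuous.continuousOn
  obtain ⟨m4, h4⟩ := hc.exists_bound_of_continuousOn (f := fderiv ℝ (fderiv ℝ k))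
    s5.continuous.continuousOn
  set M := 1 + |m0| + |m1| + |m2| + |m3| + |m4| with hM
  have i0 : m0 ≤ M := by
    linarith [le_abs_self m0, abs_nonneg m1, abs_nonneg m2, abs_nonneg m3, abs_nonneg m4]
  have i1 : m1 ≤ M := by
    linarith [le_abs_self m1, abs_nonneg m0, abs_nonneg m2, abs_nonneg m3, abs_nonneg m4]
  have i2 : m2 ≤ M := by
    linarith [le_abs_self m2, abs_nonneg m1, abs_nonneg m0, abs_nonneg m3, abs_nonneg m4]
  have i3 : m3 ≤ M := by
    linarith [le_abs_self m3, abs_nonneg m1, abs_nonneg m2, abs_nonneg m0, abs_nonneg m4]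
  have i4 : m4 ≤ M := by
    linarith [le_abs_self m4, abs_nonneg m1, abs_nonneg m2, abs_nonneg m3, abs_nonneg m0]
  have i5 : 1 ≤ M := by
    linarith [abs_nonneg m4, abs_nonneg m1, abs_nonneg m2, abs_nonneg m3, abs_nonneg m0]
  have hlip : ∀ x ∈ closure E, ∀ y ∈ closure E,
      ‖gradient k y - gradient k x‖ ≤ M * ‖y - x‖ := fun x hx y hy =>
    hcv.norm_image_sub_le_of_norm_fderiv_le (fun z _ => D.differentiable_gradient z)
      (fun z hz => (h2 z hz).trans i2) hx hy
  have hlip2 : ∀ x ∈ closure E, ∀ y ∈ closure E,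
      ‖fderiv ℝ (gradient k) y - fderiv ℝ (gradient k) x‖ ≤ M * ‖y - x‖ := fun x hx y hy =>
    hcv.norm_image_sub_le_of_norm_fderiv_le (fun z _ => s2.differentiable (by simp) z)
      (fun z hz => (h3 z hz).trans i3) hx hy
  refine ⟨M, i5, fun x hx => (h0 x hx).trans i0, fun x hx => (h1 x hx).trans i1,
    fun x hx => (h2 x hx).trans i2, fun x hx => (h4 x hx).trans i4, hlip, fun x hx y hy => ?_,
    fun x hx y hy => ?_⟩
  · have hseg := hcv.segment_subset hx hy
    have := (convex_segment x y).norm_image_sub_le_of_norm_hasFDerivWithin_le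
      (f := fun z => gradient k z - fderiv ℝ (gradient k) x z)
      (f' := fun z => fderiv ℝ (gradient k) z - fderiv ℝ (gradient k) x) (C := M * ‖y - x‖)
      (fun z _ => ((D.differentiable_gradient z).hasFDerivAt.sub
        (fderiv ℝ (gradient k) x).hasFDerivAt).hasFDerivWithinAt)
      (fun z hz => (hlip2 x hx z (hseg hz)).trans
        (mul_le_mul_of_nonneg_left (norm_sub_le_of_mem_segment hz) (by linarith)))
      (left_mem_segment ℝ x y) (right_mem_segment ℝ x y)
    calc _ = ‖gradient k y - fderiv ℝ (gradient k) x y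
          - (gradient k x - fderiv ℝ (gradient k) x x)‖ := by rw [map_sub]; congr 1; abel
      _ ≤ M * ‖y - x‖ * ‖y - x‖ := this
      _ = _ := by ring
  · have hseg := hcv.segment_subset hx hy
    have := (convex_segment x y).norm_image_sub_le_of_norm_hasFDerivWithin_le
      (f := fun z => k z - fderiv ℝ k x z)
      (f' := fun z => fderiv ℝ k z - fderiv ℝ k x) (C := M * ‖y - x‖)
      (fun z _ => ((D.differentiable z).hasFDerivAt.sub
        (fderiv ℝ k x).hasFDerivAt).hasFDerivWithinAt)
      (fun z hz => by
        have e : ‖fderiv ℝ k z - fderiv ℝ k x‖ = ‖gradient k z - gradient k x‖ := by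
          simp only [gradient, ← map_sub, LinearIsometryEquiv.norm_map]
        rw [e]
        exact (hlip x hx z (hseg hz)).trans
          (mul_le_mul_of_nonneg_left (norm_sub_le_of_mem_segment hz) (by linarith)))
      (left_mem_segment ℝ x y) (right_mem_segment ℝ x y)
    rw [Real.norm_eq_abs] at this
    have h := (_root_.abs_le.1 this).1
    rw [← fderiv_eq_inner_gradient, map_sub]
    nlinarith

lemma fderiv_gradient_symm (D : UCDomain E k θ) (x v w : Euc n) :
    ⟪fderiv ℝ (gradient k) x v, w⟫ = ⟪v, fderiv ℝ (gradient k) x w⟫ := by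
  have s4 : ContDiff ℝ (⊤ : ℕ∞) (fderiv ℝ k) := D.smooth.fderiv_right (by simp)
  have e : ∀ v w, ⟪fderiv ℝ (gradient k) x v, w⟫ = fderiv ℝ (fderiv ℝ k) x v w := fun v w => by
    have h := ((InnerProductSpace.toDual ℝ (Euc n)).symm.toContinuousLinearEquiv.hasFDerivAt.comp x
      (s4.differentiable (by simp) x).hasFDerivAt)
    have h' : HasFDerivAt (gradient k) _ x := h
    rw [h'.fderiv]
    simp
  rw [e, real_inner_comm, e]
  exact (D.contDiff_two.contDiffAt.isSymmSndFDerivAt (by simp)) v w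

end UCDomain

/-- A solution `G` of the second boundary value problem, regular up to the boundary, with `DG = U`,
`D²G = T`, together with the quantitative bounds that are known a priori. -/
structure BVSol (E D : Set (Euc n)) (k h : Euc n → ℝ) (G : Euc n → Euc n)
    (U : Euc n → Euc n →L[ℝ] Euc n) (T : Euc n → Euc n →L[ℝ] Euc n →L[ℝ] Euc n)
    (g : Euc n × Euc n → ℝ) (θ M ρ κ C L ε : ℝ) : Prop where
  sol : InteriorSol E G g
  bounds : ∀ x ∈ E, InteriorSol.PointBounds G g ρ κ C L ε x
  domE : UCDomain E k θ
  domD : UCDomain D h θ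
  bE : UCDomain.Bounds E k M
  bD : UCDomain.Bounds D h M
  hasU : ∀ x ∈ closure E, HasFDerivWithinAt G (U x) (closure E) x
  hasT : ∀ x ∈ closure E, HasFDerivWithinAt U (T x) (closure E) x
  contT : ContinuousOn T (closure E)
  pos : ∀ x ∈ closure E, ∀ v, v ≠ 0 → 0 < ⟪U x v, v⟫
  maps : ∀ x ∈ closure E, G x ∈ closure D
  maps_frontier : ∀ x ∈ frontier E, G x ∈ frontier D
  dim_pos : 0 < n
  rho_lt : ρ < 1
  kappa_pos : 0 < κ
  L_nonneg : 0 ≤ L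
  eps_nonneg : 0 ≤ ε
  eps_le_one : ε ≤ 1
  eps_le : 4 * (ε * M) ≤ θ * ((1 - ρ) * κ ^ 2 / n) / 2

namespace BVSol

variable {E D : Set (Euc n)} {k h : Euc n → ℝ} {G : Euc n → Euc n}
  {U : Euc n → Euc n →L[ℝ] Euc n} {T : Euc n → Euc n →L[ℝ] Euc n →L[ℝ] Euc n}
  {g : Euc n × Euc n → ℝ} {θ M ρ κ C L ε : ℝ}

lemma fderiv_eq (S : BVSol E D k h G U T g θ M ρ κ C L ε) {x : Euc n} (hx : x ∈ E) :
    fderiv ℝ G x = U x :=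
  ((S.hasU x (subset_closure hx)).hasFDerivAt
    (Filter.mem_of_superset (S.sol.isOpen.mem_nhds hx) subset_closure)).fderiv

lemma fderiv_fderiv_eq (S : BVSol E D k h G U T g θ M ρ κ C L ε) {x : Euc n} (hx : x ∈ E) :
    fderiv ℝ (fderiv ℝ G) x = T x := by
  have h1 : HasFDerivAt U (T x) x := (S.hasT x (subset_closure hx)).hasFDerivAt
    (Filter.mem_of_superset (S.sol.isOpen.mem_nhds hx) subset_closure)
  have h2 : fderiv ℝ G =ᶠ[𝓝 x] U := by
    filter_upwards [S.sol.isOpen.mem_nhds hx] with z hz using S.fderiv_eq hz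
  rw [h2.fderiv_eq, h1.fderiv]

lemma contU (S : BVSol E D k h G U T g θ M ρ κ C L ε) : ContinuousOn U (closure E) :=
  fun x hx => (S.hasT x hx).continuousWithinAt

lemma contG (S : BVSol E D k h G U T g θ M ρ κ C L ε) : ContinuousOn G (closure E) :=
  fun x hx => (S.hasU x hx).continuousWithinAt

lemma C_pos (S : BVSol E D k h G U T g θ M ρ κ C L ε) : 0 < C := by
  obtain ⟨x, hx⟩ := S.domE.nonempty
  exact S.kappa_pos.trans_le ((S.bounds x hx).tr_ge.trans (S.bounds x hx).tr_le)

lemma symm (S : BVSol E D k h G U T g θ M ρ κ C L ε) {x : Euc n} (hx : x ∈ closure E)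
    (v w : Euc n) : ⟪U x v, w⟫ = ⟪v, U x w⟫ := by
  have hU := S.contU
  have h1 : EqOn (fun x => ⟪U x v, w⟫) (fun x => ⟪v, U x w⟫) E := fun z hz => by
    simp only [← S.fderiv_eq hz, S.sol.symm z hz]
  exact h1.of_subset_closure (by fun_prop) (by fun_prop) subset_closure subset_rfl hx

lemma third_swap (S : BVSol E D k h G U T g θ M ρ κ C L ε) {x : Euc n} (hx : x ∈ closure E)
    (v w : Euc n) : T x v w = T x w v := by
  have hT := S.contT
  have h1 : EqOn (fun x => T x v w) (fun x => T x w v) E := fun z hz => by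
    simp only [← S.fderiv_fderiv_eq hz, S.sol.third_swap hz v w]
  exact h1.of_subset_closure (by fun_prop) (by fun_prop) subset_closure subset_rfl hx

lemma third_symm (S : BVSol E D k h G U T g θ M ρ κ C L ε) {x : Euc n} (hx : x ∈ closure E)
    (u v w : Euc n) : ⟪T x u v, w⟫ = ⟪v, T x u w⟫ := by
  have hT := S.contT
  have h1 : EqOn (fun x => ⟪T x u v, w⟫) (fun x => ⟪v, T x u w⟫) E := fun z hz => by
    simp only [← S.fderiv_fderiv_eq hz, S.sol.third_symm hz]
  exact h1.of_subset_closure (by fun_prop) (by fun_prop) subset_closure subset_rfl hx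

lemma nonneg (S : BVSol E D k h G U T g θ M ρ κ C L ε) {x : Euc n} (hx : x ∈ closure E)
    (v : Euc n) : 0 ≤ ⟪U x v, v⟫ := by
  rcases eq_or_ne v 0 with rfl | hv
  · simp
  · exact (S.pos x hx v hv).le

lemma inner_le (S : BVSol E D k h G U T g θ M ρ κ C L ε) {x : Euc n} (hx : x ∈ closure E)
    (v : Euc n) : ⟪U x v, v⟫ ≤ C * ‖v‖ ^ 2 := by
  have hU := S.contU
  have hc : ContinuousOn (fun x => ⟪U x v, v⟫) (closure E) := by fun_prop
  refine ContinuousWithinAt.closure_le hx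
    ((hc x hx).mono subset_closure) (continuousWithinAt_const (b := C * ‖v‖ ^ 2)) fun z hz => ?_
  rw [← S.fderiv_eq hz]
  exact (inner_le_tr_mul (S.sol.symm z hz) (S.bounds z hz).nonneg v).trans
    (mul_le_mul_of_nonneg_right (S.bounds z hz).tr_le (sq_nonneg _))

lemma norm_le (S : BVSol E D k h G U T g θ M ρ κ C L ε) {x : Euc n} (hx : x ∈ closure E)
    (v : Euc n) : ‖U x v‖ ≤ C * ‖v‖ :=
  norm_apply_le_of_inner_le (S.symm hx) (S.nonneg hx) S.C_pos.le (S.inner_le hx) v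

lemma surjective (S : BVSol E D k h G U T g θ M ρ κ C L ε) {x : Euc n} (hx : x ∈ closure E) :
    Function.Surjective (U x) :=
  surjective_of_inner_pos (S.pos x hx)

/-- The gain constant in the maximum principle. -/
def gain (n : ℕ) (θ ρ κ : ℝ) : ℝ := θ * ((1 - ρ) * κ ^ 2 / n) / 2

/-- The zeroth order constant in the maximum principle. -/
def loss (n : ℕ) (ρ C L : ℝ) : ℝ := L + 4 * C + 2 * n * C / (1 - ρ)

lemma gain_pos (S : BVSol E D k h G U T g θ M ρ κ C L ε) : 0 < gain n θ ρ κ := by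
  have h1 := S.domE.pos
  have h2 := S.rho_lt
  have h3 := S.kappa_pos
  have h4 : (0 : ℝ) < n := by exact_mod_cast S.dim_pos
  have h5 : 0 < 1 - ρ := by linarith
  unfold gain
  positivity

lemma loss_nonneg (S : BVSol E D k h G U T g θ M ρ κ C L ε) : 0 ≤ loss n ρ C L := by
  have h1 := S.C_pos
  have h5 : 0 < 1 - ρ := by linarith [S.rho_lt]
  have := S.L_nonneg
  unfold loss
  positivity

lemma continuousOn_apply (S : BVSol E D k h G U T g θ M ρ κ C L ε) {K : Set (Euc n)} :
    ContinuousOn (fun z : Euc n × Euc n => U z.1 z.2) (closure E ×ˢ K) :=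
  (S.contU.comp continuousOn_fst fun _ hz => hz.1).clm_apply continuousOn_snd

lemma isCompact_fibre (S : BVSol E D k h G U T g θ M ρ κ C L ε) {e : Euc n} {R : ℝ}
    (hR : ∀ x ∈ closure E, ∀ ξ, U x ξ = e → ‖ξ‖ ≤ R) :
    IsCompact {z : Euc n × Euc n | z.1 ∈ closure E ∧ U z.1 z.2 = e} := by
  have hK : IsCompact (closure E ×ˢ Metric.closedBall (0 : Euc n) R) :=
    S.domE.isCompact_closure.prod (isCompact_closedBall _ _)
  have hcl := S.continuousOn_apply.preimage_isClosed_of_isClosed hK.isClosed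
    (isClosed_singleton (x := e))
  have heq : {z : Euc n × Euc n | z.1 ∈ closure E ∧ U z.1 z.2 = e}
      = closure E ×ˢ Metric.closedBall (0 : Euc n) R ∩ (fun z => U z.1 z.2) ⁻¹' {e} := by
    ext z
    constructor
    · rintro ⟨h1, h2⟩
      exact ⟨⟨h1, by simpa using hR z.1 h1 z.2 h2⟩, h2⟩
    · rintro ⟨⟨h1, -⟩, h2⟩
      exact ⟨h1, h2⟩
  rw [heq]
  exact hK.of_isClosed_subset hcl inter_subset_left

/-- For `B` large, `s ⟨e, (DG)⁻¹ e⟩ + ⟨a, G⟩ + Q - B h(G)` is bounded by its boundary values. -/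
theorem le_of_frontier_le (S : BVSol E D k h G U T g θ M ρ κ C L ε) {e a : Euc n} {s B R W : ℝ}
    (he : ‖e‖ ≤ 1) (hs : 0 ≤ s) (hB0 : 0 ≤ B)
    (hR : ∀ x ∈ closure E, ∀ ξ, U x ξ = e → ‖ξ‖ ≤ R)
    {Q : Euc n → ℝ} (hQ : ContDiff ℝ 2 Q) {q₁ q₂ : ℝ} (hq10 : 0 ≤ q₁) (hq20 : 0 ≤ q₂)
    (hq₁ : ∀ x ∈ closure E, ∀ w, |fderiv ℝ Q x w| ≤ q₁ * ‖w‖)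
    (hq₂ : ∀ x ∈ closure E, ∀ w, - q₂ * ‖w‖ ^ 2 ≤ fderiv ℝ (fderiv ℝ Q) x w w)
    (hB : s * (loss n ρ C L + 2 * ε * R) + ε * ‖a‖ + (q₂ * (n + 1) + q₁ * (L + 4 * C))
      < B * gain n θ ρ κ)
    (hW : ∀ x ∈ frontier E, ∀ ξ, U x ξ = e →
      s * ⟪e, ξ⟫ + ⟪a, G x⟫ + Q x - B * h (G x) ≤ W) :
    ∀ x ∈ closure E, ∀ ξ, U x ξ = e → s * ⟪e, ξ⟫ + ⟪a, G x⟫ + Q x - B * h (G x) ≤ W := by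
  intro x hx ξ hξ
  have hh : Continuous h := S.domD.smooth.continuous
  have hQc : Continuous Q := hQ.continuous
  have hG := S.contG
  have hGc : ContinuousOn (fun z : Euc n × Euc n => G z.1)
      {z : Euc n × Euc n | z.1 ∈ closure E ∧ U z.1 z.2 = e} :=
    hG.comp continuousOn_fst fun z hz => hz.1
  obtain ⟨⟨x₀, ξ₀⟩, ⟨hx₀, hξ₀⟩, hmax⟩ := (S.isCompact_fibre hR).exists_isMaxOn ⟨(x, ξ), hx, hξ⟩
    (f := fun z => s * ⟪e, z.2⟫ + ⟪a, G z.1⟫ + Q z.1 - B * h (G z.1))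
    ((((continuousOn_const.mul (continuousOn_const.inner continuousOn_snd)).add
      (continuousOn_const.inner hGc)).add (hQc.comp_continuousOn continuousOn_fst)).sub
      (continuousOn_const.mul (hh.comp_continuousOn hGc)))
  simp only at hx₀ hξ₀
  have hmax' : ∀ z ∈ closure E, ∀ ζ, U z ζ = e →
      s * ⟪e, ζ⟫ + ⟪a, G z⟫ + Q z - B * h (G z)
        ≤ s * ⟪e, ξ₀⟫ + ⟪a, G x₀⟫ + Q x₀ - B * h (G x₀) := fun z hz ζ hζ =>
    hmax (show (z, ζ) ∈ {z : Euc n × Euc n | z.1 ∈ closure E ∧ U z.1 z.2 = e} from ⟨hz, hζ⟩)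
  refine (hmax' x hx ξ hξ).trans ?_
  rcases S.domE.mem_or_mem_frontier hx₀ with hin | hfr
  · exfalso
    have hle := S.sol.barrier_le hin (S.bounds x₀ hin) S.rho_lt S.kappa_pos S.dim_pos S.L_nonneg
      S.eps_nonneg hQ.contDiffAt S.domD.contDiff_two.contDiffAt
      (fun w => fderiv_eq_inner_gradient (G x₀) w)
      (S.bD.norm_gradient_le _ (S.maps x₀ hx₀)) S.domD.pos.le (S.domD.second_le _)
      (hq₁ x₀ hx₀) hq10 hq20 (hq₂ x₀ hx₀) hs hB0 ξ₀ a (by rw [S.fderiv_eq hin, hξ₀]; exact he) (by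
        filter_upwards [S.sol.isOpen.mem_nhds hin] with z hz
        rw [S.fderiv_eq hz, S.fderiv_eq hin, hξ₀]
        refine ⟨S.pos z (subset_closure hz), fun ζ hζ => ?_⟩
        rw [hζ]
        exact hmax' z (subset_closure hz) ζ hζ)
    have h1 : ‖ξ₀‖ ≤ R := hR x₀ hx₀ ξ₀ hξ₀
    have h2 : s * (2 * ε * ‖ξ₀‖) ≤ s * (2 * ε * R) :=
      mul_le_mul_of_nonneg_left (mul_le_mul_of_nonneg_left h1
        (by linarith [S.eps_nonneg])) hs
    have h3 : gain n θ ρ κ ≤ θ * ((1 - ρ) * κ ^ 2 / n) - ε * M := by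
      have h5 := S.eps_le
      have h4 := S.gain_pos
      have h6 : 0 ≤ ε * M := mul_nonneg S.eps_nonneg (by linarith [S.bE.one_le])
      have e : gain n θ ρ κ = θ * ((1 - ρ) * κ ^ 2 / n) / 2 := rfl
      linarith
    have h4 := mul_le_mul_of_nonneg_left h3 hB0
    unfold loss at hB
    linarith
  · exact hW x₀ hfr ξ₀ hξ₀

/-- The constant in the comparison of the two defining functions. -/
def slope (n : ℕ) (θ M ρ κ C L : ℝ) : ℝ :=
  (M * (n + 1) + M * (L + 4 * C) + 1) / gain n θ ρ κ

lemma slope_pos (S : BVSol E D k h G U T g θ M ρ κ C L ε) : 0 < slope n θ M ρ κ C L := by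
  have h1 := S.gain_pos
  have h2 := S.C_pos
  have h3 := S.L_nonneg
  have h4 : 0 < M := by linarith [S.bE.one_le]
  unfold slope
  positivity

theorem le_slope_mul (S : BVSol E D k h G U T g θ M ρ κ C L ε) {x : Euc n} (hx : x ∈ closure E) :
    k x ≤ slope n θ M ρ κ C L * h (G x) := by
  have h1 := S.gain_pos
  have hM : 0 ≤ M := by linarith [S.bE.one_le]
  have := S.le_of_frontier_le (e := 0) (a := 0) (s := 0) (B := slope n θ M ρ κ C L) (R := 0)
    (W := 0) (by simp) le_rfl S.slope_pos.le (fun z hz ξ hξ => by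
      by_contra! hne
      have h0 : ξ ≠ 0 := by simpa using hne
      have := S.pos z hz ξ h0
      rw [hξ, inner_zero_left] at this
      exact lt_irrefl _ this) S.domE.contDiff_two hM hM
    (fun z hz w => by
      rw [fderiv_eq_inner_gradient]
      exact (abs_real_inner_le_norm _ _).trans
        (mul_le_mul_of_nonneg_right (S.bE.norm_gradient_le z hz) (norm_nonneg _)))
    (fun z hz w => by
      have h1 := (fderiv ℝ (fderiv ℝ k) z).le_opNorm₂ w w
      rw [Real.norm_eq_abs] at h1
      have h2 : ‖fderiv ℝ (fderiv ℝ k) z‖ * ‖w‖ * ‖w‖ ≤ M * ‖w‖ * ‖w‖ := by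
        gcongr
        exact S.bE.norm_fderiv_fderiv_le z hz
      linarith [(abs_le.1 h1).1])
    (by
      have e : slope n θ M ρ κ C L * gain n θ ρ κ = M * (n + 1) + M * (L + 4 * C) + 1 := by
        unfold slope
        exact div_mul_cancel₀ _ h1.ne'
      rw [e]
      simp)
    (fun z hz ξ _ => by
      rw [S.domE.mem_frontier_iff.1 hz, S.domD.mem_frontier_iff.1 (S.maps_frontier z hz)]
      simp) x hx 0 (by simp)
  simp only [zero_mul, inner_zero_left, zero_add] at this
  linarith

lemma norm_gradient_k (S : BVSol E D k h G U T g θ M ρ κ C L ε) {x : Euc n} (hx : x ∈ frontier E) :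
    ‖gradient k x‖ = 1 := S.domE.norm_gradient x hx

lemma norm_gradient_h (S : BVSol E D k h G U T g θ M ρ κ C L ε) {x : Euc n} (hx : x ∈ frontier E) :
    ‖gradient h (G x)‖ = 1 := S.domD.norm_gradient _ (S.maps_frontier x hx)

lemma _root_.UCDomain.eventually_mem (dom : UCDomain E k θ) {x v : Euc n} (hx : x ∈ frontier E)
    (hv : 0 < ⟪gradient k x, v⟫) : ∀ᶠ t : ℝ in 𝓝[>] 0, x + t • v ∈ E := by
  have hd : HasDerivAt (fun t : ℝ => k (x + t • v)) ⟪gradient k x, v⟫ 0 := by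
    have hl : HasDerivAt (fun t : ℝ => x + t • v) v 0 := by
      simpa using ((hasDerivAt_id (0 : ℝ)).smul_const v).const_add x
    have hk : HasFDerivAt k (fderiv ℝ k x) (x + (0 : ℝ) • v) := by
      simpa using (dom.differentiable x).hasFDerivAt
    rw [← fderiv_eq_inner_gradient]
    exact hk.comp_hasDerivAt 0 hl
  have h0 : k x = 0 := dom.mem_frontier_iff.1 hx
  have h1 := (hasDerivAt_iff_tendsto_slope_zero.1 hd).mono_left
    (nhdsWithin_mono (0 : ℝ) (fun t (ht : 0 < t) => ne_of_gt ht))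
  filter_upwards [h1.eventually_const_lt hv, self_mem_nhdsWithin] with t ht ht0
  rw [dom.mem_iff]
  simp only [zero_add, zero_smul, add_zero, h0, sub_zero, smul_eq_mul] at ht
  have ht0' : (0 : ℝ) < t := ht0
  have : k (x + t • v) = t * (t⁻¹ * k (x + t • v)) := by field_simp
  rw [this]
  exact mul_pos ht0' ht

lemma _root_.UCDomain.fderivWithin_nonneg (dom : UCDomain E k θ) {x v : Euc n}
    (hx : x ∈ frontier E) (hv : 0 < ⟪gradient k x, v⟫) {F : Euc n → ℝ} {F' : Euc n →L[ℝ] ℝ}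
    (hF : HasFDerivWithinAt F F' (closure E) x) (hmin : ∀ z ∈ closure E, F x ≤ F z) : 0 ≤ F' v := by
  have hm : IsLocalMinOn F (closure E) x :=
    (show IsMinOn F (closure E) x from fun z hz => hmin z hz).localize
  refine hm.hasFDerivWithinAt_nonneg hF (mem_posTangentConeAt_of_frequently_mem ?_)
  exact ((dom.eventually_mem hx hv).mono fun t ht => subset_closure ht).frequently

lemma hasFDerivWithinAt_h (S : BVSol E D k h G U T g θ M ρ κ C L ε) {x : Euc n}
    (hx : x ∈ closure E) :
    HasFDerivWithinAt (fun z => h (G z)) ((fderiv ℝ h (G x)).comp (U x)) (closure E) x :=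
  (S.domD.differentiable (G x)).hasFDerivAt.comp_hasFDerivWithinAt x (S.hasU x hx)

/-- Obliqueness: `DG ∇h(G)` is a positive multiple of `∇k` on the boundary. -/
theorem exists_oblique (S : BVSol E D k h G U T g θ M ρ κ C L ε) {x : Euc n}
    (hx : x ∈ frontier E) : ∃ μ : ℝ, 1 / slope n θ M ρ κ C L ≤ μ ∧
      U x (gradient h (G x)) = μ • gradient k x := by
  set A := slope n θ M ρ κ C L with hA
  have hApos : 0 < A := S.slope_pos
  have hxc : x ∈ closure E := frontier_subset_closure hx
  have hν := S.norm_gradient_k hx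
  set w := A • U x (gradient h (G x)) - gradient k x with hw
  have key : ∀ v, 0 < ⟪gradient k x, v⟫ → 0 ≤ ⟪w, v⟫ := fun v hv => by
    have hF := ((S.hasFDerivWithinAt_h hxc).const_mul A).sub
      (S.domE.differentiable x).hasFDerivAt.hasFDerivWithinAt
    have := S.domE.fderivWithin_nonneg hx hv hF (fun z hz => by
      have h1 := S.le_slope_mul hz
      have h2 : k x = 0 := S.domE.mem_frontier_iff.1 hx
      have h3 : h (G x) = 0 := S.domD.mem_frontier_iff.1 (S.maps_frontier x hx)
      simp only [Pi.sub_apply, h2, h3]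
      linarith)
    rw [hw, inner_sub_left, real_inner_smul_left, S.symm hxc, ← fderiv_eq_inner_gradient,
      ← fderiv_eq_inner_gradient]
    simpa using this
  have hνν : ⟪gradient k x, gradient k x⟫ = 1 := by rw [real_inner_self_eq_norm_sq, hν]; norm_num
  set t := ⟪w, gradient k x⟫ with ht
  have ht0 : 0 ≤ t := key _ (by rw [hνν]; norm_num)
  set z := w - t • gradient k x with hz
  have hzk : ⟪gradient k x, z⟫ = 0 := by
    rw [hz, inner_sub_right, real_inner_smul_right, hνν, ht, real_inner_comm]; ring
  have hwz : ⟪w, z⟫ = ‖z‖ ^ 2 := by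
    have : w = z + t • gradient k x := by rw [hz]; abel
    rw [← real_inner_self_eq_norm_sq]
    nth_rewrite 1 [this]
    rw [inner_add_left, real_inner_smul_left, hzk]; ring
  have hz0 : z = 0 := by
    by_contra hne
    have hpos : 0 < ‖z‖ ^ 2 := by positivity
    set η := ‖z‖ ^ 2 / (2 * (t + 1)) with hη
    have hηpos : 0 < η := by positivity
    have h1 := key (η • gradient k x - z) (by
      rw [inner_sub_right, real_inner_smul_right, hνν, hzk]; linarith)
    rw [inner_sub_right, real_inner_smul_right, hwz, ← ht] at h1
    have h2 : η * (2 * (t + 1)) = ‖z‖ ^ 2 := by rw [hη]; field_simp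
    nlinarith
  refine ⟨(1 + t) / A, by gcongr; linarith, ?_⟩
  have h1 : A • U x (gradient h (G x)) = (1 + t) • gradient k x := by
    have : w = t • gradient k x := by rw [← sub_eq_zero, ← hz, hz0]
    rw [add_smul, one_smul, ← this, hw]; abel
  rw [div_eq_inv_mul, mul_smul, ← h1, smul_smul, inv_mul_cancel₀ hApos.ne', one_smul]

/-- The lower bound for the cosine of the angle between the two normals. -/
def obliq (n : ℕ) (θ M ρ κ C L : ℝ) : ℝ := 1 / (slope n θ M ρ κ C L * C)

lemma obliq_pos (S : BVSol E D k h G U T g θ M ρ κ C L ε) : 0 < obliq n θ M ρ κ C L := by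
  have h1 := S.slope_pos
  have h2 := S.C_pos
  unfold obliq
  positivity

lemma obliq_le (S : BVSol E D k h G U T g θ M ρ κ C L ε) {x : Euc n} (hx : x ∈ frontier E) :
    obliq n θ M ρ κ C L ≤ ⟪gradient k x, gradient h (G x)⟫ := by
  obtain ⟨μ, h1, h2⟩ := S.exists_oblique hx
  have hxc : x ∈ closure E := frontier_subset_closure hx
  have hA := S.slope_pos
  have hC := S.C_pos
  have hμ : 0 < μ := lt_of_lt_of_le (by positivity) h1
  have h3 := norm_sq_le_of_inner_le (S.symm hxc) (S.nonneg hxc) (S.inner_le hxc)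
    (gradient h (G x))
  rw [h2, norm_smul, S.norm_gradient_k hx, real_inner_smul_left, Real.norm_eq_abs, abs_of_pos hμ,
    mul_one] at h3
  have h4 : μ ≤ C * ⟪gradient k x, gradient h (G x)⟫ := by
    have : μ * μ ≤ μ * (C * ⟪gradient k x, gradient h (G x)⟫) := by linarith
    exact le_of_mul_le_mul_left this hμ
  have h5 : obliq n θ M ρ κ C L = 1 / slope n θ M ρ κ C L / C := by
    unfold obliq; rw [div_div]
  rw [h5, div_le_iff₀ hC]
  linarith

lemma inner_normals_le_one (S : BVSol E D k h G U T g θ M ρ κ C L ε) {x : Euc n}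
    (hx : x ∈ frontier E) : ⟪gradient k x, gradient h (G x)⟫ ≤ 1 := by
  have := real_inner_le_norm (gradient k x) (gradient h (G x))
  rwa [S.norm_gradient_k hx, S.norm_gradient_h hx, mul_one] at this

/-- Boundary values of `⟨e, (DG)⁻¹ e⟩` are controlled by the values in directions tangential to
the boundary of the image. -/
theorem inner_le_of_tangential (S : BVSol E D k h G U T g θ M ρ κ C L ε) {x : Euc n}
    (hx : x ∈ frontier E) {m : ℝ} (hm1 : 1 ≤ m)
    (hm : ∀ ξ, ⟪U x ξ, gradient h (G x)⟫ = 0 → ⟪U x ξ, ξ⟫ ≤ m * ‖U x ξ‖ ^ 2)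
    {e ξ : Euc n} (he : ‖e‖ = 1) (hξ : U x ξ = e) {s : ℝ}
    (hs : s = ⟪e, gradient h (G x)⟫ / ⟪gradient k x, gradient h (G x)⟫) :
    ⟪e, ξ⟫ ≤ m * (1 - 2 * s * ⟪gradient k x, e⟫ + (1 + slope n θ M ρ κ C L) * s ^ 2) := by
  obtain ⟨μ, h1, h2⟩ := S.exists_oblique hx
  have hxc : x ∈ closure E := frontier_subset_closure hx
  have hA := S.slope_pos
  have hμ : 0 < μ := lt_of_lt_of_le (by positivity) h1
  set ν := gradient h (G x) with hν
  set νk := gradient k x with hνk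
  have hob : 0 < ⟪νk, ν⟫ := S.obliq_pos.trans_le (S.obliq_le hx)
  have hob1 : ⟪νk, ν⟫ ≤ 1 := S.inner_normals_le_one hx
  have hsν : s * ⟪νk, ν⟫ = ⟪e, ν⟫ := by rw [hs]; field_simp
  set ξ' := ξ - (s / μ) • ν with hξ'
  have hU' : U x ξ' = e - s • νk := by
    rw [hξ', map_sub, map_smul, h2, hξ, smul_smul, div_mul_cancel₀ _ hμ.ne']
  have horth : ⟪U x ξ', ν⟫ = 0 := by
    rw [hU', inner_sub_left, real_inner_smul_left, hsν, sub_self]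
  have hmξ := hm ξ' horth
  have hnorm : ‖U x ξ'‖ ^ 2 = 1 - 2 * s * ⟪νk, e⟫ + s ^ 2 := by
    rw [hU', ← real_inner_self_eq_norm_sq, inner_sub_left, inner_sub_right, inner_sub_right,
      real_inner_smul_left, real_inner_smul_left, real_inner_smul_right, real_inner_smul_right,
      real_inner_self_eq_norm_sq, real_inner_self_eq_norm_sq, he, S.norm_gradient_k hx,
      real_inner_comm e νk]
    ring
  have hsplit : ⟪e, ξ⟫ = ⟪U x ξ', ξ'⟫ + s ^ 2 / μ * ⟪νk, ν⟫ := by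
    have e1 : ξ = ξ' + (s / μ) • ν := by rw [hξ']; abel
    have e2 : U x ξ = U x ξ' + s • νk := by rw [hU', hξ]; abel
    have e3 : ⟪νk, ξ'⟫ = 0 := by
      have : μ * ⟪νk, ξ'⟫ = 0 := by
        rw [← real_inner_smul_left, ← h2, S.symm hxc, real_inner_comm, horth]
      exact (mul_eq_zero.1 this).resolve_left hμ.ne'
    have e4 : ⟪U x ξ' + s • νk, ξ⟫ = ⟪U x ξ' + s • νk, ξ' + (s / μ) • ν⟫ := by rw [← e1]
    rw [← hξ, e2, e4, inner_add_left, inner_add_right, inner_add_right, real_inner_smul_left,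
      real_inner_smul_left, real_inner_smul_right, real_inner_smul_right, horth, e3]
    ring
  have h3 : s ^ 2 / μ * ⟪νk, ν⟫ ≤ slope n θ M ρ κ C L * s ^ 2 := by
    have h4 : 1 / μ ≤ slope n θ M ρ κ C L := by
      rw [div_le_iff₀ hμ]
      rw [div_le_iff₀ hA] at h1
      linarith
    have h5 : s ^ 2 / μ * ⟪νk, ν⟫ ≤ s ^ 2 / μ := mul_le_of_le_one_right (by positivity) hob1
    have h6 := mul_le_mul_of_nonneg_left h4 (sq_nonneg s)
    have h7 : s ^ 2 * (1 / μ) = s ^ 2 / μ := by ring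
    linarith
  have h8 : slope n θ M ρ κ C L * s ^ 2 ≤ m * (slope n θ M ρ κ C L * s ^ 2) :=
    le_mul_of_one_le_left (by positivity) hm1
  rw [hsplit]
  rw [hnorm] at hmξ
  linarith

end BVSol

namespace BVSol

variable {E D : Set (Euc n)} {k h : Euc n → ℝ} {G : Euc n → Euc n}
  {U : Euc n → Euc n →L[ℝ] Euc n} {T : Euc n → Euc n →L[ℝ] Euc n →L[ℝ] Euc n}
  {g : Euc n × Euc n → ℝ} {θ M ρ κ C L ε : ℝ}

lemma exists_min (S : BVSol E D k h G U T g θ M ρ κ C L ε) :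
    ∃ δ > 0, (∀ x ∈ closure E, ∀ v, δ * ‖v‖ ^ 2 ≤ ⟪U x v, v⟫) ∧
      ∃ x ∈ closure E, ∃ ζ, ‖ζ‖ = 1 ∧ ⟪U x ζ, ζ⟫ = δ := by
  have hK : IsCompact (closure E ×ˢ Metric.sphere (0 : Euc n) 1) :=
    S.domE.isCompact_closure.prod (isCompact_sphere _ _)
  obtain ⟨x, hx⟩ := S.domE.nonempty
  have hne : (closure E ×ˢ Metric.sphere (0 : Euc n) 1).Nonempty :=
    ⟨(x, EuclideanSpace.single ⟨0, S.dim_pos⟩ 1), subset_closure hx, by simp⟩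
  obtain ⟨⟨x₁, ζ⟩, ⟨hx₁, hζ⟩, hmin⟩ := hK.exists_isMinOn hne
    (f := fun z => ⟪U z.1 z.2, z.2⟫) (S.continuousOn_apply.inner continuousOn_snd)
  have hζ1 : ‖ζ‖ = 1 := by simpa using hζ
  refine ⟨⟪U x₁ ζ, ζ⟫, S.pos x₁ hx₁ ζ (by rintro rfl; simp at hζ1), fun z hz v => ?_,
    x₁, hx₁, ζ, hζ1, rfl⟩
  rcases eq_or_ne v 0 with rfl | hv
  · simp
  have hv' : 0 < ‖v‖ := norm_pos_iff.2 hv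
  have h1 : ⟪U x₁ ζ, ζ⟫ ≤ ⟪U z (‖v‖⁻¹ • v), ‖v‖⁻¹ • v⟫ :=
    hmin (show (z, ‖v‖⁻¹ • v) ∈ closure E ×ˢ Metric.sphere (0 : Euc n) 1 from
      ⟨hz, by simp [norm_smul, hv'.ne']⟩)
  rw [map_smul, real_inner_smul_left, real_inner_smul_right] at h1
  have h2 := mul_le_mul_of_nonneg_right h1 (sq_nonneg ‖v‖)
  have h3 : ‖v‖⁻¹ * (‖v‖⁻¹ * ⟪U z v, v⟫) * ‖v‖ ^ 2 = ⟪U z v, v⟫ := by field_simp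
  rwa [h3] at h2

lemma norm_le_of_min {δ : ℝ} (hδ : 0 < δ) {A : Euc n →L[ℝ] Euc n} {e ξ : Euc n}
    (hmin : ∀ v, δ * ‖v‖ ^ 2 ≤ ⟪A v, v⟫) (he : ‖e‖ ≤ 1) (hξ : A ξ = e) : ‖ξ‖ ≤ 1 / δ := by
  have h1 := hmin ξ
  rw [hξ] at h1
  have h2 : ⟪e, ξ⟫ ≤ ‖ξ‖ := (real_inner_le_norm e ξ).trans
    (mul_le_of_le_one_left (norm_nonneg _) he)
  rw [le_div_iff₀ hδ]
  by_contra! h3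
  have h4 : 0 < ‖ξ‖ := by
    by_contra! h5
    have : ‖ξ‖ = 0 := le_antisymm h5 (norm_nonneg _)
    rw [this] at h3
    linarith
  nlinarith

/-- The bound for boundary values in terms of tangential boundary values. -/
def bdryRatio (n : ℕ) (θ M ρ κ C L : ℝ) : ℝ :=
  1 + 2 / obliq n θ M ρ κ C L + (1 + slope n θ M ρ κ C L) / obliq n θ M ρ κ C L ^ 2

/-- The bound for interior values in terms of tangential boundary values. -/
def pinch (n : ℕ) (θ M ρ κ C L : ℝ) : ℝ :=
  2 * bdryRatio n θ M ρ κ C L + 2 * (M * ((loss n ρ C L + 1) / gain n θ ρ κ))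

lemma bdryRatio_pos (S : BVSol E D k h G U T g θ M ρ κ C L ε) :
    0 < bdryRatio n θ M ρ κ C L := by
  have := S.obliq_pos
  have := S.slope_pos
  unfold bdryRatio
  positivity

lemma pinch_pos (S : BVSol E D k h G U T g θ M ρ κ C L ε) : 0 < pinch n θ M ρ κ C L := by
  have := S.bdryRatio_pos
  have := S.loss_nonneg
  have := S.gain_pos
  have : 0 < M := by linarith [S.bE.one_le]
  unfold pinch
  positivity

lemma obliq_le_one (S : BVSol E D k h G U T g θ M ρ κ C L ε) {x : Euc n} (hx : x ∈ frontier E) :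
    obliq n θ M ρ κ C L ≤ 1 :=
  (S.obliq_le hx).trans (S.inner_normals_le_one hx)

lemma abs_div_obliq_le (S : BVSol E D k h G U T g θ M ρ κ C L ε) {x : Euc n}
    (hx : x ∈ frontier E) {r b : ℝ} (hr : |r| ≤ b) :
    |r / ⟪gradient k x, gradient h (G x)⟫| ≤ b / obliq n θ M ρ κ C L := by
  have h1 := S.obliq_pos
  have h2 := S.obliq_le hx
  rw [abs_div, abs_of_pos (h1.trans_le h2)]
  have : 0 ≤ b := (abs_nonneg r).trans hr
  gcongr

theorem inv_min_le (S : BVSol E D k h G U T g θ M ρ κ C L ε) {m : ℝ} (hm1 : 1 ≤ m)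
    (hm : ∀ x ∈ frontier E, ∀ ξ, ⟪U x ξ, gradient h (G x)⟫ = 0 →
      ⟪U x ξ, ξ⟫ ≤ m * ‖U x ξ‖ ^ 2) {δ : ℝ} (hδ : 0 < δ)
    (hmin : ∀ x ∈ closure E, ∀ v, δ * ‖v‖ ^ 2 ≤ ⟪U x v, v⟫) {x₁ ζ : Euc n}
    (hx₁ : x₁ ∈ closure E) (hζ : ‖ζ‖ = 1) (hζδ : ⟪U x₁ ζ, ζ⟫ = δ) :
    1 / δ ≤ pinch n θ M ρ κ C L * m := by
  have hc0 := S.gain_pos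
  have hΛ := S.loss_nonneg
  have hε := S.eps_nonneg
  have hM : 0 < M := by linarith [S.bE.one_le]
  set B := (loss n ρ C L + 1 + 2 * ε * (1 / δ)) / gain n θ ρ κ with hB
  have hBc : B * gain n θ ρ κ = loss n ρ C L + 1 + 2 * ε * (1 / δ) := div_mul_cancel₀ _ hc0.ne'
  have hB0 : 0 ≤ B := by positivity
  obtain ⟨ξ₁, hξ₁⟩ := S.surjective hx₁ ζ
  have hmain := S.le_of_frontier_le (e := ζ) (a := 0) (s := 1) (B := B) (R := 1 / δ)
    (W := m * bdryRatio n θ M ρ κ C L) (Q := fun _ => 0) hζ.le zero_le_one hB0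
    (fun x hx ξ hξ => norm_le_of_min hδ (hmin x hx) hζ.le hξ) contDiff_const (q₁ := 0) (q₂ := 0)
    le_rfl le_rfl (fun x _ w => by simp) (fun x _ w => by
      have : fderiv ℝ (fun _ : Euc n => (0 : ℝ)) = fun _ => 0 := by ext; simp
      rw [this]; simp)
    (by rw [hBc]; simp) (fun x hx ξ hξ => by
      rw [S.domD.mem_frontier_iff.1 (S.maps_frontier x hx)]
      have h1 := S.inner_le_of_tangential hx hm1 (hm x hx) hζ hξ rfl
      set s := ⟪ζ, gradient h (G x)⟫ / ⟪gradient k x, gradient h (G x)⟫ with hs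
      have h2 : |s| ≤ 1 / obliq n θ M ρ κ C L := S.abs_div_obliq_le hx (by
        have := abs_real_inner_le_norm ζ (gradient h (G x))
        rwa [hζ, S.norm_gradient_h hx, mul_one] at this)
      have h3 : |⟪gradient k x, ζ⟫| ≤ 1 := by
        have := abs_real_inner_le_norm (gradient k x) ζ
        rwa [hζ, S.norm_gradient_k hx, mul_one] at this
      have h4 : |s * ⟪gradient k x, ζ⟫| ≤ 1 / obliq n θ M ρ κ C L := by
        rw [abs_mul]
        exact (mul_le_of_le_one_right (abs_nonneg _) h3).trans h2
      have h5 : s ^ 2 ≤ 1 / obliq n θ M ρ κ C L ^ 2 := by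
        rw [← sq_abs, ← _root_.one_div_pow]
        exact pow_le_pow_left₀ (abs_nonneg _) h2 2
      have h6 := mul_le_mul_of_nonneg_left h5 (by linarith [S.slope_pos] :
        0 ≤ 1 + slope n θ M ρ κ C L)
      have h7 : 1 - 2 * s * ⟪gradient k x, ζ⟫ + (1 + slope n θ M ρ κ C L) * s ^ 2
          ≤ bdryRatio n θ M ρ κ C L := by
        unfold bdryRatio
        have e1 : 2 / obliq n θ M ρ κ C L = 2 * (1 / obliq n θ M ρ κ C L) := by ring
        have e2 : (1 + slope n θ M ρ κ C L) / obliq n θ M ρ κ C L ^ 2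
          = (1 + slope n θ M ρ κ C L) * (1 / obliq n θ M ρ κ C L ^ 2) := by ring
        rw [e1, e2]
        linarith [(abs_le.1 h4).1]
      have h8 := mul_le_mul_of_nonneg_left h7 (by linarith : 0 ≤ m)
      simp only [one_mul, inner_zero_left, mul_zero, sub_zero, add_zero]
      linarith) x₁ hx₁ ξ₁ hξ₁
  simp only [one_mul, inner_zero_left, add_zero] at hmain
  have h1 : 1 / δ ≤ ⟪ζ, ξ₁⟫ := by
    have h2 := two_mul_inner_sub_le (S.symm hx₁) (S.nonneg hx₁) ξ₁ ((1 / δ) • ζ)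
    rw [map_smul, real_inner_smul_left, real_inner_smul_right, real_inner_smul_right, hζδ, hξ₁,
      real_inner_self_eq_norm_sq, hζ] at h2
    have h3 : 2 * (1 / δ * 1 ^ 2) - 1 / δ * (1 / δ * δ) = 1 / δ := by field_simp; ring
    linarith
  have h2 : B * h (G x₁) ≤ B * M :=
    mul_le_mul_of_nonneg_left ((le_abs_self _).trans (S.bD.abs_le _ (S.maps x₁ hx₁))) hB0
  have h3 : B * M ≤ M * ((loss n ρ C L + 1) / gain n θ ρ κ) + 1 / 2 * (1 / δ) := by
    have h4 : 4 * (ε * M) ≤ gain n θ ρ κ := S.eps_le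
    have e : B * M = M * ((loss n ρ C L + 1) / gain n θ ρ κ)
        + (2 * (ε * M) / gain n θ ρ κ) * (1 / δ) := by
      rw [hB]; field_simp
    have h5 : 2 * (ε * M) / gain n θ ρ κ ≤ 1 / 2 := by
      rw [div_le_iff₀ hc0]; linarith
    have h6 : 0 ≤ 1 / δ := by positivity
    have h7 := mul_le_mul_of_nonneg_right h5 h6
    linarith
  have h4 : M * ((loss n ρ C L + 1) / gain n θ ρ κ)
      ≤ M * ((loss n ρ C L + 1) / gain n θ ρ κ) * m :=
    le_mul_of_one_le_right (by positivity) hm1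
  unfold pinch
  linarith

/-- The quadratic error constant in the boundary expansion. -/
def errQuad (n : ℕ) (θ M ρ κ C L : ℝ) : ℝ :=
  2 * M / obliq n θ M ρ κ C L + 4 * (M / obliq n θ M ρ κ C L) ^ 2
    + (1 + slope n θ M ρ κ C L) * (M / obliq n θ M ρ κ C L) ^ 2

/-- The linear error constant in the boundary expansion. -/
def errLin (n : ℕ) (θ M ρ κ C L : ℝ) : ℝ := 2 * errQuad n θ M ρ κ C L / θ

lemma errQuad_nonneg (S : BVSol E D k h G U T g θ M ρ κ C L ε) :
    0 ≤ errQuad n θ M ρ κ C L := by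
  have := S.obliq_pos
  have := S.slope_pos
  have : 0 < M := by linarith [S.bE.one_le]
  unfold errQuad
  positivity

lemma errLin_nonneg (S : BVSol E D k h G U T g θ M ρ κ C L ε) :
    0 ≤ errLin n θ M ρ κ C L := by
  have := S.errQuad_nonneg
  have := S.domE.pos
  unfold errLin
  positivity

/-- The linear coefficient of the boundary expansion at `x₀`. -/
def tilt (k h : Euc n → ℝ) (G : Euc n → Euc n) (x₀ e : Euc n) : Euc n :=
  (2 * (⟪gradient k x₀, e⟫ / ⟪gradient k x₀, gradient h (G x₀)⟫)) •
    fderiv ℝ (gradient h) (G x₀) e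

lemma norm_tilt_le (S : BVSol E D k h G U T g θ M ρ κ C L ε) {x₀ e : Euc n}
    (hx₀ : x₀ ∈ frontier E) (he : ‖e‖ = 1) :
    ‖tilt k h G x₀ e‖ ≤ 2 * M / obliq n θ M ρ κ C L := by
  have h1 : |⟪gradient k x₀, e⟫ / ⟪gradient k x₀, gradient h (G x₀)⟫|
      ≤ 1 / obliq n θ M ρ κ C L := S.abs_div_obliq_le hx₀ (by
    have := abs_real_inner_le_norm (gradient k x₀) e
    rwa [he, S.norm_gradient_k hx₀, mul_one] at this)
  have h2 : ‖fderiv ℝ (gradient h) (G x₀) e‖ ≤ M := by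
    have h3 := (fderiv ℝ (gradient h) (G x₀)).le_opNorm e
    have h4 := S.bD.norm_fderiv_gradient_le _ (S.maps x₀ (frontier_subset_closure hx₀))
    rw [he, mul_one] at h3
    exact h3.trans h4
  have h5 := S.obliq_pos
  unfold tilt
  rw [norm_smul, Real.norm_eq_abs, abs_mul, abs_two]
  calc _ ≤ 2 * (1 / obliq n θ M ρ κ C L) * M := by gcongr
    _ = _ := by ring

set_option maxHeartbeats 1000000 in
/-- Expansion of the boundary bound around `x₀` in a direction `e` tangential there. -/
theorem frontier_expansion (S : BVSol E D k h G U T g θ M ρ κ C L ε) {x₀ x e : Euc n}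
    (hx₀ : x₀ ∈ frontier E) (hx : x ∈ frontier E) (he : ‖e‖ = 1)
    (htan : ⟪e, gradient h (G x₀)⟫ = 0) {s : ℝ}
    (hs : s = ⟪e, gradient h (G x)⟫ / ⟪gradient k x, gradient h (G x)⟫) :
    1 - 2 * s * ⟪gradient k x, e⟫ + (1 + slope n θ M ρ κ C L) * s ^ 2
      ≤ 1 - ⟪tilt k h G x₀ e, G x - G x₀⟫ + errLin n θ M ρ κ C L *
        (⟪gradient h (G x₀), G x - G x₀⟫ + ⟪gradient k x₀, x - x₀⟫) := by
  have hxc := frontier_subset_closure hx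
  have hx₀c := frontier_subset_closure hx₀
  have hM : 0 < M := by linarith [S.bE.one_le]
  have hc := S.obliq_pos
  have hc1 := S.obliq_le_one hx
  have hA := S.slope_pos
  set c := obliq n θ M ρ κ C L with hcdef
  set A := slope n θ M ρ κ C L with hAdef
  set p := G x
  set p₀ := G x₀
  set P := ‖p - p₀‖ with hP
  set X := ‖x - x₀‖ with hX
  have hP0 : 0 ≤ P := norm_nonneg _
  have hX0 : 0 ≤ X := norm_nonneg _
  set σ := ⟪e, gradient h p⟫ with hσ
  set d := ⟪gradient k x, gradient h p⟫ with hd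
  set d₀ := ⟪gradient k x₀, gradient h p₀⟫ with hd₀
  set b := ⟪gradient k x, e⟫ with hb
  set b₀ := ⟪gradient k x₀, e⟫ with hb₀
  have hdc : c ≤ d := S.obliq_le hx
  have hd₀c : c ≤ d₀ := S.obliq_le hx₀
  have hdpos : 0 < d := hc.trans_le hdc
  have hd₀pos : 0 < d₀ := hc.trans_le hd₀c
  have hν : ‖gradient h p - gradient h p₀‖ ≤ M * P :=
    S.bD.lipschitz _ (S.maps x₀ hx₀c) _ (S.maps x hxc)
  have hκ : ‖gradient k x - gradient k x₀‖ ≤ M * X := S.bE.lipschitz _ hx₀c _ hxc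
  have hσ' : σ = ⟪e, gradient h p - gradient h p₀⟫ := by rw [inner_sub_right, htan, sub_zero]
  have hσle : |σ| ≤ M * P := by
    rw [hσ']
    exact (abs_real_inner_le_norm _ _).trans (by rw [he, one_mul]; exact hν)
  set r := ⟪e, gradient h p - gradient h p₀ - fderiv ℝ (gradient h) p₀ (p - p₀)⟫ with hr
  have hrle : |r| ≤ M * P ^ 2 := by
    refine (abs_real_inner_le_norm _ _).trans ?_
    rw [he, one_mul]
    exact S.bD.taylor _ (S.maps x₀ hx₀c) _ (S.maps x hxc)
  have hσr : σ = ⟪fderiv ℝ (gradient h) p₀ e, p - p₀⟫ + r := by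
    rw [S.domD.fderiv_gradient_symm, hr, inner_sub_right e (_ - _), ← hσ']; ring
  set β₀ := b₀ / d₀ with hβ₀
  have hβ₀le : |β₀| ≤ 1 / c := S.abs_div_obliq_le hx₀ (by
    have := abs_real_inner_le_norm (gradient k x₀) e
    rwa [he, S.norm_gradient_k hx₀, mul_one] at this)
  have htilt : ⟪tilt k h G x₀ e, p - p₀⟫ = 2 * β₀ * (σ - r) := by
    unfold tilt
    rw [real_inner_smul_left, hσr]; ring
  have hbb : |b - b₀| ≤ M * X := by
    rw [hb, hb₀, ← inner_sub_left]
    exact (abs_real_inner_le_norm _ _).trans (by rw [he, mul_one]; exact hκ)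
  have hdd : |d₀ - d| ≤ M * X + M * P := by
    have e1 : d₀ - d = -(⟪gradient k x - gradient k x₀, gradient h p⟫
        + ⟪gradient k x₀, gradient h p - gradient h p₀⟫) := by
      rw [inner_sub_left, inner_sub_right]; ring
    rw [e1, abs_neg]
    refine (abs_add_le _ _).trans (add_le_add ?_ ?_)
    · exact (abs_real_inner_le_norm _ _).trans (by rw [S.norm_gradient_h hx, mul_one]; exact hκ)
    · exact (abs_real_inner_le_norm _ _).trans (by rw [S.norm_gradient_k hx₀, one_mul]; exact hν)
  set τ := M / c with hτ
  have hτ0 : 0 < τ := by positivity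
  have hMτ : M ≤ τ := by rw [hτ, le_div_iff₀ hc]; nlinarith
  have hc1' : 1 ≤ 1 / c := by rw [le_div_iff₀ hc]; linarith
  have hβ : |b / d - β₀| ≤ 1 / c * (τ * (2 * X + P)) := by
    have e1 : b / d - β₀ = (b - b₀) / d + β₀ * ((d₀ - d) / d) := by
      rw [hβ₀]; field_simp; ring
    have h1 : |(b - b₀) / d| ≤ M * X / c := S.abs_div_obliq_le hx hbb
    have h2 : |(d₀ - d) / d| ≤ (M * X + M * P) / c := S.abs_div_obliq_le hx hdd
    have h3 : |β₀ * ((d₀ - d) / d)| ≤ 1 / c * ((M * X + M * P) / c) := by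
      rw [abs_mul]
      exact mul_le_mul hβ₀le h2 (abs_nonneg _) (by positivity)
    have h4 : M * X / c ≤ 1 / c * (M * X / c) := le_mul_of_one_le_left (by positivity) hc1'
    have e2 : 1 / c * (τ * (2 * X + P)) = 1 / c * (M * X / c) + 1 / c * ((M * X + M * P) / c) := by
      rw [hτ]; ring
    rw [e1, e2]
    exact (abs_add_le _ _).trans (add_le_add (h1.trans h4) h3)
  have hσβ : |σ * (b / d - β₀)| ≤ 2 * τ ^ 2 * (X ^ 2 + P ^ 2) := by
    rw [abs_mul]
    have h1 : |σ| * |b / d - β₀| ≤ (M * P) * (1 / c * (τ * (2 * X + P))) :=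
      mul_le_mul hσle hβ (abs_nonneg _) (by positivity)
    have e1 : (M * P) * (1 / c * (τ * (2 * X + P))) = τ ^ 2 * (2 * X * P + P ^ 2) := by
      rw [hτ]; ring
    rw [e1] at h1
    have h2 : 2 * X * P + P ^ 2 ≤ 2 * (X ^ 2 + P ^ 2) := by nlinarith [sq_nonneg (X - P)]
    have h3 := mul_le_mul_of_nonneg_left h2 (sq_nonneg τ)
    linarith
  have hβr : |β₀ * r| ≤ τ * P ^ 2 := by
    rw [abs_mul]
    have := mul_le_mul hβ₀le hrle (abs_nonneg _) (by positivity)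
    have e1 : 1 / c * (M * P ^ 2) = τ * P ^ 2 := by rw [hτ]; ring
    rwa [e1] at this
  have hs2 : s ^ 2 ≤ τ ^ 2 * P ^ 2 := by
    have h1 : |s| ≤ M * P / c := by rw [hs]; exact S.abs_div_obliq_le hx hσle
    have e1 : M * P / c = τ * P := by rw [hτ]; ring
    rw [e1] at h1
    rw [← sq_abs, ← mul_pow]
    exact pow_le_pow_left₀ (abs_nonneg _) h1 2
  have hsb : s * b = σ * β₀ + σ * (b / d - β₀) := by rw [hs]; ring
  have hquad : 1 - 2 * s * b + (1 + A) * s ^ 2 ≤ 1 - ⟪tilt k h G x₀ e, p - p₀⟫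
      + errQuad n θ M ρ κ C L * (P ^ 2 + X ^ 2) := by
    have e1 : errQuad n θ M ρ κ C L = 2 * τ + 4 * τ ^ 2 + (1 + A) * τ ^ 2 := by
      unfold errQuad; rw [hτ]; ring
    have h1 := mul_le_mul_of_nonneg_left hs2 (by linarith : 0 ≤ 1 + A)
    have h2 := (abs_le.1 hσβ).1
    have h3 := (abs_le.1 hβr).1
    have h4 : 0 ≤ τ * X ^ 2 := by positivity
    have h5 : 0 ≤ (1 + A) * (τ ^ 2 * X ^ 2) := by positivity
    rw [htilt, e1]
    have e2 : 2 * s * b = 2 * (s * b) := by ring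
    rw [e2, hsb]
    linarith
  refine hquad.trans (add_le_add le_rfl ?_)
  have hθ := S.domE.pos
  have h1 : θ / 2 * P ^ 2 ≤ ⟪gradient h p₀, p - p₀⟫ :=
    S.domD.inner_gradient_ge (S.maps_frontier x₀ hx₀) (S.maps x hxc)
  have h2 : θ / 2 * X ^ 2 ≤ ⟪gradient k x₀, x - x₀⟫ := S.domE.inner_gradient_ge hx₀ hxc
  have e1 : errQuad n θ M ρ κ C L * (P ^ 2 + X ^ 2)
      = errLin n θ M ρ κ C L * (θ / 2 * P ^ 2 + θ / 2 * X ^ 2) := by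
    unfold errLin; field_simp
  rw [e1]
  exact mul_le_mul_of_nonneg_left (add_le_add h1 h2) S.errLin_nonneg

end BVSol

/-- A frontier curve tangent to a tangential direction. -/
lemma UCDomain.exists_frontier_curve {E : Set (Euc n)} {k : Euc n → ℝ} {θ : ℝ}
    (dom : UCDomain E k θ) {x ξ : Euc n} (hx : x ∈ frontier E) (hξ : ⟪gradient k x, ξ⟫ = 0) :
    ∃ w : ℝ → Euc n, Filter.Tendsto w (𝓝[>] 0) (𝓝 ξ) ∧
      ∀ᶠ s : ℝ in 𝓝[>] 0, x + s • w s ∈ frontier E := by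
  have h0 : k x = 0 := dom.mem_frontier_iff.1 hx
  have hνν : ⟪gradient k x, gradient k x⟫ = 1 := by
    rw [real_inner_self_eq_norm_sq, dom.norm_gradient x hx]; norm_num
  have hev : ∀ η : ℝ, 0 < η → ∀ᶠ s : ℝ in 𝓝[>] 0, 0 < k (x + s • (ξ + η • gradient k x)) :=
    fun η hη => (dom.eventually_mem hx (v := ξ + η • gradient k x) (by
      rw [inner_add_right, hξ, real_inner_smul_right, hνν]; linarith)).mono
        fun s hs => dom.mem_iff.1 hs
  have hexists : ∀ s : ℝ, ∃ t : ℝ, 0 < k (x + s • (ξ + (1 : ℝ) • gradient k x)) →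
      t ∈ Icc (0 : ℝ) 1 ∧ k (x + s • (ξ + t • gradient k x)) = 0 := fun s => by
    by_cases hs : 0 < k (x + s • (ξ + (1 : ℝ) • gradient k x))
    · have hk := dom.smooth.continuous
      have hc : ContinuousOn (fun t : ℝ => k (x + s • (ξ + t • gradient k x))) (Icc 0 1) := by
        fun_prop
      have h1 : k (x + s • (ξ + (0 : ℝ) • gradient k x)) ≤ 0 := by
        have h2 := dom.le_quadratic x (x + s • (ξ + (0 : ℝ) • gradient k x))
        simp only [zero_smul, add_zero, add_sub_cancel_left, real_inner_smul_right, hξ, h0] at h2 ⊢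
        have := dom.pos
        have : 0 ≤ θ / 2 * ‖s • ξ‖ ^ 2 := by positivity
        linarith
      obtain ⟨t, ht, ht'⟩ := intermediate_value_Icc zero_le_one hc ⟨h1, hs.le⟩
      exact ⟨t, fun _ => ⟨ht, ht'⟩⟩
    · exact ⟨0, fun h => absurd h hs⟩
  choose t ht using hexists
  have htend : Filter.Tendsto t (𝓝[>] 0) (𝓝 0) := by
    rw [Metric.tendsto_nhds]
    intro η hη
    filter_upwards [hev 1 one_pos, hev (η / 2) (by positivity)] with s hs1 hs2
    obtain ⟨⟨ht0, ht1⟩, hz⟩ := ht s hs1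
    rw [Real.dist_eq, sub_zero, abs_of_nonneg ht0]
    by_contra! hle
    set a := η / 2 with ha
    have hlt : a < t s := by linarith
    have ha1 : a < 1 := by linarith
    have hconv := dom.concaveOn.2 (mem_univ (x + s • (ξ + a • gradient k x)))
      (mem_univ (x + s • (ξ + (1 : ℝ) • gradient k x)))
      (show 0 ≤ (1 - t s) / (1 - a) from div_nonneg (by linarith) (by linarith))
      (show 0 ≤ (t s - a) / (1 - a) from div_nonneg (by linarith) (by linarith))
      (by rw [← add_div]; exact (div_eq_one_iff_eq (by linarith)).2 (by ring))
    have e1 : ((1 - t s) / (1 - a)) • (x + s • (ξ + a • gradient k x))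
        + ((t s - a) / (1 - a)) • (x + s • (ξ + (1 : ℝ) • gradient k x))
        = x + s • (ξ + t s • gradient k x) := by
      have h1a : 1 - a ≠ 0 := by linarith
      have e2 : (1 - t s) / (1 - a) + (t s - a) / (1 - a) = 1 := by
        rw [← add_div]; exact (div_eq_one_iff_eq h1a).2 (by ring)
      have e3 : (1 - t s) / (1 - a) * a + (t s - a) / (1 - a) = t s := by field_simp; ring
      calc _ = ((1 - t s) / (1 - a) + (t s - a) / (1 - a)) • (x + s • ξ)
            + (s * ((1 - t s) / (1 - a) * a + (t s - a) / (1 - a))) • gradient k x := by module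
        _ = _ := by rw [e2, e3]; module
    rw [e1, hz, smul_eq_mul, smul_eq_mul] at hconv
    have hp1 : 0 < (t s - a) / (1 - a) := div_pos (by linarith) (by linarith)
    have hp2 : 0 ≤ (1 - t s) / (1 - a) := div_nonneg (by linarith) (by linarith)
    have := mul_pos hp1 hs1
    have := mul_nonneg hp2 hs2.le
    linarith
  refine ⟨fun s => ξ + t s • gradient k x, ?_, ?_⟩
  · simpa using tendsto_const_nhds.add (htend.smul_const (gradient k x))
  · filter_upwards [hev 1 one_pos] with s hs
    exact dom.mem_frontier_iff.2 (ht s hs).2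

/-- Second order Taylor expansion on a convex set. -/
lemma taylor_two_within {K : Set (Euc n)} (hK : Convex ℝ K) {G : Euc n → Euc n}
    {U : Euc n → Euc n →L[ℝ] Euc n} {T : Euc n →L[ℝ] Euc n →L[ℝ] Euc n} {x : Euc n} (hx : x ∈ K)
    (hU : ∀ z ∈ K, HasFDerivWithinAt G (U z) K z) (hT : HasFDerivWithinAt U T K x)
    (hsymm : ∀ v w, T v w = T w v) :
    (fun y => G y - G x - U x (y - x) - (1 / 2 : ℝ) • T (y - x) (y - x))
      =o[𝓝[K] x] fun y => ‖y - x‖ ^ 2 := by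
  rw [Asymptotics.isLittleO_iff]
  intro η hη
  have h1 := (hasFDerivWithinAt_iff_isLittleO.1 hT)
  have h2 := Asymptotics.isLittleO_iff.1 h1 hη
  obtain ⟨r, hr, hball⟩ := Metric.mem_nhdsWithin_iff.1 h2
  filter_upwards [inter_mem_nhdsWithin K (Metric.ball_mem_nhds x hr)] with y hy
  set F : Euc n → Euc n := fun z => G z - U x (z - x) - (1 / 2 : ℝ) • T (z - x) (z - x) with hF
  have hconv : Convex ℝ (K ∩ Metric.closedBall x ‖y - x‖) := hK.inter (convex_closedBall _ _)
  have hder : ∀ z ∈ K ∩ Metric.closedBall x ‖y - x‖,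
      HasFDerivWithinAt F (U z - U x - T (z - x)) (K ∩ Metric.closedBall x ‖y - x‖) z := by
    intro z hz
    have d0 : HasFDerivAt (fun z => z - x) (ContinuousLinearMap.id ℝ (Euc n)) z :=
      (hasFDerivAt_id z).sub_const x
    have d1 : HasFDerivAt (fun z => U x (z - x)) (U x) z :=
      ((U x).hasFDerivAt (x := z - x)).comp z d0
    have d2 : HasFDerivAt (fun z => T (z - x)) T z :=
      (T.hasFDerivAt (x := z - x)).comp z d0
    have d3 := (d2.clm_apply d0).const_smul (1 / 2 : ℝ)
    refine ((((hU z hz.1).sub d1.hasFDerivWithinAt).sub d3.hasFDerivWithinAt).mono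
      inter_subset_left).congr_fderiv ?_
    ext1 v
    have e1 := hsymm v (z - x)
    simp only [_root_.sub_apply, _root_.smul_apply, _root_.add_apply,
      ContinuousLinearMap.flip_apply, ContinuousLinearMap.comp_apply,
      ContinuousLinearMap.id_apply, e1]
    module
  have hb : ∀ z ∈ K ∩ Metric.closedBall x ‖y - x‖, ‖U z - U x - T (z - x)‖ ≤ η * ‖y - x‖ := by
    intro z hz
    have hz2 : ‖z - x‖ ≤ ‖y - x‖ := by simpa [dist_eq_norm] using hz.2
    have hy2 : ‖y - x‖ < r := by simpa [dist_eq_norm] using hy.2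
    have := hball ⟨by simpa [dist_eq_norm] using hz2.trans_lt hy2, hz.1⟩
    exact (this : ‖U z - U x - T (z - x)‖ ≤ η * ‖z - x‖).trans (by gcongr)
  have := hconv.norm_image_sub_le_of_norm_hasFDerivWithin_le hder hb
    ⟨hx, by simp⟩ ⟨hy.1, by simp [dist_eq_norm]⟩
  have e : F y - F x = G y - G x - U x (y - x) - (1 / 2 : ℝ) • T (y - x) (y - x) := by
    simp only [hF, sub_self, map_zero, smul_zero, sub_zero]
    abel
  rw [e] at this
  simp only [norm_pow, norm_norm]
  calc _ ≤ _ := this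
    _ = _ := by ring

namespace BVSol

variable {E D : Set (Euc n)} {k h : Euc n → ℝ} {G : Euc n → Euc n}
  {U : Euc n → Euc n →L[ℝ] Euc n} {T : Euc n → Euc n →L[ℝ] Euc n →L[ℝ] Euc n}
  {g : Euc n × Euc n → ℝ} {θ M ρ κ C L ε : ℝ}

/-- The second fundamental form comparison at a boundary point. -/
theorem second_order_frontier (S : BVSol E D k h G U T g θ M ρ κ C L ε) {x ξ : Euc n}
    (hx : x ∈ frontier E) (hξ : ⟪gradient k x, ξ⟫ = 0) {μ : ℝ} (hμ : 0 ≤ μ)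
    (hob : U x (gradient h (G x)) = μ • gradient k x) :
    μ * (θ / 2) * ‖ξ‖ ^ 2 + 1 / 2 * ⟪gradient h (G x), T x ξ ξ⟫ ≤ M * ‖U x ξ‖ ^ 2 := by
  have hxc := frontier_subset_closure hx
  obtain ⟨w, hw, hfr⟩ := S.domE.exists_frontier_curve hx hξ
  set ν := gradient h (G x) with hν
  set r : ℝ → Euc n := fun s =>
    (s ^ 2)⁻¹ • (G (x + s • w s) - G x - U x (s • w s) - (1 / 2 : ℝ) • T x (s • w s) (s • w s))
    with hrdef
  have hs0 : Filter.Tendsto (fun s : ℝ => s) (𝓝[>] 0) (𝓝 0) :=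
    tendsto_nhdsWithin_of_tendsto_nhds Filter.tendsto_id
  have hy : Filter.Tendsto (fun s => x + s • w s) (𝓝[>] 0) (𝓝[closure E] x) := by
    refine tendsto_nhdsWithin_iff.2 ⟨?_, hfr.mono fun s hs => frontier_subset_closure hs⟩
    simpa using tendsto_const_nhds.add (hs0.smul hw)
  have hr : Filter.Tendsto r (𝓝[>] 0) (𝓝 0) := by
    have h1 := (taylor_two_within S.domE.convex_closure hxc S.hasU (S.hasT x hxc)
      (S.third_swap hxc)).comp_tendsto hy
    have h2 : ((fun y => ‖y - x‖ ^ 2) ∘ fun s => x + s • w s) =O[𝓝[>] 0] fun s : ℝ => s ^ 2 := by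
      have h3 : (fun s : ℝ => ‖w s‖ ^ 2) =O[𝓝[>] 0] fun _ => (1 : ℝ) :=
        (hw.norm.pow 2).isBigO_one ℝ
      have h4 := (Asymptotics.isBigO_refl (fun s : ℝ => s ^ 2) (𝓝[>] 0)).mul h3
      refine (Asymptotics.isBigO_congr (Filter.EventuallyEq.of_eq ?_)
        (Filter.EventuallyEq.of_eq ?_)).1 h4
      · ext s; simp [norm_smul, mul_pow]
      · ext s; simp
    have h3 := h1.trans_isBigO h2
    have h4 := h3.tendsto_inv_smul_nhds_zero
    simpa only [hrdef, Function.comp_def, add_sub_cancel_left] using h4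
  have hexp : ∀ s : ℝ, s ≠ 0 → G (x + s • w s) - G x
      = s • (U x (w s) + (s / 2) • T x (w s) (w s) + s • r s) := by
    intro s hs
    have : s • s • r s = G (x + s • w s) - G x - U x (s • w s)
        - (1 / 2 : ℝ) • T x (s • w s) (s • w s) := by
      rw [hrdef, smul_smul, smul_smul, ← pow_two, mul_inv_cancel₀ (by positivity), one_smul]
    rw [smul_add, smul_add, this]
    simp only [map_smul, _root_.smul_apply]
    module
  have hineq : ∀ᶠ s : ℝ in 𝓝[>] 0,
      μ * (θ / 2) * ‖w s‖ ^ 2 + 1 / 2 * ⟪ν, T x (w s) (w s)⟫ + ⟪ν, r s⟫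
        ≤ M * ‖U x (w s) + (s / 2) • T x (w s) (w s) + s • r s‖ ^ 2 := by
    filter_upwards [hfr, self_mem_nhdsWithin] with s hs hspos
    have hspos' : (0 : ℝ) < s := hspos
    have h1 := S.bD.ge_quadratic (G x) (S.maps x hxc) (G (x + s • w s))
      (S.maps _ (frontier_subset_closure hs))
    rw [S.domD.mem_frontier_iff.1 (S.maps_frontier x hx),
      S.domD.mem_frontier_iff.1 (S.maps_frontier _ hs), hexp s hspos'.ne', norm_smul,
      real_inner_smul_right, inner_add_right, inner_add_right, real_inner_smul_right,
      real_inner_smul_right, mul_pow, Real.norm_eq_abs, sq_abs] at h1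
    have h2 := S.domE.inner_gradient_ge hx (frontier_subset_closure hs)
    rw [add_sub_cancel_left, norm_smul, real_inner_smul_right, mul_pow, Real.norm_eq_abs,
      sq_abs] at h2
    have h3 : ⟪ν, U x (w s)⟫ = μ * ⟪gradient k x, w s⟫ := by
      rw [← S.symm hxc, hob, real_inner_smul_left]
    have h4 := mul_le_mul_of_nonneg_left h2 hμ
    rw [← hν, h3] at h1
    set Z := U x (w s) + (s / 2) • T x (w s) (w s) + s • r s
    have h5 : s ^ 2 * (μ * (θ / 2) * ‖w s‖ ^ 2 + 1 / 2 * ⟪ν, T x (w s) (w s)⟫ + ⟪ν, r s⟫)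
        ≤ s ^ 2 * (M * ‖Z‖ ^ 2) := by linarith
    exact le_of_mul_le_mul_left h5 (by positivity)
  have hT2 : Filter.Tendsto (fun s => T x (w s) (w s)) (𝓝[>] 0) (𝓝 (T x ξ ξ)) := by
    have hc : Continuous fun v => T x v v := by fun_prop
    exact (hc.tendsto ξ).comp hw
  have hU1 : Filter.Tendsto (fun s => U x (w s)) (𝓝[>] 0) (𝓝 (U x ξ)) :=
    ((U x).continuous.tendsto ξ).comp hw
  have hL : Filter.Tendsto
      (fun s => μ * (θ / 2) * ‖w s‖ ^ 2 + 1 / 2 * ⟪ν, T x (w s) (w s)⟫ + ⟪ν, r s⟫) (𝓝[>] 0)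
      (𝓝 (μ * (θ / 2) * ‖ξ‖ ^ 2 + 1 / 2 * ⟪ν, T x ξ ξ⟫ + ⟪ν, 0⟫)) :=
    (((hw.norm.pow 2).const_mul _).add ((tendsto_const_nhds.inner hT2).const_mul _)).add
      (tendsto_const_nhds.inner hr)
  have hR : Filter.Tendsto (fun s => M * ‖U x (w s) + (s / 2) • T x (w s) (w s) + s • r s‖ ^ 2)
      (𝓝[>] 0) (𝓝 (M * ‖U x ξ + ((0 : ℝ) / 2) • T x ξ ξ + (0 : ℝ) • (0 : Euc n)‖ ^ 2)) :=
    (((hU1.add ((hs0.div_const 2).smul hT2)).add (hs0.smul hr)).norm.pow 2).const_mul _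
  have := le_of_tendsto_of_tendsto hL hR hineq
  simpa using this

end BVSol

namespace BVSol

variable {E D : Set (Euc n)} {k h : Euc n → ℝ} {G : Euc n → Euc n}
  {U : Euc n → Euc n →L[ℝ] Euc n} {T : Euc n → Euc n →L[ℝ] Euc n →L[ℝ] Euc n}
  {g : Euc n × Euc n → ℝ} {θ M ρ κ C L ε : ℝ}

/-- The largest tangential boundary value of `⟨e, (DG)⁻¹ e⟩` is attained. -/
lemma exists_tangential_max (S : BVSol E D k h G U T g θ M ρ κ C L ε) {δ : ℝ} (hδ : 0 < δ)
    (hmin : ∀ x ∈ closure E, ∀ v, δ * ‖v‖ ^ 2 ≤ ⟪U x v, v⟫) :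
    ∃ m : ℝ, 1 ≤ m ∧ (∀ x ∈ frontier E, ∀ ξ, ⟪U x ξ, gradient h (G x)⟫ = 0 →
        ⟪U x ξ, ξ⟫ ≤ m * ‖U x ξ‖ ^ 2) ∧
      (m = 1 ∨ ∃ x ∈ frontier E, ∃ ξ, ‖U x ξ‖ = 1 ∧ ⟪U x ξ, gradient h (G x)⟫ = 0 ∧
        ⟪U x ξ, ξ⟫ = m) := by
  set K : Set (Euc n × Euc n) := {z | z.1 ∈ frontier E ∧ ‖U z.1 z.2‖ = 1 ∧
    ⟪U z.1 z.2, gradient h (G z.1)⟫ = 0} with hK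
  have hscale : ∀ m : ℝ, (∀ z ∈ K, ⟪U z.1 z.2, z.2⟫ ≤ m) → ∀ x ∈ frontier E, ∀ ξ,
      ⟪U x ξ, gradient h (G x)⟫ = 0 → ⟪U x ξ, ξ⟫ ≤ m * ‖U x ξ‖ ^ 2 := by
    intro m hm x hx ξ hξ
    rcases eq_or_ne (U x ξ) 0 with h0 | h0
    · simp [h0]
    have hp : 0 < ‖U x ξ‖ := norm_pos_iff.2 h0
    have h1 := hm (x, ‖U x ξ‖⁻¹ • ξ) ⟨hx, by simp [norm_smul, hp.ne'], by
      simp only [map_smul, real_inner_smul_left, hξ, mul_zero]⟩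
    simp only [map_smul, real_inner_smul_left, real_inner_smul_right] at h1
    have h2 := mul_le_mul_of_nonneg_right h1 (sq_nonneg ‖U x ξ‖)
    have h3 : ‖U x ξ‖⁻¹ * (‖U x ξ‖⁻¹ * ⟪U x ξ, ξ⟫) * ‖U x ξ‖ ^ 2 = ⟪U x ξ, ξ⟫ := by field_simp
    rwa [h3] at h2
  have hcomp : IsCompact K := by
    have hB : IsCompact (frontier E ×ˢ Metric.closedBall (0 : Euc n) (1 / δ)) :=
      (S.domE.isCompact_closure.of_isClosed_subset isClosed_frontier
        frontier_subset_closure).prod (isCompact_closedBall _ _)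
    have hsub : frontier E ×ˢ Metric.closedBall (0 : Euc n) (1 / δ)
        ⊆ closure E ×ˢ Metric.closedBall (0 : Euc n) (1 / δ) :=
      prod_mono frontier_subset_closure subset_rfl
    have hUc := (S.continuousOn_apply (K := Metric.closedBall (0 : Euc n) (1 / δ))).mono hsub
    have hGc : ContinuousOn (fun z : Euc n × Euc n => gradient h (G z.1))
        (frontier E ×ˢ Metric.closedBall (0 : Euc n) (1 / δ)) :=
      S.domD.continuous_gradient.comp_continuousOn
        (S.contG.comp continuousOn_fst fun z hz => frontier_subset_closure hz.1)
    have hcl := (hUc.norm.prodMk (hUc.inner (𝕜 := ℝ) hGc)).preimage_isClosed_of_isClosed hB.isClosed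
      (isClosed_singleton (x := ((1 : ℝ), (0 : ℝ))))
    refine hB.of_isClosed_subset (?_ : IsClosed K) ?_
    · convert hcl using 1
      ext z
      constructor
      · rintro ⟨h1, h2, h3⟩
        refine ⟨⟨h1, ?_⟩, by simp only [mem_preimage, h2, h3, mem_singleton_iff]⟩
        simpa using norm_le_of_min hδ (hmin z.1 (frontier_subset_closure h1)) h2.le rfl
      · rintro ⟨⟨h1, -⟩, h2⟩
        simp only [mem_preimage, mem_singleton_iff, Prod.mk.injEq] at h2
        exact ⟨h1, h2⟩
    · rintro z ⟨h1, h2, -⟩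
      refine ⟨h1, ?_⟩
      simpa using norm_le_of_min hδ (hmin z.1 (frontier_subset_closure h1)) h2.le rfl
  by_cases hle : ∀ z ∈ K, ⟪U z.1 z.2, z.2⟫ ≤ 1
  · exact ⟨1, le_rfl, hscale 1 hle, Or.inl rfl⟩
  · push Not at hle
    obtain ⟨z, hz, hz1⟩ := hle
    obtain ⟨⟨x₀, ξ₀⟩, ⟨h1, h2, h3⟩, hmax⟩ := hcomp.exists_isMaxOn ⟨z, hz⟩
      (f := fun z => ⟪U z.1 z.2, z.2⟫) (((S.continuousOn_apply (K := univ)).mono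
        fun z hz => ⟨frontier_subset_closure hz.1, trivial⟩).inner continuousOn_snd)
    exact ⟨⟪U x₀ ξ₀, ξ₀⟫, hz1.le.trans (hmax hz), hscale _ fun z hz => hmax hz,
      Or.inr ⟨x₀, h1, ξ₀, h2, h3, rfl⟩⟩

/-- The bound for the linear coefficient. -/
def tiltBound (n : ℕ) (θ M ρ κ C L : ℝ) : ℝ :=
  2 * M / obliq n θ M ρ κ C L + errLin n θ M ρ κ C L

/-- The barrier coefficient at a boundary maximum. -/
def bdryBarrier (n : ℕ) (θ M ρ κ C L : ℝ) : ℝ :=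
  (loss n ρ C L + 2 * pinch n θ M ρ κ C L + tiltBound n θ M ρ κ C L
    + errLin n θ M ρ κ C L * (L + 4 * C) + 1) / gain n θ ρ κ

/-- The bound for the normal derivative at a boundary maximum. -/
def normalBound (n : ℕ) (θ M ρ κ C L : ℝ) : ℝ :=
  tiltBound n θ M ρ κ C L * C + errLin n θ M ρ κ C L + bdryBarrier n θ M ρ κ C L * C

lemma tiltBound_nonneg (S : BVSol E D k h G U T g θ M ρ κ C L ε) :
    0 ≤ tiltBound n θ M ρ κ C L := by
  have := S.errLin_nonneg
  have := S.obliq_pos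
  have : 0 < M := by linarith [S.bE.one_le]
  unfold tiltBound
  positivity

lemma bdryBarrier_nonneg (S : BVSol E D k h G U T g θ M ρ κ C L ε) :
    0 ≤ bdryBarrier n θ M ρ κ C L := by
  have := S.errLin_nonneg
  have := S.tiltBound_nonneg
  have := S.gain_pos
  have := S.loss_nonneg
  have := S.pinch_pos
  have := S.L_nonneg
  have := S.C_pos
  unfold bdryBarrier
  positivity

theorem neg_third_le (S : BVSol E D k h G U T g θ M ρ κ C L ε) {m : ℝ} (hm1 : 1 ≤ m)
    (hm : ∀ x ∈ frontier E, ∀ ξ, ⟪U x ξ, gradient h (G x)⟫ = 0 →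
      ⟪U x ξ, ξ⟫ ≤ m * ‖U x ξ‖ ^ 2) {δ : ℝ} (hδ : 0 < δ)
    (hmin : ∀ x ∈ closure E, ∀ v, δ * ‖v‖ ^ 2 ≤ ⟪U x v, v⟫)
    (hδm : 1 / δ ≤ pinch n θ M ρ κ C L * m) {x₀ ξ₀ : Euc n} (hx₀ : x₀ ∈ frontier E)
    (hξ₀ : ‖U x₀ ξ₀‖ = 1) (htan : ⟪U x₀ ξ₀, gradient h (G x₀)⟫ = 0)
    (hmax : ⟪U x₀ ξ₀, ξ₀⟫ = m) :
    - ⟪T x₀ (gradient h (G x₀)) ξ₀, ξ₀⟫ ≤ normalBound n θ M ρ κ C L * m := by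
  have hx₀c := frontier_subset_closure hx₀
  have hm0 : 0 < m := by linarith
  have hc0 := S.gain_pos
  have hC5 := S.errLin_nonneg
  have hB0 := S.bdryBarrier_nonneg
  have hΛ := S.loss_nonneg
  have hC := S.C_pos
  set e := U x₀ ξ₀ with he
  set ν := gradient h (G x₀) with hν
  set νk := gradient k x₀ with hνk
  set C5 := errLin n θ M ρ κ C L with hC5def
  set B := bdryBarrier n θ M ρ κ C L with hBdef
  set a := tilt k h G x₀ e - C5 • ν with ha
  have hνn : ‖ν‖ = 1 := S.norm_gradient_h hx₀
  have hνkn : ‖νk‖ = 1 := S.norm_gradient_k hx₀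
  have hanorm : ‖a‖ ≤ tiltBound n θ M ρ κ C L := by
    refine (norm_sub_le _ _).trans (add_le_add (S.norm_tilt_le hx₀ hξ₀) ?_)
    rw [norm_smul, hνn, mul_one, Real.norm_of_nonneg hC5]
  set Qlin : Euc n →L[ℝ] ℝ := (-C5) • innerSL ℝ νk with hQlin
  have hQapp : ∀ z, Qlin z = -C5 * ⟪νk, z⟫ := fun z => by simp [hQlin]
  set W := 1 + ⟪a, G x₀⟫ + Qlin x₀ with hW
  have hBc : B * gain n θ ρ κ = loss n ρ C L + 2 * pinch n θ M ρ κ C L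
      + tiltBound n θ M ρ κ C L + C5 * (L + 4 * C) + 1 := div_mul_cancel₀ _ hc0.ne'
  have hmain := S.le_of_frontier_le (e := e) (a := a) (s := 1 / m) (B := B) (R := 1 / δ)
    (W := W) (Q := Qlin) hξ₀.le (by positivity) hB0
    (fun x hx ξ hξ => norm_le_of_min hδ (hmin x hx) hξ₀.le hξ) Qlin.contDiff (q₁ := C5) (q₂ := 0)
    hC5 le_rfl (fun x _ w => by
      rw [Qlin.fderiv, hQapp, abs_mul, abs_neg, abs_of_nonneg hC5]
      have := abs_real_inner_le_norm νk w
      rw [hνkn, one_mul] at this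
      gcongr)
    (fun x _ w => by
      have : fderiv ℝ Qlin = fun _ => Qlin := by ext1 z; exact Qlin.fderiv
      rw [this]; simp)
    (by
      rw [hBc]
      have h1 : 1 / m * loss n ρ C L ≤ loss n ρ C L :=
        mul_le_of_le_one_left hΛ (by rw [div_le_one hm0]; exact hm1)
      have h2 : 1 / m * (2 * ε * (1 / δ)) ≤ 2 * pinch n θ M ρ κ C L := by
        have h3 : ε * (1 / δ) ≤ 1 / δ :=
          mul_le_of_le_one_left (by positivity) S.eps_le_one
        have h4 : 1 / m * (2 * ε * (1 / δ)) ≤ 1 / m * (2 * (pinch n θ M ρ κ C L * m)) :=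
          mul_le_mul_of_nonneg_left (by linarith) (by positivity)
        have e1 : 1 / m * (2 * (pinch n θ M ρ κ C L * m)) = 2 * pinch n θ M ρ κ C L := by
          field_simp
        linarith
      have h3 : ε * ‖a‖ ≤ tiltBound n θ M ρ κ C L :=
        (mul_le_of_le_one_left (norm_nonneg _) S.eps_le_one).trans hanorm
      linarith)
    (fun x hx ξ hξ => by
      rw [S.domD.mem_frontier_iff.1 (S.maps_frontier x hx)]
      have h1 := S.inner_le_of_tangential hx hm1 (hm x hx) hξ₀ hξ rfl
      have h2 := S.frontier_expansion hx₀ hx hξ₀ htan rfl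
      have h3 : 1 / m * ⟪e, ξ⟫ ≤ 1 - 2 * (⟪e, gradient h (G x)⟫ /
          ⟪gradient k x, gradient h (G x)⟫) * ⟪gradient k x, e⟫ + (1 + slope n θ M ρ κ C L) *
          (⟪e, gradient h (G x)⟫ / ⟪gradient k x, gradient h (G x)⟫) ^ 2 := by
        rw [one_div_mul_eq_div, div_le_iff₀ hm0]
        linarith
      have h4 := h3.trans h2
      rw [hW, hQapp, hQapp, ha]
      simp only [inner_sub_left, inner_sub_right, real_inner_smul_left] at h4 ⊢
      linarith)
  set F : Euc n → ℝ := fun z => (1 / m) * ⟪U z ξ₀, ξ₀⟫ - ⟪a, G z⟫ - Qlin z + B * h (G z) with hF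
  have hFmin : ∀ z ∈ closure E, F x₀ ≤ F z := by
    intro z hz
    obtain ⟨ζ, hζ⟩ := S.surjective hz e
    have h1 := hmain z hz ζ hζ
    have h2 := two_mul_inner_sub_le (S.symm hz) (S.nonneg hz) ζ ξ₀
    rw [hζ, hmax] at h2
    have h3 := mul_le_mul_of_nonneg_left h2 (by positivity : 0 ≤ 1 / m)
    have e1 : 1 / m * (2 * m - ⟪U z ξ₀, ξ₀⟫) = 2 - 1 / m * ⟪U z ξ₀, ξ₀⟫ := by field_simp
    have e2 : F x₀ = 1 - ⟪a, G x₀⟫ - Qlin x₀ := by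
      simp only [hF, ← he, hmax, S.domD.mem_frontier_iff.1 (S.maps_frontier x₀ hx₀)]
      field_simp
      ring
    rw [e2]
    simp only [hF]
    linarith
  have hder : HasFDerivWithinAt F _ (closure E) x₀ :=
    (((((((S.hasT x₀ hx₀c).clm_apply (hasFDerivWithinAt_const ξ₀ x₀ (closure E))).inner ℝ
      (hasFDerivWithinAt_const ξ₀ x₀ (closure E))).const_mul (1 / m)).sub
      ((hasFDerivWithinAt_const a x₀ (closure E)).inner ℝ (S.hasU x₀ hx₀c))).sub
      Qlin.hasFDerivWithinAt).add ((S.hasFDerivWithinAt_h hx₀c).const_mul B))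
  have hpos := S.domE.fderivWithin_nonneg hx₀ (v := ν)
    (S.obliq_pos.trans_le (S.obliq_le hx₀)) hder hFmin
  have hpos' : 0 ≤ 1 / m * ⟪T x₀ ν ξ₀, ξ₀⟫ - ⟪a, U x₀ ν⟫ - Qlin ν + B * ⟪ν, U x₀ ν⟫ := by
    rw [hν, ← fderiv_eq_inner_gradient, ← hν]
    simpa using hpos
  have hUν : ‖U x₀ ν‖ ≤ C := by simpa [hνn] using S.norm_le hx₀c ν
  have h1 : -⟪a, U x₀ ν⟫ ≤ tiltBound n θ M ρ κ C L * C := by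
    refine (neg_le_abs _).trans ((abs_real_inner_le_norm _ _).trans ?_)
    exact mul_le_mul hanorm hUν (norm_nonneg _) S.tiltBound_nonneg
  have h2 : -Qlin ν ≤ C5 := by
    rw [hQapp]
    have := S.inner_normals_le_one hx₀
    have := mul_le_mul_of_nonneg_left this hC5
    linarith
  have h3 : B * ⟪ν, U x₀ ν⟫ ≤ B * C := by
    refine mul_le_mul_of_nonneg_left ?_ hB0
    have := real_inner_le_norm ν (U x₀ ν)
    rw [hνn, one_mul] at this
    exact this.trans hUν
  have h4 : 0 ≤ 1 / m * ⟪T x₀ ν ξ₀, ξ₀⟫ + normalBound n θ M ρ κ C L := by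
    unfold normalBound
    linarith
  have h5 := mul_nonneg hm0.le h4
  have e1 : m * (1 / m * ⟪T x₀ ν ξ₀, ξ₀⟫ + normalBound n θ M ρ κ C L)
      = ⟪T x₀ ν ξ₀, ξ₀⟫ + normalBound n θ M ρ κ C L * m := by field_simp
  linarith

/-- The reciprocal of the lower bound for `DG`. -/
def invBound (n : ℕ) (θ M ρ κ C L : ℝ) : ℝ :=
  pinch n θ M ρ κ C L *
    (1 + slope n θ M ρ κ C L * (2 * M + normalBound n θ M ρ κ C L) / θ)

lemma invBound_pos (S : BVSol E D k h G U T g θ M ρ κ C L ε) :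
    0 < invBound n θ M ρ κ C L := by
  have := S.errLin_nonneg
  have := S.tiltBound_nonneg
  have := S.bdryBarrier_nonneg
  have := S.pinch_pos
  have := S.C_pos
  have := S.slope_pos
  have := S.domE.pos
  have : 0 < M := by linarith [S.bE.one_le]
  unfold invBound normalBound
  positivity

/-- The lower bound for `DG`. -/
theorem lower_bound (S : BVSol E D k h G U T g θ M ρ κ C L ε) {x : Euc n} (hx : x ∈ closure E)
    (v : Euc n) : (invBound n θ M ρ κ C L)⁻¹ * ‖v‖ ^ 2 ≤ ⟪U x v, v⟫ := by
  obtain ⟨δ, hδ, hmin, x₁, hx₁, ζ, hζ, hζδ⟩ := S.exists_min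
  obtain ⟨m, hm1, hm, hcase⟩ := S.exists_tangential_max hδ hmin
  have hδm := S.inv_min_le hm1 hm hδ hmin hx₁ hζ hζδ
  have hA := S.slope_pos
  have hθ := S.domE.pos
  have hM : 0 < M := by linarith [S.bE.one_le]
  have hN : 0 ≤ normalBound n θ M ρ κ C L := by
    have := S.errLin_nonneg
    have := S.tiltBound_nonneg
    have := S.bdryBarrier_nonneg
    have := S.C_pos
    unfold normalBound
    positivity
  have hmle : m ≤ 1 + slope n θ M ρ κ C L * (2 * M + normalBound n θ M ρ κ C L) / θ := by
    rcases hcase with rfl | ⟨x₀, hx₀, ξ₀, hξ₀, htan, hmax⟩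
    · have : 0 ≤ slope n θ M ρ κ C L * (2 * M + normalBound n θ M ρ κ C L) / θ := by positivity
      linarith
    have hx₀c := frontier_subset_closure hx₀
    have h1 := S.neg_third_le hm1 hm hδ hmin hδm hx₀ hξ₀ htan hmax
    obtain ⟨μ, hμ, hob⟩ := S.exists_oblique hx₀
    have hμ0 : 0 < μ := lt_of_lt_of_le (by positivity) hμ
    have hort : ⟪gradient k x₀, ξ₀⟫ = 0 := by
      have : μ * ⟪gradient k x₀, ξ₀⟫ = 0 := by
        rw [← real_inner_smul_left, ← hob, S.symm hx₀c, real_inner_comm, htan]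
      exact (mul_eq_zero.1 this).resolve_left hμ0.ne'
    have h2 := S.second_order_frontier hx₀ hort hμ0.le hob
    have e1 : ⟪gradient h (G x₀), T x₀ ξ₀ ξ₀⟫ = ⟪T x₀ (gradient h (G x₀)) ξ₀, ξ₀⟫ := by
      rw [← S.third_symm hx₀c, S.third_swap hx₀c]
    rw [e1, hξ₀] at h2
    have hξm : m ≤ ‖ξ₀‖ := by
      have := real_inner_le_norm (U x₀ ξ₀) ξ₀
      rwa [hmax, hξ₀, one_mul] at this
    have h3 : 1 / slope n θ M ρ κ C L * (θ / 2) * m ^ 2 ≤ μ * (θ / 2) * ‖ξ₀‖ ^ 2 := by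
      gcongr
    have h4 : 1 / slope n θ M ρ κ C L * θ * m ^ 2 ≤ (2 * M + normalBound n θ M ρ κ C L) * m := by
      have : 2 * M ≤ 2 * M * m := le_mul_of_one_le_right (by positivity) hm1
      linarith
    have h5 : 1 / slope n θ M ρ κ C L * θ * m ≤ 2 * M + normalBound n θ M ρ κ C L := by
      refine le_of_mul_le_mul_right ?_ (by linarith : 0 < m)
      linarith
    have h6 : m ≤ slope n θ M ρ κ C L * (2 * M + normalBound n θ M ρ κ C L) / θ := by
      rw [le_div_iff₀ hθ]
      have h7 := mul_le_mul_of_nonneg_left h5 hA.le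
      have e2 : slope n θ M ρ κ C L * (1 / slope n θ M ρ κ C L * θ * m) = m * θ := by
        field_simp
      linarith
    linarith
  have h1 : 1 / δ ≤ invBound n θ M ρ κ C L :=
    hδm.trans (mul_le_mul_of_nonneg_left hmle S.pinch_pos.le)
  have h2 : (invBound n θ M ρ κ C L)⁻¹ ≤ δ := by
    rw [inv_le_comm₀ S.invBound_pos hδ, ← one_div]
    exact h1
  exact (mul_le_mul_of_nonneg_right h2 (sq_nonneg _)).trans (hmin x hx v)

end BVSol

lemma sum_smul_single (v : Euc n) : ∑ i, v i • EuclideanSpace.single i (1 : ℝ) = v := by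
  ext j
  simp [Finset.sum_apply, Pi.single_apply]

lemma dotProduct_hess_mulVec (u : Euc n → ℝ) (x v : Euc n) :
    v.ofLp ⬝ᵥ (Hess u x) *ᵥ v.ofLp = fderiv ℝ (fderiv ℝ u) x v v := by
  conv_rhs => rw [← sum_smul_single v]
  simp only [dotProduct, mulVec, Hess, iteratedFDeriv_two_apply, map_sum, map_smul,
    FunLike.coe_sum, Finset.sum_apply, FunLike.coe_smul, Pi.smul_apply, smul_eq_mul, Finset.mul_sum]
  rw [Finset.sum_comm]
  refine Finset.sum_congr rfl fun i _ => Finset.sum_congr rfl fun j _ => ?_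
  simp
  ring

lemma dotProduct_smul_one_mulVec (r : ℝ) (v : Euc n) :
    v.ofLp ⬝ᵥ (r • (1 : Matrix (Fin n) (Fin n) ℝ)) *ᵥ v.ofLp = r * ‖v‖ ^ 2 := by
  rw [smul_mulVec, one_mulVec, dotProduct_smul, EuclideanSpace.real_norm_sq_eq, smul_eq_mul]
  simp [dotProduct, sq]

lemma MatLE.dotProduct_le {A B : Matrix (Fin n) (Fin n) ℝ} (h : MatLE A B) (v : Euc n) :
    v.ofLp ⬝ᵥ A *ᵥ v.ofLp ≤ v.ofLp ⬝ᵥ B *ᵥ v.ofLp := by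
  have := PosSemidef.dotProduct_mulVec_nonneg h v.ofLp
  rw [sub_mulVec, dotProduct_sub] at this
  simpa using this

lemma MatLE.of_dotProduct_le {A B : Matrix (Fin n) (Fin n) ℝ} (hA : A.IsHermitian)
    (hB : B.IsHermitian) (h : ∀ v : Euc n, v.ofLp ⬝ᵥ A *ᵥ v.ofLp ≤ v.ofLp ⬝ᵥ B *ᵥ v.ofLp) :
    MatLE A B := by
  refine PosSemidef.of_dotProduct_mulVec_nonneg (hB.sub hA) fun v => ?_
  rw [sub_mulVec, dotProduct_sub]
  simpa using h (WithLp.toLp 2 v)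

lemma isHermitian_hess {u : Euc n → ℝ} {x : Euc n}
    (h : ∀ v w, fderiv ℝ (fderiv ℝ u) x v w = fderiv ℝ (fderiv ℝ u) x w v) :
    (Hess u x).IsHermitian := by
  ext i j
  simp [Hess, iteratedFDeriv_two_apply, h (EuclideanSpace.single i 1)]

lemma isHermitian_smul_one (r : ℝ) : (r • (1 : Matrix (Fin n) (Fin n) ℝ)).IsHermitian := by
  simp [IsHermitian]

lemma matLE_smul_one_hess {u : Euc n → ℝ} {x : Euc n}
    (h : ∀ v w, fderiv ℝ (fderiv ℝ u) x v w = fderiv ℝ (fderiv ℝ u) x w v) {r : ℝ}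
    (hr : ∀ v, r * ‖v‖ ^ 2 ≤ fderiv ℝ (fderiv ℝ u) x v v) :
    MatLE (r • (1 : Matrix (Fin n) (Fin n) ℝ)) (Hess u x) :=
  MatLE.of_dotProduct_le (isHermitian_smul_one r) (isHermitian_hess h) fun v => by
    simpa only [dotProduct_hess_mulVec, dotProduct_smul_one_mulVec] using hr v

lemma matLE_hess_smul_one {u : Euc n → ℝ} {x : Euc n}
    (h : ∀ v w, fderiv ℝ (fderiv ℝ u) x v w = fderiv ℝ (fderiv ℝ u) x w v) {r : ℝ}
    (hr : ∀ v, fderiv ℝ (fderiv ℝ u) x v v ≤ r * ‖v‖ ^ 2) :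
    MatLE (Hess u x) (r • (1 : Matrix (Fin n) (Fin n) ℝ)) :=
  MatLE.of_dotProduct_le (isHermitian_hess h) (isHermitian_smul_one r) fun v => by
    simpa only [dotProduct_hess_mulVec, dotProduct_smul_one_mulVec] using hr v

lemma MatLE.le_fderiv_fderiv {u : Euc n → ℝ} {x : Euc n} {r : ℝ}
    (h : MatLE (r • (1 : Matrix (Fin n) (Fin n) ℝ)) (Hess u x)) (v : Euc n) :
    r * ‖v‖ ^ 2 ≤ fderiv ℝ (fderiv ℝ u) x v v := by
  simpa only [dotProduct_hess_mulVec, dotProduct_smul_one_mulVec] using h.dotProduct_le v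

lemma MatLE.fderiv_fderiv_le {u : Euc n → ℝ} {x : Euc n} {r : ℝ}
    (h : MatLE (Hess u x) (r • (1 : Matrix (Fin n) (Fin n) ℝ))) (v : Euc n) :
    fderiv ℝ (fderiv ℝ u) x v v ≤ r * ‖v‖ ^ 2 := by
  simpa only [dotProduct_hess_mulVec, dotProduct_smul_one_mulVec] using h.dotProduct_le v

lemma UCDomain.mono {E : Set (Euc n)} {k : Euc n → ℝ} {θ θ' : ℝ} (D : UCDomain E k θ)
    (hpos : 0 < θ') (h : θ' ≤ θ) : UCDomain E k θ' :=
  { D with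
    pos := hpos
    second_le := fun x v => (D.second_le x v).trans (by nlinarith [sq_nonneg ‖v‖]) }

lemma UCDomain.Bounds.mono {E : Set (Euc n)} {k : Euc n → ℝ} {M M' : ℝ} (B : Bounds E k M)
    (h : M ≤ M') : Bounds E k M' where
  one_le := B.one_le.trans h
  abs_le x hx := (B.abs_le x hx).trans h
  norm_gradient_le x hx := (B.norm_gradient_le x hx).trans h
  norm_fderiv_gradient_le x hx := (B.norm_fderiv_gradient_le x hx).trans h
  norm_fderiv_fderiv_le x hx := (B.norm_fderiv_fderiv_le x hx).trans h
  lipschitz x hx y hy := (B.lipschitz x hx y hy).trans (by gcongr)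
  taylor x hx y hy := (B.taylor x hx y hy).trans (by gcongr)
  ge_quadratic x hx y hy := (B.ge_quadratic x hx y hy).trans' (by gcongr)

lemma DomainSetup.exists_common {Ω Ωt : Set (Euc n)} {ht h : Euc n → ℝ} {θt θ : ℝ}
    (hd : DomainSetup Ω Ωt ht h θt θ) :
    ∃ θ₀ M, UCDomain Ω ht θ₀ ∧ UCDomain Ωt h θ₀ ∧ UCDomain.Bounds Ω ht M ∧
      UCDomain.Bounds Ωt h M := by
  obtain ⟨h1, h2, h3, h4, h5, h6, h7, h8, h9, h10, h11, h12, h13, h14, h15, h16⟩ := hd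
  have D1 : UCDomain Ω ht θt := ⟨h1, h3, h5, h7, h9, h11, h13, fun x v => (h15 x).fderiv_fderiv_le v⟩
  have D2 : UCDomain Ωt h θ := ⟨h2, h4, h6, h8, h10, h12, h14, fun x v => (h16 x).fderiv_fderiv_le v⟩
  obtain ⟨M1, B1⟩ := D1.exists_bounds
  obtain ⟨M2, B2⟩ := D2.exists_bounds
  exact ⟨min θt θ, max M1 M2, D1.mono (lt_min h13 h14) (min_le_left _ _),
    D2.mono (lt_min h13 h14) (min_le_right _ _), B1.mono (le_max_left _ _),
    B2.mono (le_max_right _ _)⟩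

/-- A function which is smooth on the closed set `closure E` and uniformly convex there. -/
structure ConvexPotential (E : Set (Euc n)) (u : Euc n → ℝ) (δ : ℝ) : Prop where
  smooth : ContDiffOn ℝ (⊤ : ℕ∞) u (closure E)
  pos : 0 < δ
  second_ge : ∀ x ∈ closure E, ∀ v, δ * ‖v‖ ^ 2 ≤ fderiv ℝ (fderiv ℝ u) x v v
  dim_pos : 0 < n

namespace ConvexPotential

variable {E : Set (Euc n)} {k u : Euc n → ℝ} {θ δ : ℝ}

/-- The derivative of `u` is differentiable even at boundary points, since otherwise the second
derivative would take the default value zero. -/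
lemma differentiableAt_fderiv (P : ConvexPotential E u δ) {x : Euc n} (hx : x ∈ closure E) :
    DifferentiableAt ℝ (fderiv ℝ u) x := by
  by_contra h
  have h1 := P.second_ge x hx (EuclideanSpace.single ⟨0, P.dim_pos⟩ 1)
  rw [fderiv_zero_of_not_differentiableAt h] at h1
  simp at h1
  linarith [P.pos]

lemma uniqueDiffOn (D : UCDomain E k θ) : UniqueDiffOn ℝ (closure E) :=
  uniqueDiffOn_convex D.convex_closure
    (D.nonempty.mono (interior_maximal subset_closure D.isOpen))

lemma closure_mem_nhds (D : UCDomain E k θ) {x : Euc n} (hx : x ∈ E) : closure E ∈ 𝓝 x :=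
  Filter.mem_of_superset (D.isOpen.mem_nhds hx) subset_closure

lemma fderivWithin_eq (P : ConvexPotential E u δ) (D : UCDomain E k θ) :
    EqOn (fderivWithin ℝ u (closure E)) (fderiv ℝ u) (closure E) := by
  refine EqOn.of_subset_closure (s := E) (fun x hx => ?_) ?_ ?_ subset_closure subset_rfl
  · exact fderivWithin_of_mem_nhds (closure_mem_nhds D hx)
  · exact P.smooth.continuousOn_fderivWithin (uniqueDiffOn D) (by simp)
  · exact fun x hx => (P.differentiableAt_fderiv hx).continuousAt.continuousWithinAt

lemma contDiffOn_gradient (P : ConvexPotential E u δ) (D : UCDomain E k θ) :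
    ContDiffOn ℝ (⊤ : ℕ∞) (gradient u) (closure E) := by
  have h1 : ContDiffOn ℝ (⊤ : ℕ∞) (fderivWithin ℝ u (closure E)) (closure E) :=
    P.smooth.fderivWithin (uniqueDiffOn D) (by simp)
  have h2 : ContDiffOn ℝ (⊤ : ℕ∞) (fderiv ℝ u) (closure E) :=
    h1.congr fun x hx => (P.fderivWithin_eq D hx).symm
  exact (InnerProductSpace.toDual ℝ (Euc n)).symm.toContinuousLinearEquiv.contDiff.comp_contDiffOn h2

lemma hasFDerivAt_gradient (P : ConvexPotential E u δ) {x : Euc n} (hx : x ∈ closure E) :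
    HasFDerivAt (gradient u)
      ((InnerProductSpace.toDual ℝ (Euc n)).symm.toContinuousLinearEquiv.toContinuousLinearMap ∘L
        fderiv ℝ (fderiv ℝ u) x) x :=
  ((InnerProductSpace.toDual ℝ (Euc n)).symm.toContinuousLinearEquiv.hasFDerivAt).comp x
    (P.differentiableAt_fderiv hx).hasFDerivAt

lemma inner_fderiv_gradient (P : ConvexPotential E u δ) {x : Euc n} (hx : x ∈ closure E)
    (v w : Euc n) : ⟪fderiv ℝ (gradient u) x v, w⟫ = fderiv ℝ (fderiv ℝ u) x v w := by
  rw [(P.hasFDerivAt_gradient hx).fderiv]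
  simp

lemma fderivWithin_gradient (P : ConvexPotential E u δ) (D : UCDomain E k θ) {x : Euc n}
    (hx : x ∈ closure E) :
    fderivWithin ℝ (gradient u) (closure E) x = fderiv ℝ (gradient u) x :=
  (P.hasFDerivAt_gradient hx).differentiableAt.fderivWithin (uniqueDiffOn D x hx)

lemma inner_pos (P : ConvexPotential E u δ) {x : Euc n} (hx : x ∈ closure E) {v : Euc n}
    (hv : v ≠ 0) : 0 < ⟪fderiv ℝ (gradient u) x v, v⟫ := by
  rw [P.inner_fderiv_gradient hx]
  have := P.pos
  exact (P.second_ge x hx v).trans_lt' (by positivity)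

lemma inner_nonneg (P : ConvexPotential E u δ) {x : Euc n} (hx : x ∈ closure E) (v : Euc n) :
    0 ≤ ⟪fderiv ℝ (gradient u) x v, v⟫ := by
  rw [P.inner_fderiv_gradient hx]
  have := P.pos
  exact (P.second_ge x hx v).trans' (by positivity)

lemma contDiffAt (P : ConvexPotential E u δ) (D : UCDomain E k θ) {x : Euc n} (hx : x ∈ E) :
    ContDiffAt ℝ (⊤ : ℕ∞) u x := P.smooth.contDiffAt (closure_mem_nhds D hx)

lemma symm (P : ConvexPotential E u δ) (D : UCDomain E k θ) {x : Euc n} (hx : x ∈ E)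
    (v w : Euc n) : ⟪fderiv ℝ (gradient u) x v, w⟫ = ⟪v, fderiv ℝ (gradient u) x w⟫ := by
  rw [real_inner_comm _ v, P.inner_fderiv_gradient (subset_closure hx),
    P.inner_fderiv_gradient (subset_closure hx)]
  exact (P.contDiffAt D hx).isSymmSndFDerivAt (by simpa using InteriorSol.two_le) v w

lemma gradient_ne (P : ConvexPotential E u δ) (D : UCDomain E k θ) {x y : Euc n}
    (hx : x ∈ closure E) (hy : y ∈ closure E) (hxy : x ≠ y) : gradient u x ≠ gradient u y := by
  intro heq
  set v := x - y with hv
  have hv0 : v ≠ 0 := sub_ne_zero.2 hxy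
  have hmem : ∀ t ∈ Icc (0 : ℝ) 1, y + t • v ∈ closure E := fun t ht => by
    have := D.convex_closure.add_smul_sub_mem hy hx ht
    simpa [hv] using this
  have hder : ∀ t ∈ Icc (0 : ℝ) 1, HasDerivAt (fun t : ℝ => ⟪gradient u (y + t • v), v⟫)
      ⟪fderiv ℝ (gradient u) (y + t • v) v, v⟫ t := fun t ht => by
    have hl : HasDerivAt (fun t : ℝ => y + t • v) v t := by
      simpa using ((hasDerivAt_id t).smul_const v).const_add y
    have h2 := (P.hasFDerivAt_gradient (hmem t ht)).differentiableAt.hasFDerivAt.comp_hasDerivAt t hl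
    simpa using h2.inner ℝ (hasDerivAt_const t v)
  obtain ⟨c, hc, hc'⟩ := exists_hasDerivAt_eq_slope (fun t : ℝ => ⟪gradient u (y + t • v), v⟫)
    (fun t => ⟪fderiv ℝ (gradient u) (y + t • v) v, v⟫) zero_lt_one
    (fun t ht => (hder t ht).continuousAt.continuousWithinAt)
    (fun t ht => hder t (Ioo_subset_Icc_self ht))
  have hpos := P.inner_pos (hmem c (Ioo_subset_Icc_self hc)) hv0
  have hx' : y + v = x := by simp [hv]
  rw [hc'] at hpos
  simp [hx', heq] at hpos

variable {D : Set (Euc n)}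

lemma maps_closure (P : ConvexPotential E u δ) (DE : UCDomain E k θ)
    (him : gradient u '' E = D) {x : Euc n} (hx : x ∈ closure E) : gradient u x ∈ closure D := by
  have h1 : ContinuousOn (gradient u) (closure E) := (P.contDiffOn_gradient DE).continuousOn
  rw [← him]
  exact h1.image_closure (mem_image_of_mem _ hx)

lemma maps_frontier (P : ConvexPotential E u δ) (DE : UCDomain E k θ) (hD : IsOpen D)
    (him : gradient u '' E = D) {x : Euc n} (hx : x ∈ frontier E) : gradient u x ∈ frontier D := by
  have hxc := frontier_subset_closure hx
  rw [hD.frontier_eq]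
  refine ⟨P.maps_closure DE him hxc, fun hmem => ?_⟩
  rw [← him] at hmem
  obtain ⟨y, hy, hyx⟩ := hmem
  refine P.gradient_ne DE (subset_closure hy) hxc ?_ hyx
  rintro rfl
  rw [DE.isOpen.frontier_eq] at hx
  exact hx.2 hy

end ConvexPotential

/-- The volume factor `(1 - |p|²)^{3/2}`. -/
def cubeWeight (p : Euc n) : ℝ := Real.sqrt (1 - ‖p‖ ^ 2) ^ 3

lemma minkDiv_eq {u : Euc n → ℝ} {x : Euc n} (hd : DifferentiableAt ℝ (gradient u) x)
    (hx : ‖gradient u x‖ < 1) :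
    MinkDiv u x = (Real.sqrt (1 - ‖gradient u x‖ ^ 2))⁻¹ * tr (fderiv ℝ (gradient u) x) +
      (Real.sqrt (1 - ‖gradient u x‖ ^ 2) ^ 3)⁻¹ *
        ⟪fderiv ℝ (gradient u) x (gradient u x), gradient u x⟫ := by
  have hpos : 0 < 1 - ‖gradient u x‖ ^ 2 := by nlinarith [norm_nonneg (gradient u x)]
  set A := fderiv ℝ (gradient u) x with hA
  set p := gradient u x with hp
  set s := Real.sqrt (1 - ‖p‖ ^ 2) with hs
  have hs0 : 0 < s := Real.sqrt_pos.2 hpos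
  have h1 : HasFDerivAt (fun y => 1 - ‖gradient u y‖ ^ 2) (-(2 • (innerSL ℝ p) ∘L A)) x :=
    hd.hasFDerivAt.norm_sq.const_sub 1
  have h2 := (hasDerivAt_inv hs0.ne').comp_hasFDerivAt x (h1.sqrt hpos.ne')
  have h3 : ∀ i, HasFDerivAt (fun y => gradient u y i) (EuclideanSpace.proj i ∘L A) x := fun i =>
    (EuclideanSpace.proj (𝕜 := ℝ) i).hasFDerivAt.comp x hd.hasFDerivAt
  have h4 : ∀ i, fderiv ℝ (fun y => (Real.sqrt (1 - ‖gradient u y‖ ^ 2))⁻¹ * gradient u y i) x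
      (EuclideanSpace.single i 1) =
      s⁻¹ * ⟪A (EuclideanSpace.single i 1), EuclideanSpace.single i 1⟫ +
      (s ^ 3)⁻¹ * (p i * ⟪p, A (EuclideanSpace.single i 1)⟫) := fun i => by
    have h : HasFDerivAt (fun y => (Real.sqrt (1 - ‖gradient u y‖ ^ 2))⁻¹ * gradient u y i) _ x :=
      h2.mul (h3 i)
    rw [h.fderiv]
    simp [EuclideanSpace.inner_single_right, ← hp, ← hs]
    field_simp
  have h5 : ∑ i, p i * ⟪p, A (EuclideanSpace.single i 1)⟫ = ⟪A p, p⟫ := by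
    conv_rhs => rw [real_inner_comm]; arg 3; rw [← sum_smul_single p]
    simp [map_sum, inner_sum, real_inner_smul_right]
  rw [MinkDiv, Finset.sum_congr rfl fun i _ => h4 i, Finset.sum_add_distrib, ← Finset.mul_sum,
    ← Finset.mul_sum, h5, tr]

lemma cubeWeight_mul_minkDiv {u : Euc n → ℝ} {x : Euc n} (hd : DifferentiableAt ℝ (gradient u) x)
    (hx : ‖gradient u x‖ < 1) :
    contr (gradient u x) (fun v => ⟪fderiv ℝ (gradient u) x v, v⟫) =
      cubeWeight (gradient u x) * MinkDiv u x := by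
  have hpos : 0 < 1 - ‖gradient u x‖ ^ 2 := by nlinarith [norm_nonneg (gradient u x)]
  have hs0 := Real.sqrt_pos.2 hpos
  have hs2 := Real.sq_sqrt hpos.le
  rw [minkDiv_eq hd hx, cubeWeight, contr, ← tr]
  rw [← hs2]
  simp only [Real.sqrt_sq hs0.le]
  field_simp

lemma tr_le_minkDiv {u : Euc n → ℝ} {x : Euc n} (hd : DifferentiableAt ℝ (gradient u) x)
    (hx : ‖gradient u x‖ < 1) (h0 : ∀ v, 0 ≤ ⟪fderiv ℝ (gradient u) x v, v⟫) :
    tr (fderiv ℝ (gradient u) x) ≤ MinkDiv u x := by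
  have hpos : 0 < 1 - ‖gradient u x‖ ^ 2 := by nlinarith [norm_nonneg (gradient u x)]
  have hs0 := Real.sqrt_pos.2 hpos
  have hs1 : Real.sqrt (1 - ‖gradient u x‖ ^ 2) ≤ 1 :=
    Real.sqrt_le_one.2 (by nlinarith [sq_nonneg ‖gradient u x‖])
  have htr : 0 ≤ tr (fderiv ℝ (gradient u) x) := Finset.sum_nonneg fun i _ => h0 _
  rw [minkDiv_eq hd hx]
  have h1 := le_mul_of_one_le_left htr (one_le_inv_iff₀.2 ⟨hs0, hs1⟩)
  have h2 := mul_nonneg (inv_nonneg.2 (pow_nonneg hs0.le 3)) (h0 (gradient u x))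
  linarith

lemma contr_le_tr {A : Euc n →L[ℝ] Euc n} (hs : ∀ v w, ⟪A v, w⟫ = ⟪v, A w⟫)
    (h0 : ∀ v, 0 ≤ ⟪A v, v⟫) (p : Euc n) : contr p (fun v => ⟪A v, v⟫) ≤ tr A := by
  have := inner_le_tr_mul hs h0 p
  rw [contr, ← tr]
  linarith

lemma le_contr {A : Euc n →L[ℝ] Euc n} (h0 : ∀ v, 0 ≤ ⟪A v, v⟫) (p : Euc n) :
    (1 - ‖p‖ ^ 2) * tr A ≤ contr p (fun v => ⟪A v, v⟫) := by
  rw [contr, ← tr]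
  linarith [h0 p]

lemma det_le_tr_div_pow {A : Euc n →L[ℝ] Euc n} (hn : 0 < n) (hs : ∀ v w, ⟪A v, w⟫ = ⟪v, A w⟫)
    (h0 : ∀ v, 0 ≤ ⟪A v, v⟫) : |A.det| ≤ (tr A / n) ^ n := by
  have hT : (A : Euc n →ₗ[ℝ] Euc n).IsSymmetric := hs
  have hr : Module.finrank ℝ (Euc n) = n := by simp
  set z := hT.eigenvalues hr with hz
  have hz0 : ∀ i, 0 ≤ z i := fun i => by
    have h1 := hT.apply_eigenvectorBasis hr i
    have h2 := h0 (hT.eigenvectorBasis hr i)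
    have h3 : A (hT.eigenvectorBasis hr i) = (z i) • hT.eigenvectorBasis hr i := h1
    rw [h3, real_inner_smul_left, real_inner_self_eq_norm_sq] at h2
    simpa using h2
  have hdet : A.det = ∏ i, z i := by
    simpa [ContinuousLinearMap.det] using hT.det_eq_prod_eigenvalues hr
  have htr : tr A = ∑ i, z i := by
    have h1 := LinearMap.IsSymmetric.trace_eq_sum_eigenvalues hr hT
    rw [LinearMap.trace_eq_sum_inner _ (EuclideanSpace.basisFun (Fin n) ℝ)] at h1
    simpa [tr, real_inner_comm] using h1
  have hn' : (0 : ℝ) < n := by exact_mod_cast hn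
  have hp : 0 ≤ ∏ i, z i := Finset.prod_nonneg fun i _ => hz0 i
  rw [hdet, htr, abs_of_nonneg hp]
  have h := Real.geom_mean_le_arith_mean Finset.univ (fun _ => 1) z (by simp) (by simpa using hn)
    (fun i _ => hz0 i)
  simp only [Real.rpow_one, Finset.sum_const, Finset.card_univ, Fintype.card_fin, nsmul_eq_mul,
    mul_one, one_mul] at h
  calc ∏ i, z i = ((∏ i, z i) ^ ((n : ℝ)⁻¹)) ^ n := by
        rw [← Real.rpow_natCast, ← Real.rpow_mul hp, inv_mul_cancel₀ hn'.ne', Real.rpow_one]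
    _ ≤ _ := by gcongr

/-- A uniform upper bound for the trace of the derivative of a gradient map bounds the volume of
its image. -/
lemma rpow_volume_ratio_le {E : Set (Euc n)} {G : Euc n → Euc n} {r : ℝ} (hn : 0 < n)
    (hE : IsOpen E) (hb : Bornology.IsBounded E) (hne : E.Nonempty)
    (hd : ∀ x ∈ E, DifferentiableAt ℝ G x)
    (hs : ∀ x ∈ E, ∀ v w, ⟪fderiv ℝ G x v, w⟫ = ⟪v, fderiv ℝ G x w⟫)
    (h0 : ∀ x ∈ E, ∀ v, 0 ≤ ⟪fderiv ℝ G x v, v⟫) (hr : ∀ x ∈ E, tr (fderiv ℝ G x) ≤ r) :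
    n * ((volume (G '' E)).toReal / (volume E).toReal) ^ ((1 : ℝ) / n) ≤ r := by
  have hn' : (0 : ℝ) < n := by exact_mod_cast hn
  have htr : ∀ x ∈ E, 0 ≤ tr (fderiv ℝ G x) := fun x hx => Finset.sum_nonneg fun i _ => h0 x hx _
  have hr0 : 0 ≤ r := by
    obtain ⟨x, hx⟩ := hne
    exact (htr x hx).trans (hr x hx)
  have hvE : volume E ≠ ⊤ := hb.measure_lt_top.ne
  have hvE0 : 0 < (volume E).toReal := ENNReal.toReal_pos (hE.measure_pos volume hne).ne' hvE
  have h1 : volume (G '' E) ≤ ENNReal.ofReal ((r / n) ^ n) * volume E := by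
    refine (addHaar_image_le_lintegral_abs_det_fderiv volume hE.measurableSet
      (fun x hx => (hd x hx).hasFDerivAt.hasFDerivWithinAt)).trans ?_
    rw [← setLIntegral_const]
    refine setLIntegral_mono measurable_const fun x hx => ENNReal.ofReal_le_ofReal ?_
    refine (det_le_tr_div_pow hn (hs x hx) (h0 x hx)).trans ?_
    have := htr x hx
    have := hr x hx
    gcongr
  have h2 : (volume (G '' E)).toReal ≤ (r / n) ^ n * (volume E).toReal := by
    have := ENNReal.toReal_mono (ENNReal.mul_ne_top ENNReal.ofReal_ne_top hvE) h1
    rwa [ENNReal.toReal_mul, ENNReal.toReal_ofReal (by positivity)] at this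
  have h3 : (volume (G '' E)).toReal / (volume E).toReal ≤ (r / n) ^ n := (div_le_iff₀ hvE0).2 h2
  have h4 : ((volume (G '' E)).toReal / (volume E).toReal) ^ ((1 : ℝ) / n) ≤ r / n := by
    calc _ ≤ ((r / n) ^ n) ^ ((1 : ℝ) / n) := by gcongr
      _ = r / n := by
        rw [one_div, Real.pow_rpow_inv_natCast (by positivity) hn.ne']
  calc _ ≤ n * (r / n) := by gcongr
    _ = r := by field_simp

namespace ConvexPotential

variable {E : Set (Euc n)} {k u : Euc n → ℝ} {θ δ : ℝ}

/-- A convex function with gradient of norm less than one on a ball of radius `r` has a point in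
the ball where the Hessian is at most `4 / r`. -/
lemma exists_second_le (P : ConvexPotential E u δ) (D : UCDomain E k θ)
    (hlt : ∀ x ∈ closure E, ‖gradient u x‖ < 1) {z : Euc n} {r : ℝ} (hr : 0 < r)
    (hball : Metric.closedBall z r ⊆ E) :
    ∃ y ∈ E, ∀ v, fderiv ℝ (fderiv ℝ u) y v v ≤ 4 / r * ‖v‖ ^ 2 := by
  have hcont : ContinuousOn u (Metric.closedBall z r) :=
    P.smooth.continuousOn.mono (hball.trans subset_closure)
  have hφ : ContinuousOn (fun x => u x - 2 / r * ‖x - z‖ ^ 2) (Metric.closedBall z r) := by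
    fun_prop
  obtain ⟨y, hy, hmax⟩ := (isCompact_closedBall z r).exists_isMaxOn
    ⟨z, Metric.mem_closedBall_self hr.le⟩ hφ
  have hzE : z ∈ Metric.closedBall z r := Metric.mem_closedBall_self hr.le
  have hyr : ‖y - z‖ < r := by
    refine lt_of_le_of_ne (by simpa [dist_eq_norm] using hy) fun heq => ?_
    have h1 := hmax hzE
    simp only [mem_ofPred_eq, sub_self, norm_zero, heq] at h1
    have h2 : ‖u y - u z‖ ≤ 1 * ‖y - z‖ := by
      refine (convex_closedBall z r).norm_image_sub_le_of_norm_fderiv_le (𝕜 := ℝ)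
        (fun x hx => ?_) (fun x hx => ?_) hzE hy
      · exact (P.contDiffAt D (hball hx)).differentiableAt (by simp)
      · have := (hlt x (subset_closure (hball hx))).le
        rwa [gradient, LinearIsometryEquiv.norm_map] at this
    rw [heq, Real.norm_eq_abs] at h2
    have h3 := (abs_le.1 h2).2
    have h4 : 2 / r * r ^ 2 = 2 * r := by field_simp
    simp only [ne_eq, OfNat.ofNat_ne_zero, not_false_eq_true, zero_pow, mul_zero, sub_zero] at h1
    linarith
  have hyE := hball hy
  refine ⟨y, hyE, fun v => ?_⟩
  have hu : ContDiffAt ℝ 2 u y := (P.contDiffAt D hyE).of_le InteriorSol.two_le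
  have j1 := jet2_along_line hu v
  have jl := Jet2.line (y - z) v
  have j := j1.sub ((jl.inner jl).const_smul (2 / r))
  have hloc : IsLocalMax (fun t : ℝ => u (y + t • v) -
      (2 / r) • ⟪(y - z) + t • v, (y - z) + t • v⟫) 0 := by
    have hnear : ∀ᶠ t : ℝ in 𝓝 0, y + t • v ∈ Metric.closedBall z r := by
      refine (tendsto_line y v).eventually (Filter.mem_of_superset
        (Metric.isOpen_ball.mem_nhds ?_) Metric.ball_subset_closedBall)
      simpa [dist_eq_norm] using hyr
    filter_upwards [hnear] with t ht
    have := hmax ht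
    simp only [mem_ofPred_eq] at this
    rw [show y + t • v - z = y - z + t • v by abel] at this
    simpa [real_inner_self_eq_norm_sq] using this
  have h := (j.of_isLocalMax hloc).2
  simp only [inner_zero_left, inner_zero_right, real_inner_self_eq_norm_sq, smul_eq_mul] at h
  have h4 : 4 / r * ‖v‖ ^ 2 = 2 / r * (2 * ‖v‖ ^ 2) := by ring
  rw [h4]
  linarith

end ConvexPotential

lemma contDiffOn_cubeWeight :
    ContDiffOn ℝ (⊤ : ℕ∞) (cubeWeight (n := n)) (Metric.ball 0 1) := by
  intro p hp
  have hp1 : ‖p‖ < 1 := by simpa using hp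
  have hpos : 1 - ‖p‖ ^ 2 ≠ 0 := by nlinarith [norm_nonneg p]
  have h1 : ContDiffAt ℝ (⊤ : ℕ∞) (fun p : Euc n => 1 - ‖p‖ ^ 2) p :=
    contDiffAt_const.sub (contDiff_norm_sq ℝ).contDiffAt
  exact ((h1.sqrt hpos).pow 3).contDiffWithinAt

lemma cubeWeight_nonneg (p : Euc n) : 0 ≤ cubeWeight p := by unfold cubeWeight; positivity

lemma cubeWeight_le_one (p : Euc n) : cubeWeight p ≤ 1 :=
  pow_le_one₀ (Real.sqrt_nonneg _) (Real.sqrt_le_one.2 (by nlinarith [sq_nonneg ‖p‖]))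

lemma le_cubeWeight {p : Euc n} {ρ : ℝ} (h : ‖p‖ ^ 2 ≤ ρ) :
    Real.sqrt (1 - ρ) ^ 3 ≤ cubeWeight p := by
  unfold cubeWeight
  gcongr

lemma exists_cubeWeight_bound {D : Set (Euc n)} (hc : IsCompact (closure D))
    (hD : closure D ⊆ Metric.ball 0 1) :
    ∃ W, 0 ≤ W ∧ ∀ p ∈ closure D, ‖fderiv ℝ cubeWeight p‖ ≤ W ∧
      ‖fderiv ℝ (fderiv ℝ cubeWeight) p‖ ≤ W := by
  have s1 : ContDiffOn ℝ (⊤ : ℕ∞) (fderiv ℝ (cubeWeight (n := n))) (Metric.ball 0 1) :=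
    contDiffOn_cubeWeight.fderiv_of_isOpen Metric.isOpen_ball (by simp)
  have s2 : ContDiffOn ℝ (⊤ : ℕ∞) (fderiv ℝ (fderiv ℝ (cubeWeight (n := n)))) (Metric.ball 0 1) :=
    s1.fderiv_of_isOpen Metric.isOpen_ball (by simp)
  obtain ⟨m1, h1⟩ := hc.exists_bound_of_continuousOn (s1.continuousOn.mono hD)
  obtain ⟨m2, h2⟩ := hc.exists_bound_of_continuousOn
    (f := fderiv ℝ (fderiv ℝ (cubeWeight (n := n)))) (s2.continuousOn.mono hD)
  refine ⟨|m1| + |m2|, by positivity, fun p hp => ⟨(h1 p hp).trans ?_, (h2 p hp).trans ?_⟩⟩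
  · linarith [le_abs_self m1, abs_nonneg m2]
  · linarith [le_abs_self m2, abs_nonneg m1]

/-- The right-hand side of the equation after multiplication by the volume factor. -/
def weightedRhs (f : Euc n × Euc n → ℝ) (c : ℝ) (z : Euc n × Euc n) : ℝ :=
  cubeWeight z.2 * (f z + c)

section Rhs

variable {f : Euc n × Euc n → ℝ} {x p : Euc n}

lemma fderiv_weightedRhs (hf : ContDiffAt ℝ 2 f (x, p)) (hω : ContDiffAt ℝ 2 cubeWeight p) (c : ℝ)
    (ξ w : Euc n) :
    fderiv ℝ (weightedRhs f c) (x, p) (ξ, w) = fderiv ℝ cubeWeight p w * (f (x, p) + c) +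
        cubeWeight p * fderiv ℝ f (x, p) (ξ, w) ∧
      fderiv ℝ (fderiv ℝ (weightedRhs f c)) (x, p) (ξ, w) (ξ, w) =
        fderiv ℝ (fderiv ℝ cubeWeight) p w w * (f (x, p) + c) +
          2 * (fderiv ℝ cubeWeight p w * fderiv ℝ f (x, p) (ξ, w)) +
          cubeWeight p * fderiv ℝ (fderiv ℝ f) (x, p) (ξ, w) (ξ, w) := by
  have hg : ContDiffAt ℝ 2 (weightedRhs f c) (x, p) := by
    have hω' : ContDiffAt ℝ 2 (fun z : Euc n × Euc n => cubeWeight z.2) (x, p) :=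
      ContDiffAt.comp (x, p) (f := fun z : Euc n × Euc n => z.2) hω contDiffAt_snd
    exact hω'.mul (hf.add contDiffAt_const)
  have j1 := jet2_along_line hg (ξ, w)
  have j2 := (jet2_along_line hω w).mul ((jet2_along_line hf (ξ, w)).add (Jet2.const c))
  obtain ⟨e1, e2⟩ := j1.unique j2 (Filter.Eventually.of_forall fun t => by simp [weightedRhs])
  exact ⟨by simpa using e1, by simpa using e2⟩

lemma abs_fderiv_fst_le (hf : ContDiffAt ℝ 2 f (x, p)) {ε : ℝ}
    (h : ‖fderiv ℝ (fun x' => f (x', p)) x‖ ≤ ε) (ξ : Euc n) :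
    |fderiv ℝ f (x, p) (ξ, 0)| ≤ ε * ‖ξ‖ := by
  have h1 : HasFDerivAt (fun x' : Euc n => (x', p)) (ContinuousLinearMap.inl ℝ (Euc n) (Euc n)) x :=
    hasFDerivAt_prodMk_left x p
  have h2 := (hf.differentiableAt (by simp)).hasFDerivAt.comp x h1
  have h3 : fderiv ℝ (fun x' => f (x', p)) x = _ := h2.fderiv
  have h4 : fderiv ℝ f (x, p) (ξ, 0) = fderiv ℝ (fun x' => f (x', p)) x ξ := by
    rw [h3]; simp
  rw [h4, ← Real.norm_eq_abs]
  exact (fderiv ℝ (fun x' => f (x', p)) x).le_of_opNorm_le h ξ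

lemma abs_fderiv_fderiv_mixed_le (hf : ContDiffAt ℝ 2 f (x, p)) {ε : ℝ}
    (h : ‖fderiv ℝ (fun p' => fderiv ℝ (fun x' => f (x', p')) x) p‖ ≤ ε) (ξ w : Euc n) :
    |fderiv ℝ (fderiv ℝ f) (x, p) (0, w) (ξ, 0)| ≤ ε * ‖w‖ * ‖ξ‖ := by
  have hev : ∀ᶠ z in 𝓝 (x, p), DifferentiableAt ℝ f z := by
    filter_upwards [hf.eventually (by simp)] with z hz using hz.differentiableAt (by simp)
  have hcont : Filter.Tendsto (fun p' : Euc n => (x, p')) (𝓝 p) (𝓝 (x, p)) :=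
    (Continuous.prodMk_right x).tendsto p
  have e : (fun p' => fderiv ℝ (fun x' => f (x', p')) x) =ᶠ[𝓝 p]
      fun p' => (fderiv ℝ f (x, p')).comp (ContinuousLinearMap.inl ℝ (Euc n) (Euc n)) := by
    filter_upwards [hcont.eventually hev] with p' hp'
    exact (hp'.hasFDerivAt.comp x (hasFDerivAt_prodMk_left x p')).fderiv
  have hd : DifferentiableAt ℝ (fderiv ℝ f) (x, p) :=
    (hf.fderiv_right (m := 1) (by norm_num)).differentiableAt (by simp)
  have h2 : HasFDerivAt (fun p' => fderiv ℝ f (x, p')) _ p :=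
    hd.hasFDerivAt.comp p (hasFDerivAt_prodMk_right x p)
  have h3 := h2.clm_comp (hasFDerivAt_const (ContinuousLinearMap.inl ℝ (Euc n) (Euc n)) p)
  have h4 : fderiv ℝ (fderiv ℝ f) (x, p) (0, w) (ξ, 0) =
      fderiv ℝ (fun p' => fderiv ℝ (fun x' => f (x', p')) x) p w ξ := by
    rw [e.fderiv_eq, h3.fderiv]; simp
  rw [h4, ← Real.norm_eq_abs]
  exact ((fderiv ℝ (fun p' => fderiv ℝ (fun x' => f (x', p')) x) p w).le_opNorm ξ).trans
    (by gcongr; exact (fderiv ℝ (fun p' => fderiv ℝ (fun x' => f (x', p')) x) p).le_of_opNorm_le h w)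

lemma fderiv_fderiv_fst_nonpos (hf : ContDiffAt ℝ 2 f (x, p)) {s : Set (Euc n)} (hs : s ∈ 𝓝 x)
    (hcc : ConcaveOn ℝ s (fun x => f (x, p))) (ξ : Euc n) :
    fderiv ℝ (fderiv ℝ f) (x, p) (ξ, 0) (ξ, 0) ≤ 0 := by
  have j := (jet2_along_line hf (ξ, 0)).add (jet2_along_line hf (-(ξ, 0)))
  have hloc : IsLocalMax (fun t : ℝ => f ((x, p) + t • (ξ, (0 : Euc n))) +
      f ((x, p) + t • (-(ξ, (0 : Euc n))))) 0 := by
    filter_upwards [(tendsto_line x ξ).eventually hs, (tendsto_line x (-ξ)).eventually hs]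
      with t h1 h2
    have h := hcc.2 h1 h2 (by norm_num : (0 : ℝ) ≤ 1 / 2) (by norm_num : (0 : ℝ) ≤ 1 / 2)
      (by norm_num)
    have e : (1 / 2 : ℝ) • (x + t • ξ) + (1 / 2 : ℝ) • (x + t • (-ξ)) = x := by module
    rw [e] at h
    simp only [smul_eq_mul] at h
    simp
    simp at h
    linarith
  have h := (j.of_isLocalMax hloc).2
  simp only [map_neg, _root_.neg_apply, neg_neg] at h
  linarith

lemma abs_fderiv_fderiv_le {K : ℝ} (h : ‖iteratedFDeriv ℝ 2 f (x, p)‖ ≤ K) (a b : Euc n × Euc n) :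
    |fderiv ℝ (fderiv ℝ f) (x, p) a b| ≤ K * ‖a‖ * ‖b‖ := by
  have h1 := (iteratedFDeriv ℝ 2 f (x, p)).le_of_opNorm_le h ![a, b]
  rw [iteratedFDeriv_two_apply] at h1
  simpa [Fin.prod_univ_two, mul_assoc] using h1

end Rhs

section Rhs

variable {f : Euc n × Euc n → ℝ} {x p : Euc n} {W Φ K ε c : ℝ}

lemma abs_fderiv_weightedRhs_fst_le (hf : ContDiffAt ℝ 2 f (x, p))
    (hω : ContDiffAt ℝ 2 cubeWeight p) (hx : ‖fderiv ℝ (fun x' => f (x', p)) x‖ ≤ ε) (ξ : Euc n) :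
    |fderiv ℝ (weightedRhs f c) (x, p) (ξ, 0)| ≤ ε * ‖ξ‖ := by
  rw [(fderiv_weightedRhs hf hω c ξ 0).1]
  have h1 := abs_fderiv_fst_le hf hx ξ
  rw [map_zero, zero_mul, zero_add, abs_mul, abs_of_nonneg (cubeWeight_nonneg p)]
  exact (mul_le_of_le_one_left (abs_nonneg _) (cubeWeight_le_one p)).trans h1

lemma abs_fderiv_snd_le (h1 : ‖fderiv ℝ f (x, p)‖ ≤ K) (w : Euc n) :
    |fderiv ℝ f (x, p) (0, w)| ≤ K * ‖w‖ := by
  have := (fderiv ℝ f (x, p)).le_of_opNorm_le h1 (0, w)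
  simpa using this

lemma abs_fderiv_weightedRhs_snd_le (hf : ContDiffAt ℝ 2 f (x, p))
    (hω : ContDiffAt ℝ 2 cubeWeight p) (hW : 0 ≤ W) (hω1 : ‖fderiv ℝ cubeWeight p‖ ≤ W)
    (hΦ : |f (x, p) + c| ≤ Φ) (h1 : ‖fderiv ℝ f (x, p)‖ ≤ K) (w : Euc n) :
    |fderiv ℝ (weightedRhs f c) (x, p) (0, w)| ≤ (W * Φ + K) * ‖w‖ := by
  rw [(fderiv_weightedRhs hf hω c 0 w).1]
  have a1 : |fderiv ℝ cubeWeight p w| ≤ W * ‖w‖ := (fderiv ℝ cubeWeight p).le_of_opNorm_le hω1 w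
  have a2 := abs_fderiv_snd_le h1 w
  calc _ ≤ |fderiv ℝ cubeWeight p w * (f (x, p) + c)| +
        |cubeWeight p * fderiv ℝ f (x, p) (0, w)| := abs_add_le _ _
    _ ≤ W * ‖w‖ * Φ + 1 * (K * ‖w‖) := by
        rw [abs_mul, abs_mul, abs_of_nonneg (cubeWeight_nonneg p)]
        have := cubeWeight_le_one p
        gcongr
    _ = _ := by ring

lemma fderiv_fderiv_weightedRhs_le (hf : ContDiffAt ℝ 2 f (x, p))
    (hω : ContDiffAt ℝ 2 cubeWeight p) (hW : 0 ≤ W) (hω1 : ‖fderiv ℝ cubeWeight p‖ ≤ W)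
    (hω2 : ‖fderiv ℝ (fderiv ℝ cubeWeight) p‖ ≤ W)
    (hΦ : |f (x, p) + c| ≤ Φ) (h1 : ‖fderiv ℝ f (x, p)‖ ≤ K)
    (h2 : ‖iteratedFDeriv ℝ 2 f (x, p)‖ ≤ K)
    (hx : ‖fderiv ℝ (fun x' => f (x', p)) x‖ ≤ ε)
    (hxp : ‖fderiv ℝ (fun p' => fderiv ℝ (fun x' => f (x', p')) x) p‖ ≤ ε)
    {s : Set (Euc n)} (hs : s ∈ 𝓝 x) (hcc : ConcaveOn ℝ s (fun x => f (x, p))) (ξ w : Euc n) :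
    fderiv ℝ (fderiv ℝ (weightedRhs f c)) (x, p) (ξ, w) (ξ, w) ≤
      (W * Φ + 2 * W * K + K) * ‖w‖ ^ 2 + 2 * ((W + 1) * ε) * ‖ξ‖ * ‖w‖ := by
  have hε : 0 ≤ ε := (norm_nonneg _).trans hx
  have hK : 0 ≤ K := (norm_nonneg _).trans h1
  have e : (ξ, w) = (ξ, (0 : Euc n)) + (0, w) := by simp
  rw [(fderiv_weightedRhs hf hω c ξ w).2]
  have a1 : |fderiv ℝ cubeWeight p w| ≤ W * ‖w‖ := (fderiv ℝ cubeWeight p).le_of_opNorm_le hω1 w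
  have a2 : |fderiv ℝ (fderiv ℝ cubeWeight) p w w| ≤ W * ‖w‖ * ‖w‖ :=
    ((fderiv ℝ (fderiv ℝ cubeWeight) p w).le_opNorm w).trans
      (by gcongr; exact (fderiv ℝ (fderiv ℝ cubeWeight) p).le_of_opNorm_le hω2 w)
  have b1 : |fderiv ℝ f (x, p) (ξ, w)| ≤ ε * ‖ξ‖ + K * ‖w‖ := by
    rw [e, map_add]
    exact (abs_add_le _ _).trans (add_le_add (abs_fderiv_fst_le hf hx ξ) (abs_fderiv_snd_le h1 w))
  have b2 : fderiv ℝ (fderiv ℝ f) (x, p) (ξ, w) (ξ, w) ≤ 2 * ε * ‖ξ‖ * ‖w‖ + K * ‖w‖ ^ 2 := by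
    have c1 := fderiv_fderiv_fst_nonpos hf hs hcc ξ
    have c2 := (abs_le.1 (abs_fderiv_fderiv_mixed_le hf hxp ξ w)).2
    have c3 := (abs_le.1 (abs_fderiv_fderiv_le h2 (0, w) (0, w))).2
    have c4 : fderiv ℝ (fderiv ℝ f) (x, p) (ξ, 0) (0, w) =
        fderiv ℝ (fderiv ℝ f) (x, p) (0, w) (ξ, 0) := hf.isSymmSndFDerivAt (by simp) _ _
    have c5 : ‖((0 : Euc n), w)‖ = ‖w‖ := by simp
    rw [c5] at c3
    rw [e]
    simp only [map_add, _root_.add_apply, c4]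
    nlinarith
  have d1 : fderiv ℝ (fderiv ℝ cubeWeight) p w w * (f (x, p) + c) ≤ W * ‖w‖ * ‖w‖ * Φ := by
    refine (le_abs_self _).trans ?_
    rw [abs_mul]
    gcongr
  have d2 : fderiv ℝ cubeWeight p w * fderiv ℝ f (x, p) (ξ, w) ≤
      W * ‖w‖ * (ε * ‖ξ‖ + K * ‖w‖) := by
    refine (le_abs_self _).trans ?_
    rw [abs_mul]
    gcongr
  have d3 : cubeWeight p * fderiv ℝ (fderiv ℝ f) (x, p) (ξ, w) (ξ, w) ≤
      2 * ε * ‖ξ‖ * ‖w‖ + K * ‖w‖ ^ 2 :=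
    (mul_le_mul_of_nonneg_left b2 (cubeWeight_nonneg p)).trans
      (mul_le_of_le_one_left (by positivity) (cubeWeight_le_one p))
  linarith

end Rhs

namespace ConvexPotential

variable {E D : Set (Euc n)} {k u : Euc n → ℝ} {θ δ : ℝ} {f : Euc n × Euc n → ℝ} {c : ℝ}

lemma le_rhs (P : ConvexPotential E u δ) (DE : UCDomain E k θ)
    (hlt : ∀ x ∈ closure E, ‖gradient u x‖ < 1)
    (heq : ∀ x ∈ E, MinkDiv u x = f (x, gradient u x) + c) (him : gradient u '' E = D)
    (hosc : OSCcond E D f) {z : Euc n × Euc n} (hz : z ∈ closure E ×ˢ closure D) :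
    (n / 2 : ℝ) * ((volume D).toReal / (volume E).toReal) ^ ((1 : ℝ) / n) ≤ f z + c := by
  have h := rpow_volume_ratio_le (G := gradient u) (r := f z + c +
    (n / 2 : ℝ) * ((volume D).toReal / (volume E).toReal) ^ ((1 : ℝ) / n)) P.dim_pos
    DE.isOpen DE.isBounded DE.nonempty
    (fun x hx => (P.hasFDerivAt_gradient (subset_closure hx)).differentiableAt)
    (fun x hx => P.symm DE hx) (fun x hx => P.inner_nonneg (subset_closure hx))
    (fun x hx => ?_)
  · rw [him] at h
    linarith
  · have hxc := subset_closure hx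
    have h1 := tr_le_minkDiv (P.hasFDerivAt_gradient hxc).differentiableAt (hlt x hxc)
      (P.inner_nonneg hxc)
    rw [heq x hx] at h1
    have h2 := (abs_le.1 (hosc x hxc z.1 hz.1 _ (P.maps_closure DE him hxc) z.2 hz.2)).2
    linarith

lemma rhs_le (P : ConvexPotential E u δ) (DE : UCDomain E k θ)
    (hlt : ∀ x ∈ closure E, ‖gradient u x‖ < 1)
    (heq : ∀ x ∈ E, MinkDiv u x = f (x, gradient u x) + c) (him : gradient u '' E = D)
    {ρ : ℝ} (hρ : ∀ p ∈ closure D, ‖p‖ ^ 2 ≤ ρ) (hρ1 : ρ < 1) {K : ℝ}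
    (hK : ∀ z ∈ closure E ×ˢ closure D, |f z| ≤ K)
    (h0 : ∀ z ∈ closure E ×ˢ closure D, 0 ≤ f z + c)
    {y : Euc n} {r : ℝ} (hr : 0 < r) (hball : Metric.closedBall y r ⊆ E)
    {z : Euc n × Euc n} (hz : z ∈ closure E ×ˢ closure D) :
    f z + c ≤ n * (4 / r) / Real.sqrt (1 - ρ) ^ 3 + 2 * K := by
  obtain ⟨a, ha, hle⟩ := P.exists_second_le DE hlt hr hball
  have hac := subset_closure ha
  have hmem : (a, gradient u a) ∈ closure E ×ˢ closure D := ⟨hac, P.maps_closure DE him hac⟩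
  have h1 : tr (fderiv ℝ (gradient u) a) ≤ n * (4 / r) := by
    calc tr (fderiv ℝ (gradient u) a) ≤ ∑ _i : Fin n, 4 / r := by
          refine Finset.sum_le_sum fun i _ => ?_
          rw [P.inner_fderiv_gradient hac]
          simpa using hle (EuclideanSpace.single i 1)
      _ = _ := by simp
  have h2 := contr_le_tr (P.symm DE ha) (P.inner_nonneg hac) (gradient u a)
  rw [cubeWeight_mul_minkDiv (P.hasFDerivAt_gradient hac).differentiableAt (hlt a hac),
    heq a ha] at h2
  have h3 := le_cubeWeight (hρ _ hmem.2)
  have hs : 0 < Real.sqrt (1 - ρ) ^ 3 := pow_pos (Real.sqrt_pos.2 (by linarith)) 3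
  have h4 : f (a, gradient u a) + c ≤ n * (4 / r) / Real.sqrt (1 - ρ) ^ 3 := by
    rw [le_div_iff₀ hs, mul_comm]
    exact ((mul_le_mul_of_nonneg_right h3 (h0 _ hmem)).trans h2).trans h1
  have h5 := abs_le.1 (hK _ hmem)
  have h6 := abs_le.1 (hK _ hz)
  linarith [h5.1, h6.2]

end ConvexPotential

lemma IsSmoothSol.convexPotential {Ω Ωt : Set (Euc n)} {f : Euc n × Euc n → ℝ} {c : ℝ}
    {u : Euc n → ℝ} (hn : 0 < n) (hu : IsSmoothSol Ω Ωt f c u) :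
    ∃ δ, ConvexPotential Ω u δ := by
  obtain ⟨h1, ⟨δ, hδ, h2⟩, -⟩ := hu
  exact ⟨δ, h1, hδ, fun x hx v => (h2 x hx).le_fderiv_fderiv v, hn⟩

/-- A smooth uniformly convex solution whose right-hand side is controlled satisfies the hypotheses
of the global second derivative estimate. -/
lemma IsSmoothSol.bvSol {Ω Ωt : Set (Euc n)} {ht h : Euc n → ℝ} {f : Euc n × Euc n → ℝ} {c : ℝ}
    {u : Euc n → ℝ} (hn : 0 < n) (hu : IsSmoothSol Ω Ωt f c u)
    {θ M ρ W R Φ K ε : ℝ} (D1 : UCDomain Ω ht θ) (D2 : UCDomain Ωt h θ)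
    (B1 : UCDomain.Bounds Ω ht M) (B2 : UCDomain.Bounds Ωt h M)
    (hball : closure Ωt ⊆ Metric.ball (0 : Euc n) 1)
    (hρ : ∀ p ∈ closure Ωt, ‖p‖ ^ 2 ≤ ρ) (hρ1 : ρ < 1) (hW : 0 ≤ W)
    (hω : ∀ p ∈ closure Ωt, ‖fderiv ℝ cubeWeight p‖ ≤ W ∧
      ‖fderiv ℝ (fderiv ℝ cubeWeight) p‖ ≤ W)
    (hR : 0 < R) (hfR : ∀ z ∈ closure Ω ×ˢ closure Ωt, R ≤ f z + c)
    (hfΦ : ∀ z ∈ closure Ω ×ˢ closure Ωt, f z + c ≤ Φ)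
    (hA : InA Ω Ωt f) (hC2 : C2Bound Ω Ωt f K) (hK : 0 ≤ K) (hx : DxBound Ω Ωt f ε)
    (hxp : DxpBound Ω Ωt f ε) (hε : 0 ≤ ε) (hε1 : (W + 1) * ε ≤ 1)
    (hε2 : 4 * ((W + 1) * ε * M) ≤
      θ * ((1 - ρ) * (Real.sqrt (1 - ρ) ^ 3 * R) ^ 2 / n) / 2) :
    BVSol Ω Ωt ht h (gradient u) (fderivWithin ℝ (gradient u) (closure Ω))
      (fderivWithin ℝ (fderivWithin ℝ (gradient u) (closure Ω)) (closure Ω)) (weightedRhs f c)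
      θ M ρ (Real.sqrt (1 - ρ) ^ 3 * R) (Φ / (1 - ρ)) (W * Φ + 2 * W * K + K) ((W + 1) * ε) := by
  obtain ⟨δ, P⟩ := hu.convexPotential hn
  obtain ⟨-, -, hlt, heq, him⟩ := hu
  have hs : 0 < Real.sqrt (1 - ρ) ^ 3 := pow_pos (Real.sqrt_pos.2 (by linarith)) 3
  have hG := P.contDiffOn_gradient D1
  have hU : ContDiffOn ℝ (⊤ : ℕ∞) (fderivWithin ℝ (gradient u) (closure Ω)) (closure Ω) :=
    hG.fderivWithin (ConvexPotential.uniqueDiffOn D1) (by simp)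
  have hT := hU.continuousOn_fderivWithin (ConvexPotential.uniqueDiffOn D1) (by simp)
  have hmem : ∀ x ∈ closure Ω, (x, gradient u x) ∈ closure Ω ×ˢ closure Ωt := fun x hx =>
    ⟨hx, P.maps_closure D1 him hx⟩
  have hmaps : ∀ x ∈ Ω, gradient u x ∈ Ωt := fun x hx => him ▸ mem_image_of_mem _ hx
  have hΦ0 : 0 ≤ Φ := by
    obtain ⟨x, hx⟩ := D1.nonempty
    linarith [hfR _ (hmem x (subset_closure hx)), hfΦ _ (hmem x (subset_closure hx))]
  have hf2 : ∀ x ∈ Ω, ContDiffAt ℝ 2 f (x, gradient u x) := fun x hx =>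
    hA.1.contDiffAt (prod_mem_nhds (ConvexPotential.closure_mem_nhds D1 hx)
      (ConvexPotential.closure_mem_nhds D2 (hmaps x hx)))
  have hω2 : ∀ p ∈ closure Ωt, ContDiffAt ℝ 2 (cubeWeight (n := n)) p := fun p hp =>
    (contDiffOn_cubeWeight.contDiffAt (Metric.isOpen_ball.mem_nhds (hball hp))).of_le
      InteriorSol.two_le
  have heqn : ∀ x ∈ Ω, contr (gradient u x) (fun v => ⟪fderiv ℝ (gradient u) x v, v⟫) =
      weightedRhs f c (x, gradient u x) := fun x hx => by
    have hxc := subset_closure hx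
    rw [cubeWeight_mul_minkDiv (P.hasFDerivAt_gradient hxc).differentiableAt (hlt x hxc),
      heq x hx, weightedRhs]
  have hdx : ∀ x ∈ Ω, ‖fderiv ℝ (fun x' => f (x', gradient u x)) x‖ ≤ (W + 1) * ε :=
    fun x hx' => (hx x (subset_closure hx') _ (hmem x (subset_closure hx')).2).trans
      (le_mul_of_one_le_left hε (by linarith))
  refine
    { sol := ⟨D1.isOpen, fun x hx => hG.contDiffAt (ConvexPotential.closure_mem_nhds D1 hx),
        fun x hx => P.symm D1 hx, heqn, fun x hx => ?_⟩
      bounds := fun x hx' => ⟨hρ _ (hmem x (subset_closure hx')).2, P.inner_nonneg (subset_closure hx'),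
        ?_, ?_, ?_, ?_, ?_⟩
      domE := D1, domD := D2, bE := B1, bD := B2
      hasU := fun x hx => (hG.differentiableOn (by simp) x hx).hasFDerivWithinAt
      hasT := fun x hx => (hU.differentiableOn (by simp) x hx).hasFDerivWithinAt
      contT := hT
      pos := fun x hx v hv => ?_
      maps := fun x hx => (hmem x hx).2
      maps_frontier := fun x hx => P.maps_frontier D1 D2.isOpen him hx
      dim_pos := hn, rho_lt := hρ1, kappa_pos := by positivity, L_nonneg := by positivity
      eps_nonneg := by positivity, eps_le_one := hε1, eps_le := hε2 }
  · have hω' : ContDiffAt ℝ 2 (fun z : Euc n × Euc n => cubeWeight z.2) (x, gradient u x) :=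
      ContDiffAt.comp (x, gradient u x) (f := fun z : Euc n × Euc n => z.2)
        (hω2 _ (hmem x (subset_closure hx)).2) contDiffAt_snd
    exact hω'.mul ((hf2 x hx).add contDiffAt_const)
  · have h1 := contr_le_tr (P.symm D1 hx') (P.inner_nonneg (subset_closure hx')) (gradient u x)
    rw [heqn x hx'] at h1
    refine le_trans ?_ h1
    have h2 := le_cubeWeight (hρ _ (hmem x (subset_closure hx')).2)
    have h3 := hfR _ (hmem x (subset_closure hx'))
    exact mul_le_mul h2 h3 hR.le (cubeWeight_nonneg _)
  · have h1 := le_contr (P.inner_nonneg (subset_closure hx')) (gradient u x)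
    rw [heqn x hx', weightedRhs] at h1
    have h2 := hρ _ (hmem x (subset_closure hx')).2
    have h3 := hfΦ _ (hmem x (subset_closure hx'))
    have h4 : 0 ≤ tr (fderiv ℝ (gradient u) x) :=
      Finset.sum_nonneg fun i _ => P.inner_nonneg (subset_closure hx') _
    have h5 := mul_le_of_le_one_left (hR.le.trans (hfR _ (hmem x (subset_closure hx'))))
      (cubeWeight_le_one (gradient u x))
    rw [le_div_iff₀ (by linarith)]
    nlinarith
  · exact abs_fderiv_weightedRhs_fst_le (hf2 x hx') (hω2 _ (hmem x (subset_closure hx')).2)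
      (hdx x hx')
  · intro w
    have hz := hmem x (subset_closure hx')
    have hω' := hω2 _ hz.2
    have hΦ : |f (x, gradient u x) + c| ≤ Φ := abs_le.2 ⟨by linarith [hfR _ hz], hfΦ _ hz⟩
    have hC := hC2.2 _ hz
    refine (abs_fderiv_weightedRhs_snd_le (hf2 x hx') hω' hW (hω _ hz.2).1 hΦ hC.2.1 w).trans ?_
    gcongr
    nlinarith
  · have hz := hmem x (subset_closure hx')
    have hω' := hω2 _ hz.2
    have hΦ : |f (x, gradient u x) + c| ≤ Φ := abs_le.2 ⟨by linarith [hfR _ hz], hfΦ _ hz⟩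
    have hC := hC2.2 _ hz
    exact fderiv_fderiv_weightedRhs_le (hf2 x hx') hω' hW (hω _ hz.2).1 (hω _ hz.2).2 hΦ hC.2.1
      hC.2.2 (hx x hz.1 _ hz.2) (hxp x hz.1 _ hz.2) (ConvexPotential.closure_mem_nhds D1 hx')
      (hA.2 _ hz.2)
  · rw [P.fderivWithin_gradient D1 hx]
    exact P.inner_pos hx hv

lemma exists_norm_sq_le_of_subset_ball {s : Set (Euc n)} (hs : IsCompact s) (hne : s.Nonempty)
    (h : s ⊆ Metric.ball (0 : Euc n) 1) : ∃ ρ < 1, ∀ p ∈ s, ‖p‖ ^ 2 ≤ ρ := by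
  obtain ⟨q, hq, hmax⟩ := hs.exists_isMaxOn hne (f := fun p : Euc n => ‖p‖ ^ 2)
    (by fun_prop)
  have hq1 : ‖q‖ < 1 := by simpa using h hq
  exact ⟨‖q‖ ^ 2, by nlinarith [norm_nonneg q], fun p hp => hmax hp⟩

theorem statement_19 {n : ℕ} (hn : 2 ≤ n)
    (Ω Ωt : Set (Euc n)) (ht h : Euc n → ℝ) (θt θ : ℝ)
    (hdom : DomainSetup Ω Ωt ht h θt θ)
    (hball : closure Ωt ⊆ Metric.ball (0 : Euc n) 1)
    :
    ∀ K : ℝ, 0 < K →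
      ∃ ε C₃₆ : ℝ, 0 < ε ∧ 0 < C₃₆ ∧
        ∀ f : Euc n × Euc n → ℝ, InA Ω Ωt f → C2Bound Ω Ωt f K → OSCcond Ω Ωt f →
          DxBound Ω Ωt f ε → DxpBound Ω Ωt f ε →
        ∀ (c : ℝ) (u : Euc n → ℝ), IsSmoothSol Ω Ωt f c u →
        ∀ x ∈ closure Ω,
          MatLE (C₃₆⁻¹ • (1 : Matrix (Fin n) (Fin n) ℝ)) (Hess u x) ∧
          MatLE (Hess u x) (C₃₆ • (1 : Matrix (Fin n) (Fin n) ℝ)) := by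
  intro K hK
  have hn0 : 0 < n := by omega
  have hn' : (0 : ℝ) < n := by exact_mod_cast hn0
  obtain ⟨θ₀, M, D1, D2, B1, B2⟩ := hdom.exists_common
  obtain ⟨ρ, hρ1, hρ⟩ := exists_norm_sq_le_of_subset_ball D2.isCompact_closure D2.nonempty.closure
    hball
  obtain ⟨W, hW, hω⟩ := exists_cubeWeight_bound D2.isCompact_closure hball
  obtain ⟨y, hy⟩ := D1.nonempty
  obtain ⟨r, hr, hyr⟩ := Metric.nhds_basis_closedBall.mem_iff.1 (D1.isOpen.mem_nhds hy)
  set R : ℝ := (n / 2 : ℝ) * ((volume Ωt).toReal / (volume Ω).toReal) ^ ((1 : ℝ) / n) with hRdef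
  have hv1 : 0 < (volume Ω).toReal := ENNReal.toReal_pos
    (D1.isOpen.measure_pos volume D1.nonempty).ne' D1.isBounded.measure_lt_top.ne
  have hv2 : 0 < (volume Ωt).toReal := ENNReal.toReal_pos
    (D2.isOpen.measure_pos volume D2.nonempty).ne' D2.isBounded.measure_lt_top.ne
  have hR : 0 < R := by positivity
  set Φ : ℝ := n * (4 / r) / Real.sqrt (1 - ρ) ^ 3 + 2 * K with hΦ
  set κ : ℝ := Real.sqrt (1 - ρ) ^ 3 * R with hκ
  have hs : 0 < Real.sqrt (1 - ρ) ^ 3 := pow_pos (Real.sqrt_pos.2 (by linarith)) 3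
  have hM : 0 < M := by linarith [B1.one_le]
  have hθ := D1.pos
  have hρ' : 0 < 1 - ρ := by linarith
  set I := BVSol.invBound n θ₀ M ρ κ (Φ / (1 - ρ)) (W * Φ + 2 * W * K + K) with hI
  set m : ℝ := min 1 (θ₀ * ((1 - ρ) * κ ^ 2 / n) / (8 * M)) with hm
  have hmpos : 0 < m := lt_min one_pos (by positivity)
  refine ⟨m / (W + 1), max (max 1 I) (Φ / (1 - ρ)), by positivity,
    lt_max_of_lt_left (lt_max_of_lt_left one_pos), ?_⟩
  intro f hA hC2 hosc hx hxp c u hu x hxc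
  have hεm : (W + 1) * (m / (W + 1)) = m := by field_simp
  obtain ⟨δ, P⟩ := hu.convexPotential hn0
  have hfR : ∀ z ∈ closure Ω ×ˢ closure Ωt, R ≤ f z + c := fun z hz =>
    P.le_rhs D1 hu.2.2.1 hu.2.2.2.1 hu.2.2.2.2 hosc hz
  have hfΦ : ∀ z ∈ closure Ω ×ˢ closure Ωt, f z + c ≤ Φ := fun z hz =>
    P.rhs_le D1 hu.2.2.1 hu.2.2.2.1 hu.2.2.2.2 hρ hρ1 (fun z hz => (hC2.2 z hz).1)
      (fun z hz => hR.le.trans (hfR z hz)) hr hyr hz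
  have S := hu.bvSol hn0 D1 D2 B1 B2 hball hρ hρ1 hW hω hR hfR hfΦ hA hC2 hK.le hx hxp
    (by positivity) (by rw [hεm]; exact min_le_left _ _) (by
      rw [hεm]
      have h1 : m * (8 * M) ≤ θ₀ * ((1 - ρ) * κ ^ 2 / n) :=
        (le_div_iff₀ (by positivity)).1 (min_le_right _ _)
      linarith)
  have hq : ∀ v w, ⟪fderivWithin ℝ (gradient u) (closure Ω) x v, w⟫ =
      fderiv ℝ (fderiv ℝ u) x v w := fun v w => by
    rw [P.fderivWithin_gradient D1 hxc, P.inner_fderiv_gradient hxc]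
  have hsymm : ∀ v w, fderiv ℝ (fderiv ℝ u) x v w = fderiv ℝ (fderiv ℝ u) x w v := fun v w => by
    rw [← hq, ← hq, S.symm hxc, real_inner_comm]
  refine ⟨matLE_smul_one_hess hsymm fun v => ?_, matLE_hess_smul_one hsymm fun v => ?_⟩
  · rw [← hq]
    refine le_trans ?_ (S.lower_bound hxc v)
    have hI0 : 0 < I := S.invBound_pos
    have hle : I ≤ max (max 1 I) (Φ / (1 - ρ)) :=
      le_max_of_le_left (le_max_right _ _)
    gcongr
  · rw [← hq]
    refine (S.inner_le hxc v).trans ?_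
    gcongr
    exact le_max_right _ _

end
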